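/- Let (y₁, y₂) be a solution of the normalised Hamiltonian system, analytic on a finite-length curve γ ending in a movable singularity z_∞, such that 1/y₁ and 1/y₂ are bounded on γ. Then, after a possible deformation of γ (with the same endpoint z_∞) in the region where (y₁, y₂) is analytic, one obtains a finite-length curve γ̃ on which y₂^k / y₁^l is bounded for all integers k, l ≥ 0 satisfying l(N+1) − k(M+1) ≥ 0. -/

import Mathlib

open scoped Topology
open Filter

/-- The index set `I = {(i,j) ∈ ℕ² : i(N+1) + j(M+1) < (N+1)(M+1)}`. -/
def idxI (M N : ℕ) : Finset (ℕ × ℕ) :=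
  (Finset.range (M + 2) ×ˢ Finset.range (N + 2)).filter
    fun p => p.1 * (N + 1) + p.2 * (M + 1) < (N + 1) * (M + 1)

/-- The index set `I' = I \ {(0,N)}`. -/
def idxI' (M N : ℕ) : Finset (ℕ × ℕ) := (idxI M N).erase (0, N)

/-- Right-hand side of the first equation of the normalised Hamiltonian system. -/
noncomputable def Fn₁ (M N : ℕ) (α : ℕ × ℕ → ℂ → ℂ) (z y₁ y₂ : ℂ) : ℂ :=
  ((N : ℂ) + 1) * y₂ ^ N +
    ∑ p ∈ idxI' M N, (p.2 : ℂ) * α p z * y₁ ^ p.1 * y₂ ^ (p.2 - 1)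

/-- Right-hand side of the second equation of the normalised Hamiltonian system. -/
noncomputable def Fn₂ (M N : ℕ) (α : ℕ × ℕ → ℂ → ℂ) (z y₁ y₂ : ℂ) : ℂ :=
  -(((M : ℂ) + 1) * y₁ ^ M) -
    ∑ p ∈ idxI' M N, (p.1 : ℂ) * α p z * y₁ ^ (p.1 - 1) * y₂ ^ p.2

namespace SCM
open Asymptotics

/-- continuous `f` on `[a,b]` with `exp f` constant has equal end values -/
theorem exp_const {f : ℝ → ℂ} {a b : ℝ} (hab : a ≤ b) (hf : ContinuousOn f (Set.Icc a b))
    (h : ∀ s ∈ Set.Icc a b, Complex.exp (f s) = Complex.exp (f a)) : f b = f a := by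
  have hc : ContinuousOn (fun s => (f s - f a).im / (2 * Real.pi)) (Set.Icc a b) :=
    (Complex.continuous_im.comp_continuousOn (hf.sub continuousOn_const)).div_const _
  have hn : ∀ s ∈ Set.Icc a b, ∃ n : ℤ, f s = f a + n * (2 * Real.pi * Complex.I) :=
    fun s hs => Complex.exp_eq_exp_iff_exists_int.1 (h s hs)
  obtain ⟨n, hn'⟩ := hn b (Set.right_mem_Icc.2 hab)
  have hpi := Real.pi_pos
  have hval : ∀ s (m : ℤ), f s = f a + m * (2 * Real.pi * Complex.I) →
      (f s - f a).im / (2 * Real.pi) = m := by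
    intro s m hm
    rw [hm]; simp
  by_contra hne
  have hn0 : n ≠ 0 := by
    rintro rfl; apply hne; simpa using hn'
  have hb := hval b n hn'
  have ha : (f a - f a).im / (2 * Real.pi) = 0 := by simp
  have key : ∀ x : ℝ, (∃ s ∈ Set.Icc a b, (f s - f a).im / (2 * Real.pi) = x) → ∃ m : ℤ, x = m := by
    rintro x ⟨s, hs, rfl⟩
    obtain ⟨m, hm⟩ := hn s hs
    exact ⟨m, hval s m hm⟩
  rcases lt_or_gt_of_ne hn0 with h0 | h0
  · have := intermediate_value_Icc' hab hc
    have hm : (-(1/2) : ℝ) ∈ Set.Icc ((f b - f a).im / (2 * Real.pi)) ((f a - f a).im / (2 * Real.pi)) := by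
      rw [hb, ha]; constructor
      · have : (n : ℝ) ≤ -1 := by exact_mod_cast Int.le_sub_one_of_lt h0
        linarith
      · norm_num
    obtain ⟨s, hs, hs'⟩ := this hm
    obtain ⟨m, hm⟩ := key _ ⟨s, hs, hs'⟩
    have h2 : ((2 * m : ℤ) : ℝ) = ((-1 : ℤ) : ℝ) := by push_cast; linarith
    have h3 : 2 * m = -1 := by exact_mod_cast h2
    omega
  · have := intermediate_value_Icc hab hc
    have hm : ((1/2) : ℝ) ∈ Set.Icc ((f a - f a).im / (2 * Real.pi)) ((f b - f a).im / (2 * Real.pi)) := by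
      rw [hb, ha]; constructor
      · norm_num
      · have : (1 : ℝ) ≤ n := by exact_mod_cast h0
        linarith
    obtain ⟨s, hs, hs'⟩ := this hm
    obtain ⟨m, hm⟩ := key _ ⟨s, hs, hs'⟩
    have h2 : ((2 * m : ℤ) : ℝ) = ((1 : ℤ) : ℝ) := by push_cast; linarith
    have h3 : 2 * m = 1 := by exact_mod_cast h2
    omega

theorem exp_diff_const {f g : ℝ → ℂ} {a b : ℝ} (hab : a ≤ b) (hf : ContinuousOn f (Set.Icc a b))
    (hg : ContinuousOn g (Set.Icc a b)) (c : ℂ)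
    (h : ∀ s ∈ Set.Icc a b, Complex.exp (f s) = c * Complex.exp (g s)) : f b - f a = g b - g a := by
  have := exp_const (f := fun s => f s - g s) hab (hf.sub hg) (by
    intro s hs
    have ha : a ∈ Set.Icc a b := ⟨le_rfl, hab⟩
    rw [Complex.exp_sub, Complex.exp_sub, h s hs, h a ha, mul_div_assoc, mul_div_assoc,
      div_self (Complex.exp_ne_zero _), div_self (Complex.exp_ne_zero _)])
  linear_combination this

/-- Continuous logarithm of a nonvanishing function on the plane. -/
theorem exists_log_of_continuous {X : Type*} [NormedAddCommGroup X] [NormedSpace ℝ X]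
    {g : X → ℂ} (hg : Continuous g) (h0 : ∀ x, g x ≠ 0) :
    ∃ f : X → ℂ, Continuous f ∧ ∀ x, Complex.exp (f x) = g x := by
  have hs : IsSimplyConnected (Set.univ : Set X) :=
    (Homeomorph.Set.univ X).toHomotopyEquiv.simplyConnectedSpace
  obtain ⟨f, hf, he⟩ := Complex.exists_continuousOn_eqOn_exp_comp hs
    isOpen_univ (g := g) hg.continuousOn (by rintro ⟨x, -, hx⟩; exact h0 x hx)
  exact ⟨f, continuousOn_univ.1 hf, fun x => he (Set.mem_univ x)⟩

theorem crossing_cont {G : ℝ → ℂ} (hG : Continuous G) {a b T : ℝ} (hab : a ≤ b)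
    (hT : 0 < T) (hT' : T < (G b).im - (G a).im)
    (h1 : ∀ s t, G t ≠ G s + T * Complex.I)
    (h2 : ∀ t x : ℝ, 0 ≤ x → G t ≠ G a + T * Complex.I + x)
    (h3 : ∀ t x : ℝ, 0 ≤ x → G t ≠ G b - T * Complex.I + x) : False := by
  obtain ⟨l, hl, hle⟩ := exists_log_of_continuous (X := ℝ × ℝ)
    (g := fun p => G p.2 - G p.1 - T * Complex.I) (by fun_prop)
    (fun p hp => h1 p.1 p.2 (by linear_combination hp))
  have hd : l (b, b) = l (a, a) := by
    apply exp_const (f := fun s => l (s, s)) hab (by fun_prop)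
    intro s hs
    simp [hle]
  have hs1 : ∀ t, -(G t - G a - T * Complex.I) ∈ Complex.slitPlane := by
    intro t
    rw [Complex.mem_slitPlane_iff]
    by_contra hcon
    push Not at hcon
    obtain ⟨hre, him⟩ := hcon
    apply h2 t (G t - G a - T * Complex.I).re (by simpa using hre)
    apply Complex.ext
    · simp
    · simp at him ⊢; linarith
  have hs2 : ∀ s, (G b - G s - T * Complex.I) ∈ Complex.slitPlane := by
    intro t
    rw [Complex.mem_slitPlane_iff]
    by_contra hcon
    push Not at hcon
    obtain ⟨hre, him⟩ := hcon
    apply h3 t (-(G b - G t - T * Complex.I).re) (by linarith)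
    apply Complex.ext
    · simp
    · simp at him ⊢; linarith
  have e1 := exp_diff_const (f := fun t => l (a, t)) (g := fun t => Complex.log (-(G t - G a - T * Complex.I)))
    hab (by fun_prop) (by
      apply Continuous.continuousOn
      exact Continuous.clog (by fun_prop) hs1) (-1) (by
      intro s hs
      rw [Complex.exp_log (Complex.slitPlane_ne_zero (hs1 s)), hle]; ring)
  have e2 := exp_diff_const (f := fun t => l (t, b)) (g := fun t => Complex.log (G b - G t - T * Complex.I))
    hab (by fun_prop) (by
      apply Continuous.continuousOn
      exact Continuous.clog (by fun_prop) hs2) 1 (by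
      intro s hs
      rw [Complex.exp_log (Complex.slitPlane_ne_zero (hs2 s)), hle]; ring)
  have hw : 0 < (G b - G a - T * Complex.I).im := by simp; linarith
  set w := G b - G a - T * Complex.I with hwdef
  have a1 : (Complex.log (-w)).im = (Complex.log w).im - Real.pi := by
    rw [Complex.log_im, Complex.log_im, Complex.arg_neg_eq_arg_sub_pi_of_im_pos hw]
  have a2 : (Complex.log (-(G a - G a - T * Complex.I))).im = Real.pi / 2 := by
    rw [Complex.log_im]
    have : -(G a - G a - T * Complex.I) = (T : ℂ) * Complex.I := by ring
    rw [this, Complex.arg_real_mul _ hT, Complex.arg_I]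
  have a3 : (Complex.log (G b - G b - T * Complex.I)).im = -(Real.pi / 2) := by
    rw [Complex.log_im]
    have : (G b - G b - T * Complex.I) = (T : ℂ) * (-Complex.I) := by ring
    rw [this, Complex.arg_real_mul _ hT, Complex.arg_neg_I]
  have e1' := congrArg Complex.im e1
  have e2' := congrArg Complex.im e2
  have hd' := congrArg Complex.im hd
  simp only [Complex.sub_im] at e1' e2'
  rw [a1] at e1'
  rw [a2] at e1'
  rw [a3] at e2'
  have := Real.pi_pos
  linarith

theorem crossing {G : ℝ → ℂ} {a b T : ℝ} (hab : a ≤ b) (hG : ContinuousOn G (Set.Icc a b))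
    (hT : 0 < T) (hT' : T < (G b).im - (G a).im) :
    (∃ s ∈ Set.Icc a b, ∃ t ∈ Set.Icc a b, G t = G s + T * Complex.I) ∨
    (∃ t ∈ Set.Icc a b, (G t).im = (G a).im + T ∧ (G a).re ≤ (G t).re) ∨
    (∃ t ∈ Set.Icc a b, (G t).im = (G b).im - T ∧ (G b).re ≤ (G t).re) := by
  by_contra hcon
  push Not at hcon
  obtain ⟨h1, h2, h3⟩ := hcon
  have hp : ∀ s, ((Set.projIcc a b hab s : Set.Icc a b) : ℝ) ∈ Set.Icc a b := fun s => (Set.projIcc a b hab s).2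
  have pa : ((Set.projIcc a b hab a : Set.Icc a b) : ℝ) = a := by simp
  have pb : ((Set.projIcc a b hab b : Set.Icc a b) : ℝ) = b := by simp
  refine crossing_cont (G := fun s => G (Set.projIcc a b hab s)) (a := a) (b := b) (T := T) ?_ hab hT
    (by simpa using hT') ?_ ?_ ?_
  · exact hG.comp_continuous (by fun_prop) hp
  · intro s t
    exact h1 _ (hp s) _ (hp t)
  · intro t x hx h
    simp only [pa] at h
    have := h2 _ (hp t) (by rw [h]; simp)
    rw [h] at this
    simp at this; linarith
  · intro t x hx h
    simp only [pb] at h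
    have := h3 _ (hp t) (by rw [h]; simp)
    rw [h] at this
    simp at this; linarith

/-- Gap lemma (real induction along a closed set `K`). -/
theorem gapInduction {H : ℝ → ℂ} {L : ℝ → ℝ} {K : Set ℝ} {a b C : ℝ}
    (hH : ContinuousOn H (Set.Icc a b)) (hL : MonotoneOn L (Set.Icc a b)) (hC : 0 ≤ C)
    (hK : ∀ t ∈ Set.Icc a b, t ∉ K → ∀ᶠ t' in 𝓝[Set.Icc a b] t, t' ∉ K) (haK : a ∈ K)
    (hloc : ∀ t ∈ K, a ≤ t → t < b → ‖H t - H a‖ ≤ C * (L t - L a) →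
      ∀ᶠ t' in 𝓝[>] t, ‖H t' - H t‖ ≤ C * (L t' - L t))
    (hgap : ∀ t ∈ K, ∀ t' ∈ K, a ≤ t → t < t' → t' ≤ b → (∀ x, t < x → x < t' → x ∉ K) →
      ‖H t - H a‖ ≤ C * (L t - L a) → ‖H t' - H t‖ ≤ C * (L t' - L t)) :
    ∀ t ∈ K, a ≤ t → t ≤ b → ‖H t - H a‖ ≤ C * (L t - L a) := by
  intro t₁ ht₁K hat₁ ht₁b
  by_contra hcon
  have hadd : ∀ t t', ‖H t - H a‖ ≤ C * (L t - L a) → ‖H t' - H t‖ ≤ C * (L t' - L t) →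
      ‖H t' - H a‖ ≤ C * (L t' - L a) := by
    intro t t' h h'
    have : H t' - H a = (H t' - H t) + (H t - H a) := by ring
    rw [this]
    refine (norm_add_le _ _).trans ?_
    linarith
  have hclosed : ∀ t ∈ Set.Icc a b, (∀ ε > 0, ∃ t' ∈ K, t' ∈ Set.Icc a b ∧ |t' - t| < ε) → t ∈ K := by
    intro t ht h
    by_contra hn
    have := hK t ht hn
    rw [eventually_nhdsWithin_iff, Metric.eventually_nhds_iff] at this
    obtain ⟨ε, hε, h'⟩ := this
    obtain ⟨t', h1, h2, h3⟩ := h ε hε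
    exact h' (by simpa [Real.dist_eq] using h3) h2 h1
  set S : Set ℝ := {t | t ∈ K ∧ a ≤ t ∧ t ≤ t₁ ∧ ∀ t' ∈ K, a ≤ t' → t' ≤ t → ‖H t' - H a‖ ≤ C * (L t' - L a)} with hS
  have haS : a ∈ S := by
    refine ⟨haK, le_rfl, hat₁, ?_⟩
    intro t' _ h1 h2
    have : t' = a := le_antisymm h2 h1
    subst this; simp
  have hbdd : BddAbove S := ⟨t₁, fun t ht => ht.2.2.1⟩
  set σ := sSup S with hσ
  have haσ : a ≤ σ := le_csSup hbdd haS
  have hσt : σ ≤ t₁ := csSup_le ⟨a, haS⟩ fun t ht => ht.2.2.1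
  have happ : ∀ ε > 0, ∃ t ∈ S, σ - ε < t ∧ t ≤ σ := by
    intro ε hε
    obtain ⟨t, ht, h⟩ := exists_lt_of_lt_csSup ⟨a, haS⟩ (show σ - ε < sSup S by linarith)
    exact ⟨t, ht, h, le_csSup hbdd ht⟩
  have hσI : σ ∈ Set.Icc a b := ⟨haσ, hσt.trans ht₁b⟩
  have hσK : σ ∈ K := by
    apply hclosed σ hσI
    intro ε hε
    obtain ⟨t, ht, h1, h2⟩ := happ ε hε
    exact ⟨t, ht.1, ⟨ht.2.1, ht.2.2.1.trans ht₁b⟩, by rw [abs_lt]; constructor <;> linarith⟩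
  have hlow : ∀ t' ∈ K, a ≤ t' → t' < σ → ‖H t' - H a‖ ≤ C * (L t' - L a) := by
    intro t' hK' h1 h2
    obtain ⟨t, ht, h3, h4⟩ := happ (σ - t') (by linarith)
    exact ht.2.2.2 t' hK' h1 (by linarith)
  have hPσ : ‖H σ - H a‖ ≤ C * (L σ - L a) := by
    apply le_of_forall_pos_le_add
    intro ε hε
    have hc := hH σ hσI
    rw [Metric.continuousWithinAt_iff] at hc
    obtain ⟨δ, hδ, hc⟩ := hc ε hε
    obtain ⟨t, ht, h1, h2⟩ := happ δ hδ
    have htI : t ∈ Set.Icc a b := ⟨ht.2.1, ht.2.2.1.trans ht₁b⟩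
    have h3 := ht.2.2.2 t ht.1 ht.2.1 le_rfl
    have h4 := hc htI (by rw [Real.dist_eq, abs_lt]; constructor <;> linarith)
    have h5 := hL htI hσI h2
    rw [dist_comm, dist_eq_norm] at h4
    have : H σ - H a = (H σ - H t) + (H t - H a) := by ring
    rw [this]
    refine (norm_add_le _ _).trans ?_
    nlinarith
  have hσS : σ ∈ S := by
    refine ⟨hσK, haσ, hσt, ?_⟩
    intro t' hK' h1 h2
    rcases h2.lt_or_eq with h | h
    · exact hlow t' hK' h1 h
    · rw [h]; exact hPσ
  have hσlt : σ < t₁ := by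
    rcases hσt.lt_or_eq with h | h
    · exact h
    · exact absurd (h ▸ hPσ) hcon
  have hnot : ∀ t ∈ S, t ≤ σ := fun t ht => le_csSup hbdd ht
  set R : Set ℝ := {t | t ∈ K ∧ σ < t ∧ t ≤ t₁} with hR
  have ht₁R : t₁ ∈ R := ⟨ht₁K, hσlt, le_rfl⟩
  have hRb : BddBelow R := ⟨σ, fun t ht => ht.2.1.le⟩
  set θ := sInf R with hθ
  have hθ1 : θ ≤ t₁ := csInf_le hRb ht₁R
  have hσθ : σ ≤ θ := le_csInf ⟨_, ht₁R⟩ fun t ht => ht.2.1.le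
  have happ' : ∀ ε > 0, ∃ t ∈ R, t < θ + ε ∧ θ ≤ t := by
    intro ε hε
    obtain ⟨t, ht, h⟩ := exists_lt_of_csInf_lt ⟨_, ht₁R⟩ (show sInf R < θ + ε by linarith)
    exact ⟨t, ht, h, csInf_le hRb ht⟩
  rcases hσθ.lt_or_eq with hlt | heq
  · have hθK : θ ∈ K := by
      apply hclosed θ ⟨by linarith, by linarith⟩
      intro ε hε
      obtain ⟨t, ht, h1, h2⟩ := happ' ε hε
      exact ⟨t, ht.1, ⟨by linarith [ht.2.1], by linarith [ht.2.2]⟩, by rw [abs_lt]; constructor <;> linarith⟩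
    have hno : ∀ x, σ < x → x < θ → x ∉ K := by
      intro x h1 h2 hx
      have : θ ≤ x := csInf_le hRb ⟨hx, h1, by linarith⟩
      linarith
    have hP := hadd _ _ hPσ (hgap σ hσK θ hθK haσ hlt (by linarith) hno hPσ)
    have : θ ∈ S := by
      refine ⟨hθK, by linarith, hθ1, ?_⟩
      intro t' hK' h1 h2
      rcases h2.lt_or_eq with h | h
      · rcases le_or_gt t' σ with h' | h'
        · exact hσS.2.2.2 t' hK' h1 h'
        · exact absurd hK' (hno t' h' h)
      · rw [h]; exact hP
    linarith [hnot θ this]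
  · have := hloc σ hσK haσ (by linarith) hPσ
    rw [eventually_nhdsWithin_iff, Metric.eventually_nhds_iff] at this
    obtain ⟨ε, hε, h⟩ := this
    obtain ⟨t, ht, h1, h2⟩ := happ' ε hε
    rw [← heq] at h1
    have : t ∈ S := by
      refine ⟨ht.1, by linarith [ht.2.1], ht.2.2, ?_⟩
      intro t' hK' h3 h4
      rcases le_or_gt t' σ with h' | h'
      · exact hσS.2.2.2 t' hK' h3 h'
      · exact hadd _ _ hPσ (h (by rw [Real.dist_eq, abs_lt]; constructor <;> linarith) h')
    linarith [hnot t this, ht.2.1]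

/-- Path lemma: bounded local growth implies global bound. -/
theorem pathLemma {H : ℝ → ℂ} {L : ℝ → ℝ} {a b C : ℝ} (hab : a ≤ b)
    (hH : ContinuousOn H (Set.Icc a b)) (hL : MonotoneOn L (Set.Icc a b)) (hC : 0 ≤ C)
    (hloc : ∀ t, a ≤ t → t < b → ∀ᶠ t' in 𝓝[>] t, ‖H t' - H t‖ ≤ C * (L t' - L t)) :
    ‖H b - H a‖ ≤ C * (L b - L a) := by
  apply gapInduction (K := Set.univ) hH hL hC (by simp) (Set.mem_univ _) _ _ b (Set.mem_univ _) hab le_rfl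
  · intro t _ h1 h2 _
    exact hloc t h1 h2
  · intro t _ t' _ _ h1 _ h2 _
    exact absurd (Set.mem_univ _) (h2 ((t + t') / 2) (by linarith) (by linarith))

end SCM

namespace SCM
open Asymptotics

theorem windStep {ω g : ℝ → ℂ} {L : ℝ → ℝ} {a t μ : ℝ} (hat : a ≤ t)
    (hω : ContinuousOn ω (Set.Icc a t)) (hg : ∀ s ∈ Set.Icc a t, Complex.exp (ω s) = g s)
    (hL : ∀ s ∈ Set.Icc a t, ‖g s - g a‖ ≤ L t - L a)
    (hμ : 0 < μ) (ha : μ ≤ ‖g a‖) (h1 : 1 ≤ (ω t).im - (ω a).im) :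
    μ / 10 ≤ L t - L a := by
  by_contra hcon
  push Not at hcon
  have haI : a ∈ Set.Icc a t := ⟨le_rfl, hat⟩
  have htI : t ∈ Set.Icc a t := ⟨hat, le_rfl⟩
  have ha0 : g a ≠ 0 := by rw [← hg a haI]; exact Complex.exp_ne_zero _
  have hna : 0 < ‖g a‖ := norm_pos_iff.2 ha0
  have hsm : ∀ s ∈ Set.Icc a t, ‖(g s - g a) / g a‖ ≤ 1 / 10 := by
    intro s hs
    rw [norm_div, div_le_iff₀ hna]
    linarith [hL s hs]
  have hx : ∀ s, 1 + (g s - g a) / g a = g s / g a := by intro s; field_simp; ring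
  have hgc : ContinuousOn g (Set.Icc a t) := by
    apply ContinuousOn.congr (Complex.continuous_exp.comp_continuousOn hω)
    intro s hs; exact (hg s hs).symm
  have hslit : ∀ s ∈ Set.Icc a t, 1 + (g s - g a) / g a ∈ Complex.slitPlane := by
    intro s hs
    apply Complex.mem_slitPlane_of_norm_lt_one
    linarith [hsm s hs]
  have := exp_diff_const (f := ω) (g := fun s => Complex.log (1 + (g s - g a) / g a)) hat hω
    (by
      apply ContinuousOn.clog _ hslit
      exact continuousOn_const.add ((hgc.sub continuousOn_const).div_const _)) (g a)
    (by
      intro s hs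
      rw [Complex.exp_log (Complex.slitPlane_ne_zero (hslit s hs)), hx, hg s hs]; field_simp)
  simp at this
  have h2 := Complex.norm_log_one_add_half_le_self (z := (g t - g a) / g a)
    (by linarith [hsm t htI])
  rw [← this] at h2
  have h3 := Complex.abs_im_le_norm (ω t - ω a)
  have h4 := le_abs_self (ω t - ω a).im
  rw [Complex.sub_im] at h4
  have := hsm t htI
  simp only [Complex.sub_im] at h3
  linarith

theorem windCount {g : ℝ → ℂ} {L : ℝ → ℝ} {μ T : ℝ} (hμ : 0 < μ) (hT : 1 ≤ T) (n : ℕ) :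
    ∀ (ω : ℝ → ℂ) (a b : ℝ), a ≤ b → ContinuousOn ω (Set.Icc a b) →
    (∀ s ∈ Set.Icc a b, Complex.exp (ω s) = g s) →
    (∀ s ∈ Set.Icc a b, ∀ t ∈ Set.Icc a b, s ≤ t → ‖g t - g s‖ ≤ L t - L s) →
    (∀ s ∈ Set.Icc a b, ∀ t ∈ Set.Icc a b, ω t ≠ ω s + T * Complex.I) →
    μ ≤ ‖g a‖ → μ ≤ ‖g b‖ → n * T < (ω b).im - (ω a).im → n * (μ / 10) ≤ L b - L a := by
  induction n with
  | zero =>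
    intro ω a b hab hω hg hL hno ha hb h
    have := hL a ⟨le_rfl, hab⟩ b ⟨hab, le_rfl⟩ hab
    simp
    linarith [norm_nonneg (g b - g a)]
  | succ n ih =>
    intro ω a b hab hω hg hL hno ha hb h
    push_cast at h
    have hnT : 0 ≤ (n : ℝ) * T := by positivity
    have hstep : ∀ t ∈ Set.Icc a b, μ ≤ ‖g t‖ → ∀ t' ∈ Set.Icc a b, t ≤ t' →
        (ω t').im = (ω t).im + T → μ / 10 ≤ L t' - L t := by
      intro t ht hμt t' ht' htt him
      have hsub : Set.Icc t t' ⊆ Set.Icc a b := Set.Icc_subset_Icc ht.1 ht'.2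
      apply windStep htt (hω.mono hsub) (fun s hs => hg s (hsub hs)) _ hμ hμt (by linarith)
      intro s hs
      have h1 := hL t ht s (hsub hs) hs.1
      have h2 := hL s (hsub hs) t' ht' hs.2
      linarith [norm_nonneg (g t' - g s)]
    have haI : a ∈ Set.Icc a b := ⟨le_rfl, hab⟩
    have hbI : b ∈ Set.Icc a b := ⟨hab, le_rfl⟩
    have hng : ∀ t ∈ Set.Icc a b, ‖g t‖ = Real.exp (ω t).re := by
      intro t ht; rw [← hg t ht, Complex.norm_exp]
    rcases crossing hab hω (by linarith : (0:ℝ) < T) (by linarith) with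
      ⟨s, hs, t, ht, h1⟩ | ⟨t, ht, him, hre⟩ | ⟨t, ht, him, hre⟩
    · exact absurd h1 (hno s hs t ht)
    · have hμt : μ ≤ ‖g t‖ := by
        rw [hng t ht]; rw [hng a haI] at ha
        exact ha.trans (Real.exp_le_exp.2 hre)
      have hsub : Set.Icc t b ⊆ Set.Icc a b := Set.Icc_subset_Icc ht.1 le_rfl
      have e1 := ih ω t b ht.2 (hω.mono hsub) (fun s hs => hg s (hsub hs))
        (fun s hs t ht => hL s (hsub hs) t (hsub ht)) (fun s hs t ht => hno s (hsub hs) t (hsub ht))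
        hμt hb (by linarith)
      have e2 := hstep a haI ha t ht ht.1 him
      push_cast
      linarith
    · have hμt : μ ≤ ‖g t‖ := by
        rw [hng t ht]; rw [hng b hbI] at hb
        exact hb.trans (Real.exp_le_exp.2 hre)
      have hsub : Set.Icc a t ⊆ Set.Icc a b := Set.Icc_subset_Icc le_rfl ht.2
      have e1 := ih ω a t ht.1 (hω.mono hsub) (fun s hs => hg s (hsub hs))
        (fun s hs t ht => hL s (hsub hs) t (hsub ht)) (fun s hs t ht => hno s (hsub hs) t (hsub ht))
        ha hμt (by linarith)
      have e2 := hstep t ht hμt b hbI ht.2 (by linarith)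
      push_cast
      linarith

theorem windBound {g ω : ℝ → ℂ} {L : ℝ → ℝ} {a b μ T : ℝ} (hμ : 0 < μ) (hT : 1 ≤ T)
    (hab : a ≤ b) (hω : ContinuousOn ω (Set.Icc a b))
    (hg : ∀ s ∈ Set.Icc a b, Complex.exp (ω s) = g s)
    (hL : ∀ s ∈ Set.Icc a b, ∀ t ∈ Set.Icc a b, s ≤ t → ‖g t - g s‖ ≤ L t - L s)
    (hno : ∀ s ∈ Set.Icc a b, ∀ t ∈ Set.Icc a b, ω t ≠ ω s + T * Complex.I)
    (ha : μ ≤ ‖g a‖) (hb : μ ≤ ‖g b‖) :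
    |(ω b).im - (ω a).im| ≤ T * ((L b - L a) / (μ / 10) + 1) := by
  have hl : 0 ≤ L b - L a := (norm_nonneg _).trans (hL a ⟨le_rfl, hab⟩ b ⟨hab, le_rfl⟩ hab)
  have hd : 0 < μ / 10 := by positivity
  have main : ∀ x : ℝ, (∀ n : ℕ, n * T < x → n * (μ / 10) ≤ L b - L a) →
      x ≤ T * ((L b - L a) / (μ / 10) + 1) := by
    intro x hx
    by_contra hcon
    push Not at hcon
    set q := (L b - L a) / (μ / 10) with hq
    have hq0 : 0 ≤ q := by positivity
    have h1 := Nat.floor_le hq0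
    have h2 := Nat.lt_floor_add_one q
    have h3 := hx (⌊q⌋₊ + 1) (by push_cast; nlinarith)
    push_cast at h3
    rw [← le_div_iff₀ hd] at h3
    linarith
  rw [abs_le]
  constructor
  · have := main ((ω a).im - (ω b).im) (by
      intro n hn
      apply windCount (g := fun s => (starRingEnd ℂ) (g s)) (L := L) hμ hT n
        (fun s => (starRingEnd ℂ) (ω s)) a b hab (Complex.continuous_conj.comp_continuousOn hω)
      · intro s hs; rw [← hg s hs, Complex.exp_conj]
      · intro s hs t ht hst
        rw [← map_sub, Complex.norm_conj]; exact hL s hs t ht hst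
      · intro s hs t ht h
        apply hno t ht s hs
        have h' := congrArg (starRingEnd ℂ) h
        simp at h'
        rw [h']; ring
      · rwa [Complex.norm_conj]
      · rwa [Complex.norm_conj]
      · simp; linarith)
    linarith
  · exact main _ fun n hn => windCount hμ hT n ω a b hab hω hg hL hno ha hb hn

theorem norm_exp_nat_mul (τ : ℕ) (x : ℂ) : ‖Complex.exp (τ * x)‖ = ‖Complex.exp x‖ ^ τ := by
  rw [Complex.exp_nat_mul, norm_pow]

/-- Abstract chord estimate. -/
theorem chordEst {γ lam H : ℝ → ℂ} {L : ℝ → ℝ} {a b m K : ℝ} {A p c C : ℂ} {τ q N1 : ℕ}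
    (hab : a ≤ b) (hγ : ContinuousOn γ (Set.Icc a b)) (hlam : ContinuousOn lam (Set.Icc a b))
    (hL : ∀ s ∈ Set.Icc a b, ∀ t ∈ Set.Icc a b, s ≤ t → ‖γ t - γ s‖ ≤ L t - L s)
    (hτ : 1 ≤ τ) (hq : 1 ≤ q) (hA : A ≠ 0) (hN1 : 1 ≤ N1) (hNτ : N1 ≤ τ)
    (h1 : ∀ s ∈ Set.Icc a b, ‖γ s - p - A * Complex.exp (τ * lam s)‖
      ≤ 1 / 100 * ‖A * Complex.exp (τ * lam s)‖)
    (hm : 0 < m) (hma : m ≤ ‖Complex.exp (lam a)‖) (hmb : m ≤ ‖Complex.exp (lam b)‖)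
    (ha1 : ‖Complex.exp (lam a)‖ ≤ 1) (hb1 : ‖Complex.exp (lam b)‖ ≤ 1)
    (hHa : ‖H a - C - c * lam a‖ ≤ K * (m⁻¹) ^ q) (hHb : ‖H b - C - c * lam b‖ ≤ K * (m⁻¹) ^ q)
    (hc : ‖c‖ ≤ K)
    (hN : ∀ s ∈ Set.Icc a b, ∀ t ∈ Set.Icc a b, γ s = γ t →
      ∃ n : ℤ, N1 * (lam t - lam s) = n * (2 * Real.pi * Complex.I))
    (hcz : ∀ s ∈ Set.Icc a b, ∀ t ∈ Set.Icc a b, γ s = γ t →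
      lam t - lam s = 2 * Real.pi * Complex.I → c = 0) :
    ‖H b - H a‖ ≤ K * (200 / ‖A‖ * (m⁻¹) ^ τ * (L b - L a) + 20 * (m⁻¹) ^ q) := by
  have hpi := Real.pi_pos
  have hpi4 := Real.pi_lt_four
  have hpi3 := Real.pi_gt_three
  have haI : a ∈ Set.Icc a b := ⟨le_rfl, hab⟩
  have hbI : b ∈ Set.Icc a b := ⟨hab, le_rfl⟩
  have hK : 0 ≤ K := (norm_nonneg _).trans hc
  have hnA : 0 < ‖A‖ := norm_pos_iff.2 hA
  have hm1 : m ≤ 1 := hma.trans ha1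
  have hl : 0 ≤ L b - L a := (norm_nonneg _).trans (hL a haI b hbI hab)
  have hmq : 1 ≤ (m⁻¹) ^ q := one_le_pow₀ ((one_le_inv₀ hm).2 hm1)
  have hmq' : m⁻¹ ≤ (m⁻¹) ^ q := le_self_pow₀ ((one_le_inv₀ hm).2 hm1) (by omega)
  have hmt : 0 < (m⁻¹) ^ τ := by positivity
  have hdec : H b - H a = (H b - C - c * lam b) - (H a - C - c * lam a) + c * (lam b - lam a) := by ring
  by_cases hc0 : c = 0
  · rw [hdec, hc0, zero_mul, zero_mul, zero_mul, add_zero]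
    rw [hc0, zero_mul] at hHa hHb
    refine (norm_sub_le _ _).trans ?_
    have : 0 ≤ 200 / ‖A‖ * (m⁻¹) ^ τ * (L b - L a) := by positivity
    nlinarith
  set e : ℝ → ℂ := fun s => (γ s - p) / (A * Complex.exp (τ * lam s)) - 1 with he
  have hne : ∀ s, A * Complex.exp (τ * lam s) ≠ 0 := fun s => mul_ne_zero hA (Complex.exp_ne_zero _)
  have hes : ∀ s ∈ Set.Icc a b, ‖e s‖ ≤ 1 / 100 := by
    intro s hs
    have : e s = (γ s - p - A * Complex.exp (τ * lam s)) / (A * Complex.exp (τ * lam s)) := by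
      rw [he]; field_simp [hne s]
    rw [this, norm_div, div_le_iff₀ (norm_pos_iff.2 (hne s))]
    exact h1 s hs
  have hslit : ∀ s ∈ Set.Icc a b, 1 + e s ∈ Complex.slitPlane := by
    intro s hs
    apply Complex.mem_slitPlane_of_norm_lt_one
    linarith [hes s hs]
  have hec : ContinuousOn e (Set.Icc a b) := by
    apply ContinuousOn.sub _ continuousOn_const
    apply ContinuousOn.div (hγ.sub continuousOn_const)
    · exact continuousOn_const.mul (Complex.continuous_exp.comp_continuousOn (continuousOn_const.mul hlam))
    · intro s hs; exact hne s
  set ω : ℝ → ℂ := fun s => τ * lam s + Complex.log (1 + e s) with hω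
  have hωc : ContinuousOn ω (Set.Icc a b) :=
    (continuousOn_const.mul hlam).add ((continuousOn_const.add hec).clog hslit)
  have hlog : ∀ s ∈ Set.Icc a b, ‖Complex.log (1 + e s)‖ ≤ 2 / 100 := by
    intro s hs
    have := Complex.norm_log_one_add_half_le_self (z := e s) (by linarith [hes s hs])
    linarith [hes s hs]
  have hexp : ∀ s ∈ Set.Icc a b, Complex.exp (ω s) = (γ s - p) / A := by
    intro s hs
    have h2 : Complex.exp (τ * lam s) ≠ 0 := Complex.exp_ne_zero _
    rw [hω, Complex.exp_add, Complex.exp_log (Complex.slitPlane_ne_zero (hslit s hs)), he]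
    field_simp
    ring
  have hτ0 : (0:ℝ) < τ := by exact_mod_cast hτ
  have hT1 : (1:ℝ) ≤ 2 * Real.pi * τ := by
    have : (1:ℝ) ≤ τ := by exact_mod_cast hτ
    nlinarith
  have hno : ∀ s ∈ Set.Icc a b, ∀ t ∈ Set.Icc a b, ω t ≠ ω s + (2 * Real.pi * τ : ℝ) * Complex.I := by
    intro s hs t ht h
    apply hc0
    have hγe : γ s = γ t := by
      have := hexp t ht
      rw [h, Complex.exp_add, hexp s hs] at this
      have h2 : Complex.exp ((2 * Real.pi * τ : ℝ) * Complex.I) = 1 := by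
        rw [Complex.exp_eq_one_iff]
        exact ⟨τ, by push_cast; ring⟩
      rw [h2, mul_one] at this
      field_simp at this
      linear_combination this
    obtain ⟨n, hn⟩ := hN s hs t ht hγe
    apply hcz s hs t ht hγe
    have hN0 : (N1 : ℂ) ≠ 0 := by exact_mod_cast (by omega : N1 ≠ 0)
    have key : ((2 * Real.pi * τ * ((n : ℝ) - N1) : ℝ) : ℂ) * Complex.I
        = N1 * (Complex.log (1 + e s) - Complex.log (1 + e t)) := by
      have h3 : (τ : ℂ) * lam t + Complex.log (1 + e t) = τ * lam s + Complex.log (1 + e s)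
        + (2 * Real.pi * τ : ℝ) * Complex.I := h
      push_cast at h3 ⊢
      linear_combination (-(τ : ℂ)) * hn + N1 * h3
    have hnorm := congrArg norm key
    rw [norm_mul, Complex.norm_I, mul_one, Complex.norm_real, norm_mul (N1 : ℂ), Complex.norm_natCast,
      Real.norm_eq_abs, abs_mul, abs_of_pos (by positivity : 0 < 2 * Real.pi * τ)] at hnorm
    have hb : ‖Complex.log (1 + e s) - Complex.log (1 + e t)‖ ≤ 4 / 100 :=
      (norm_sub_le _ _).trans (by linarith [hlog s hs, hlog t ht])
    have hNτ' : (N1 : ℝ) ≤ τ := by exact_mod_cast hNτ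
    have h5 : 2 * Real.pi * τ * |(n : ℝ) - N1| ≤ τ * (4 / 100) := by
      rw [hnorm]
      exact mul_le_mul hNτ' hb (norm_nonneg _) hτ0.le
    have h6 : |(n : ℝ) - N1| < 1 := by
      by_contra hcon
      push Not at hcon
      have : 2 * Real.pi * τ * 1 ≤ 2 * Real.pi * τ * |(n : ℝ) - N1| := by gcongr
      nlinarith
    have h7 : n - (N1 : ℤ) = 0 := by
      rw [← Int.abs_lt_one_iff]
      exact_mod_cast h6
    have h8 : n = N1 := by omega
    rw [h8] at hn
    have : (N1 : ℂ) * (lam t - lam s) = N1 * (2 * Real.pi * Complex.I) := by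
      rw [hn]; push_cast; ring
    exact mul_left_cancel₀ hN0 this
  have hgn : ∀ s ∈ Set.Icc a b, m ≤ ‖Complex.exp (lam s)‖ → m ^ τ / 2 ≤ ‖(γ s - p) / A‖ := by
    intro s hs hms
    have h3 := h1 s hs
    have h4 : ‖A * Complex.exp (τ * lam s)‖ - ‖γ s - p‖ ≤ ‖γ s - p - A * Complex.exp (τ * lam s)‖ := by
      rw [norm_sub_rev (γ s - p)]; exact norm_sub_norm_le _ _
    rw [norm_div, le_div_iff₀ hnA]
    have h5 : m ^ τ ≤ ‖Complex.exp (τ * lam s)‖ := by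
      rw [norm_exp_nat_mul]; gcongr
    rw [norm_mul] at h3 h4
    have h6 : m ^ τ * ‖A‖ ≤ ‖A‖ * ‖Complex.exp (τ * lam s)‖ := by
      rw [mul_comm]; gcongr
    have h7 : 0 ≤ m ^ τ * ‖A‖ := by positivity
    linarith
  have hw := windBound (g := fun s => (γ s - p) / A) (ω := ω) (L := fun s => L s / ‖A‖)
    (μ := m ^ τ / 2) (by positivity) hT1 hab hωc hexp (by
      intro s hs t ht hst
      have : (γ t - p) / A - (γ s - p) / A = (γ t - γ s) / A := by ring
      rw [this, norm_div, ← sub_div]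
      gcongr
      exact hL s hs t ht hst) hno (hgn a haI hma) (hgn b hbI hmb)
  have hτne : (τ : ℝ) ≠ 0 := hτ0.ne'
  have himl : |(lam b - lam a).im| ≤ 2 * Real.pi * (20 / ‖A‖ * (m⁻¹) ^ τ * (L b - L a) + 1) + 4 / 100 := by
    have e1 : (τ : ℝ) * (lam b - lam a).im = ((ω b).im - (ω a).im)
        - ((Complex.log (1 + e b)).im - (Complex.log (1 + e a)).im) := by
      simp [hω]; ring
    have e2 : |((Complex.log (1 + e b)).im - (Complex.log (1 + e a)).im)| ≤ 4 / 100 := by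
      refine (abs_sub _ _).trans ?_
      have := Complex.abs_im_le_norm (Complex.log (1 + e b))
      have := Complex.abs_im_le_norm (Complex.log (1 + e a))
      linarith [hlog a haI, hlog b hbI]
    have e3 : (τ : ℝ) * |(lam b - lam a).im| ≤
        2 * Real.pi * τ * (20 / ‖A‖ * (m⁻¹) ^ τ * (L b - L a) + 1) + 4 / 100 := by
      rw [← abs_of_pos hτ0, ← abs_mul, e1, abs_of_pos hτ0]
      refine (abs_sub _ _).trans (add_le_add ?_ e2)
      refine hw.trans (le_of_eq ?_)
      rw [inv_pow]
      field_simp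
      ring
    have e4 : (1:ℝ) ≤ τ := by exact_mod_cast hτ
    have : (τ : ℝ) * |(lam b - lam a).im| ≤
        τ * (2 * Real.pi * (20 / ‖A‖ * (m⁻¹) ^ τ * (L b - L a) + 1) + 4 / 100) := by
      nlinarith
    exact le_of_mul_le_mul_left this hτ0
  have hrel : |(lam b - lam a).re| ≤ (m⁻¹) ^ q := by
    have hlogm : -Real.log m ≤ m⁻¹ := by
      rw [← Real.log_inv]
      exact (Real.log_le_sub_one_of_pos (by positivity)).trans (by linarith)
    have r1 : ∀ s, m ≤ ‖Complex.exp (lam s)‖ → ‖Complex.exp (lam s)‖ ≤ 1 →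
        Real.log m ≤ (lam s).re ∧ (lam s).re ≤ 0 := by
      intro s h2 h3
      rw [Complex.norm_exp] at h2 h3
      constructor
      · rwa [Real.log_le_iff_le_exp hm]
      · simpa using h3
    obtain ⟨x1, x2⟩ := r1 a hma ha1
    obtain ⟨x3, x4⟩ := r1 b hmb hb1
    rw [Complex.sub_re, abs_le]
    constructor <;> linarith
  have hnl : ‖lam b - lam a‖ ≤ 200 / ‖A‖ * (m⁻¹) ^ τ * (L b - L a) + 18 * (m⁻¹) ^ q := by
    refine (Complex.norm_le_abs_re_add_abs_im _).trans ?_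
    have hX : 0 ≤ (m⁻¹) ^ τ * (L b - L a) / ‖A‖ := by positivity
    have e1 : 20 / ‖A‖ * (m⁻¹) ^ τ * (L b - L a) = 20 * ((m⁻¹) ^ τ * (L b - L a) / ‖A‖) := by ring
    have e2 : 200 / ‖A‖ * (m⁻¹) ^ τ * (L b - L a) = 200 * ((m⁻¹) ^ τ * (L b - L a) / ‖A‖) := by ring
    rw [e1] at himl
    rw [e2]
    nlinarith
  rw [hdec]
  calc _ ≤ ‖(H b - C - c * lam b) - (H a - C - c * lam a)‖ + ‖c * (lam b - lam a)‖ := norm_add_le _ _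
    _ ≤ (K * (m⁻¹) ^ q + K * (m⁻¹) ^ q) + K * (200 / ‖A‖ * (m⁻¹) ^ τ * (L b - L a) + 18 * (m⁻¹) ^ q) := by
        refine add_le_add ((norm_sub_le _ _).trans (add_le_add hHb hHa)) ?_
        rw [norm_mul]
        exact mul_le_mul hc hnl (norm_nonneg _) hK
    _ = _ := by ring

end SCM

namespace SCM
open Asymptotics

noncomputable def dv (F : ℂ × ℂ → ℂ) (q : ℂ × ℂ) : ℂ := fderiv ℂ F q (1, 0)
noncomputable def dz (F : ℂ × ℂ → ℂ) (q : ℂ × ℂ) : ℂ := fderiv ℂ F q (0, 1)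

theorem analyticAt_dv {F : ℂ × ℂ → ℂ} {q : ℂ × ℂ} (h : AnalyticAt ℂ F q) : AnalyticAt ℂ (dv F) q :=
  ((ContinuousLinearMap.apply ℂ ℂ ((1:ℂ), (0:ℂ))).analyticAt _).comp h.fderiv
theorem analyticAt_dz {F : ℂ × ℂ → ℂ} {q : ℂ × ℂ} (h : AnalyticAt ℂ F q) : AnalyticAt ℂ (dz F) q :=
  ((ContinuousLinearMap.apply ℂ ℂ ((0:ℂ), (1:ℂ))).analyticAt _).comp h.fderiv

theorem hasDerivAt_dv {F : ℂ × ℂ → ℂ} {v z : ℂ} (h : DifferentiableAt ℂ F (v, z)) :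
    HasDerivAt (fun w => F (w, z)) (dv F (v, z)) v := by
  have h1 : HasDerivAt (fun w : ℂ => (w, z)) ((1 : ℂ), (0 : ℂ)) v :=
    (hasDerivAt_id v).prodMk (hasDerivAt_const v z)
  exact h.hasFDerivAt.comp_hasDerivAt v h1

theorem bigO_dv {F : ℂ × ℂ → ℂ} {z₀ : ℂ} (h : AnalyticAt ℂ F (0, z₀)) {j : ℕ}
    (hO : F =O[𝓝 (0, z₀)] fun q => q.1 ^ (j + 1)) : dv F =O[𝓝 (0, z₀)] fun q => q.1 ^ j := by
  obtain ⟨C, hC⟩ := hO.bound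
  obtain ⟨ε, hε, hb⟩ := Metric.eventually_nhds_iff_ball.1 (hC.and h.eventually_analyticAt)
  have hmem : ∀ w z : ℂ, ‖w‖ < ε → ‖z - z₀‖ < ε → (w, z) ∈ Metric.ball ((0:ℂ), z₀) ε := by
    intro w z h1 h2
    rw [Metric.mem_ball, Prod.dist_eq, max_lt_iff]
    simpa [dist_eq_norm] using ⟨h1, h2⟩
  have hC0 : 0 ≤ max C 0 := le_max_right _ _
  have key : ∀ v z : ℂ, ‖v‖ < ε / 2 → ‖z - z₀‖ < ε → v ≠ 0 →
      ‖dv F (v, z)‖ ≤ max C 0 * 2 ^ (j + 1) * ‖v‖ ^ j := by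
    intro v z hv hz hv0
    have hvp : 0 < ‖v‖ := norm_pos_iff.2 hv0
    have hd : ∀ w, ‖w‖ < ε → HasDerivAt (fun w => F (w, z)) (dv F (w, z)) w := fun w hw =>
      hasDerivAt_dv ((hb _ (hmem w z hw hz)).2.differentiableAt)
    have hball : ∀ w ∈ Metric.closedBall v ‖v‖, ‖w‖ ≤ 2 * ‖v‖ := by
      intro w hw
      rw [mem_closedBall_iff_norm] at hw
      have : w = (w - v) + v := by ring
      rw [this]; exact (norm_add_le _ _).trans (by linarith)
    have hdc : DiffContOnCl ℂ (fun w => F (w, z)) (Metric.ball v ‖v‖) := by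
      apply DifferentiableOn.diffContOnCl
      rw [closure_ball v hvp.ne']
      intro w hw
      exact (hd w (by linarith [hball w hw])).differentiableAt.differentiableWithinAt
    have := Complex.norm_deriv_le_of_forall_mem_sphere_norm_le (C := max C 0 * (2 * ‖v‖) ^ (j+1)) hvp hdc (by
      intro w hw
      have hw' := hball w (Metric.sphere_subset_closedBall hw)
      refine ((hb _ (hmem w z (by linarith) hz)).1).trans ?_
      rw [norm_pow]
      gcongr
      exact le_max_left _ _)
    rw [(hd v (by linarith)).deriv] at this
    refine this.trans (le_of_eq ?_)
    field_simp
    ring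
  apply IsBigO.of_bound (max C 0 * 2 ^ (j + 1))
  have : ∀ᶠ q : ℂ × ℂ in 𝓝 (0, z₀), q ∈ Metric.ball ((0:ℂ), z₀) (ε / 2) :=
    Metric.ball_mem_nhds _ (by positivity)
  filter_upwards [this] with q hq
  obtain ⟨v, z⟩ := q
  rw [Metric.mem_ball, Prod.dist_eq, max_lt_iff] at hq
  simp only [dist_eq_norm, sub_zero] at hq
  obtain ⟨hv, hz⟩ := hq
  by_cases hv0 : v = 0
  · subst hv0
    have hc : ContinuousAt (fun w => dv F (w, z)) 0 := by
      have h1 := (analyticAt_dv (hb _ (hmem 0 z (by simpa using hε) (by linarith))).2).continuousAt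
      exact h1.comp (f := fun w : ℂ => (w, z)) (by fun_prop)
    have t1 : Tendsto (fun w => ‖dv F (w, z)‖) (𝓝[≠] 0) (𝓝 ‖dv F (0, z)‖) :=
      hc.norm.tendsto.mono_left nhdsWithin_le_nhds
    have t2 : Tendsto (fun w : ℂ => max C 0 * 2 ^ (j + 1) * ‖w‖ ^ j) (𝓝[≠] 0)
        (𝓝 (max C 0 * 2 ^ (j + 1) * ‖(0:ℂ)‖ ^ j)) := by
      apply Tendsto.mono_left _ nhdsWithin_le_nhds
      apply Continuous.tendsto'
      · fun_prop
      · rfl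
    rw [norm_pow]
    apply le_of_tendsto_of_tendsto t1 t2
    have : ∀ᶠ w : ℂ in 𝓝[≠] 0, ‖w‖ < ε / 2 := by
      apply nhdsWithin_le_nhds
      have := Metric.ball_mem_nhds (0:ℂ) (by positivity : 0 < ε / 2)
      filter_upwards [this] with w hw
      simpa using hw
    filter_upwards [this, self_mem_nhdsWithin] with w hw hw0
    exact key w z hw (by linarith) hw0
  · rw [norm_pow]
    exact key v z hv (by linarith) hv0

theorem bigO_of_dv {F : ℂ × ℂ → ℂ} {z₀ : ℂ} (h : AnalyticAt ℂ F (0, z₀)) {j : ℕ}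
    (h0 : ∀ᶠ z in 𝓝 z₀, F (0, z) = 0)
    (hO : dv F =O[𝓝 (0, z₀)] fun q => q.1 ^ j) : F =O[𝓝 (0, z₀)] fun q => q.1 ^ (j + 1) := by
  obtain ⟨C, hC⟩ := hO.bound
  have h0' : ∀ᶠ q : ℂ × ℂ in 𝓝 (0, z₀), F (0, q.2) = 0 :=
    (continuous_snd.tendsto ((0:ℂ), z₀)).eventually h0
  obtain ⟨ε, hε, hb⟩ := Metric.eventually_nhds_iff_ball.1 ((hC.and h.eventually_analyticAt).and h0')
  apply IsBigO.of_bound (max C 0)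
  filter_upwards [Metric.ball_mem_nhds _ hε] with q hq
  have hq0 := hq
  obtain ⟨v, z⟩ := q
  rw [Metric.mem_ball, Prod.dist_eq, max_lt_iff] at hq
  simp only [dist_eq_norm, sub_zero] at hq
  obtain ⟨hv, hz⟩ := hq
  have hmem : ∀ w ∈ Metric.closedBall (0:ℂ) ‖v‖, (w, z) ∈ Metric.ball ((0:ℂ), z₀) ε := by
    intro w hw
    rw [mem_closedBall_zero_iff] at hw
    rw [Metric.mem_ball, Prod.dist_eq, max_lt_iff]
    simpa [dist_eq_norm] using ⟨by linarith, hz⟩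
  have := (convex_closedBall (0:ℂ) ‖v‖).norm_image_sub_le_of_norm_hasDerivWithin_le
    (f := fun w => F (w, z)) (f' := fun w => dv F (w, z)) (C := max C 0 * ‖v‖ ^ j) (x := 0) (y := v)
    (fun w hw => (hasDerivAt_dv ((hb _ (hmem w hw)).1.2.differentiableAt)).hasDerivWithinAt)
    (by
      intro w hw
      refine (hb _ (hmem w hw)).1.1.trans ?_
      rw [mem_closedBall_zero_iff] at hw
      rw [norm_pow]
      gcongr
      exact le_max_left _ _) (by simp) (by simp)
  have hz0 := (hb _ hq0).2
  simp only at hz0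
  rw [hz0] at this
  simp only [sub_zero] at this
  rw [norm_pow]
  refine this.trans (le_of_eq (by ring))

theorem dv_sub_monomial {F : ℂ × ℂ → ℂ} {c : ℂ → ℂ} {q : ℂ × ℂ} (j : ℕ)
    (hF : DifferentiableAt ℂ F q) (hc : DifferentiableAt ℂ c q.2) :
    dv (fun q => F q + c q.2 * q.1 ^ (j + 1)) q = dv F q + (j + 1) * c q.2 * q.1 ^ j ∧
    dz (fun q => F q + c q.2 * q.1 ^ (j + 1)) q = dz F q + deriv c q.2 * q.1 ^ (j + 1) := by
  have h1 : HasFDerivAt (fun q : ℂ × ℂ => c q.2) (((1 : ℂ →L[ℂ] ℂ).smulRight (deriv c q.2)).comp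
      (ContinuousLinearMap.snd ℂ ℂ ℂ)) q :=
    hc.hasDerivAt.hasFDerivAt.comp q hasFDerivAt_snd
  have h2 : HasFDerivAt (fun q : ℂ × ℂ => q.1 ^ (j + 1)) _ q := (hasFDerivAt_fst (𝕜 := ℂ) (p := q)).pow (j + 1)
  have h3 := (hF.hasFDerivAt.add (h1.mul h2)).fderiv
  unfold dv dz
  have e : (fun q : ℂ × ℂ => F q + c q.2 * q.1 ^ (j + 1)) = F + (fun q : ℂ × ℂ => c q.2) * fun q => q.1 ^ (j+1) := rfl
  rw [e]
  constructor
  · rw [h3]; simp; ring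
  · rw [h3]; simp; ring

theorem taylorT {z₀ : ℂ} (j : ℕ) : ∀ {F : ℂ × ℂ → ℂ}, AnalyticAt ℂ F (0, z₀) →
    (F =O[𝓝 (0, z₀)] fun q => q.1 ^ j) →
    ∃ c : ℂ → ℂ, AnalyticAt ℂ c z₀ ∧
      (fun q => F q - c q.2 * q.1 ^ j) =O[𝓝 (0, z₀)] fun q => q.1 ^ (j + 1) := by
  induction j with
  | zero =>
    intro F hF hO
    refine ⟨fun z => F (0, z), ?_, ?_⟩
    · apply AnalyticAt.comp' (f := fun z : ℂ => ((0:ℂ), z)) hF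
      exact analyticAt_const.prod analyticAt_id
    · have h1 := (hF.hasStrictFDerivAt).isBigO_sub
      have ht : Tendsto (fun q : ℂ × ℂ => (q, ((0:ℂ), q.2))) (𝓝 (0, z₀)) (𝓝 (((0:ℂ), z₀), ((0:ℂ), z₀))) := by
        apply Continuous.tendsto'
        · fun_prop
        · rfl
      have h2 := h1.comp_tendsto ht
      simp only [pow_zero, mul_one, zero_add, pow_one]
      refine h2.trans ?_
      apply IsBigO.of_bound 1
      filter_upwards with q
      simp [Prod.norm_def]
  | succ j ih =>
    intro F hF hO
    obtain ⟨c, hc, hcO⟩ := ih (analyticAt_dv hF) (bigO_dv hF hO)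
    have hj : ((j : ℂ) + 1) ≠ 0 := by exact_mod_cast Nat.succ_ne_zero j
    refine ⟨fun z => c z / (j + 1), hc.div_const, ?_⟩
    have hc' : AnalyticAt ℂ (fun z => - (c z / (j + 1))) z₀ := (hc.div_const).neg
    have hfun : (fun q : ℂ × ℂ => F q - c q.2 / (j + 1) * q.1 ^ (j + 1))
        = fun q => F q + (fun z => -(c z / (j + 1))) q.2 * q.1 ^ (j + 1) := by
      ext q; simp; ring
    rw [hfun]
    apply bigO_of_dv
    · apply hF.add
      apply AnalyticAt.mul
      · have hc2 : AnalyticAt ℂ (fun z => - (c z / ((j:ℂ) + 1))) ((0:ℂ), z₀).2 := hc'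
        exact AnalyticAt.comp' (f := fun q : ℂ × ℂ => q.2) hc2 analyticAt_snd
      · exact analyticAt_fst.pow _
    · have hz := (hO.eq_zero_imp)
      have : Tendsto (fun z : ℂ => ((0:ℂ), z)) (𝓝 z₀) (𝓝 (0, z₀)) := by
        apply Continuous.tendsto' (by fun_prop); rfl
      filter_upwards [this.eventually hz] with z hz
      simp at hz ⊢
      exact hz
    · refine IsBigO.congr' hcO ?_ EventuallyEq.rfl
      have e1 := hF.eventually_analyticAt
      have e2 : ∀ᶠ q : ℂ × ℂ in 𝓝 (0, z₀), AnalyticAt ℂ (fun z => - (c z / ((j : ℂ) + 1))) q.2 :=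
        (continuous_snd.tendsto ((0:ℂ), z₀)).eventually hc'.eventually_analyticAt
      filter_upwards [e1, e2] with q h1 h2
      rw [(dv_sub_monomial j h1.differentiableAt h2.differentiableAt).1]
      field_simp
      ring

/-- the flow residual -/
noncomputable def Res (τ D : ℕ) (a h : ℂ × ℂ × ℂ → ℂ) (V : ℂ × ℂ → ℂ) (q : ℂ × ℂ) : ℂ :=
  q.1 * dv V q + q.1 ^ τ * a (q.1, q.2, V q) * dz V q - D * V q - q.1 ^ (τ + 1) * h (q.1, q.2, V q)

theorem bigO_pow_mono {z₀ : ℂ} {i j : ℕ} (h : i ≤ j) :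
    (fun q : ℂ × ℂ => q.1 ^ j) =O[𝓝 (0, z₀)] fun q => q.1 ^ i := by
  apply IsBigO.of_bound 1
  have : ∀ᶠ q : ℂ × ℂ in 𝓝 (0, z₀), ‖q.1‖ < 1 := by
    have : Tendsto (fun q : ℂ × ℂ => ‖q.1‖) (𝓝 (0, z₀)) (𝓝 0) := by
      apply Continuous.tendsto' (by fun_prop); simp
    exact this.eventually (gt_mem_nhds one_pos)
  filter_upwards [this] with q hq
  rw [norm_pow, norm_pow, one_mul]
  exact pow_le_pow_of_le_one (norm_nonneg _) hq.le h

theorem exists_V {z₀ : ℂ} {τ D : ℕ} {a h : ℂ × ℂ × ℂ → ℂ} (hτ : 1 ≤ τ)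
    (ha : AnalyticAt ℂ a (0, z₀, 0)) (hh : AnalyticAt ℂ h (0, z₀, 0)) (j : ℕ) (hj1 : τ + 1 ≤ j) :
    j ≤ D → ∃ V : ℂ × ℂ → ℂ, AnalyticAt ℂ V (0, z₀) ∧
      (V =O[𝓝 (0, z₀)] fun q => q.1 ^ (τ + 1)) ∧ (dz V =O[𝓝 (0, z₀)] fun q => q.1 ^ (τ + 1)) ∧
      Res τ D a h V =O[𝓝 (0, z₀)] fun q => q.1 ^ j := by
  have comp3 : ∀ {g : ℂ × ℂ × ℂ → ℂ} {V : ℂ × ℂ → ℂ}, AnalyticAt ℂ g (0, z₀, 0) →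
      AnalyticAt ℂ V (0, z₀) → V (0, z₀) = 0 → AnalyticAt ℂ (fun q : ℂ × ℂ => g (q.1, q.2, V q)) (0, z₀) := by
    intro g V hg hV h0
    apply AnalyticAt.comp' (f := fun q : ℂ × ℂ => (q.1, q.2, V q))
    · simpa [h0] using hg
    · exact analyticAt_fst.prod (analyticAt_snd.prod hV)
  have zero_of : ∀ {V : ℂ × ℂ → ℂ}, (V =O[𝓝 (0, z₀)] fun q => q.1 ^ (τ + 1)) → V (0, z₀) = 0 := by
    intro V hV
    have := hV.eq_zero_imp.self_of_nhds
    simpa using this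
  have bdd : ∀ {g : ℂ × ℂ → ℂ}, AnalyticAt ℂ g (0, z₀) → g =O[𝓝 (0, z₀)] fun _ => (1 : ℂ) :=
    fun hg => hg.continuousAt.isBigO_one ℂ
  induction j, hj1 using Nat.le_induction with
  | base =>
    intro _
    refine ⟨fun _ => 0, analyticAt_const, isBigO_zero _ _, ?_, ?_⟩
    · have : dz (fun _ : ℂ × ℂ => (0:ℂ)) = fun _ => 0 := by ext q; simp [dz]
      rw [this]; exact isBigO_zero _ _
    · have e : Res τ D a h (fun _ => 0) = fun q => q.1 ^ (τ + 1) * (-h (q.1, q.2, 0)) := by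
        ext q; simp [Res, dz, dv]
      rw [e]
      have := (isBigO_refl (fun q : ℂ × ℂ => q.1 ^ (τ + 1)) (𝓝 (0, z₀))).mul
        (bdd (comp3 hh analyticAt_const rfl).neg)
      simpa using this
  | succ j hj ih =>
    intro hjD
    obtain ⟨V, hV, hVO, hVz, hR⟩ := ih (by omega)
    have hV0 := zero_of hVO
    have hRan : AnalyticAt ℂ (Res τ D a h V) (0, z₀) := by
      unfold Res
      exact (((analyticAt_fst.mul (analyticAt_dv hV)).add (((analyticAt_fst.pow _).mul
        (comp3 ha hV hV0)).mul (analyticAt_dz hV))).sub (analyticAt_const.mul hV)).sub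
        ((analyticAt_fst.pow _).mul (comp3 hh hV hV0))
    obtain ⟨c, hc, hcO⟩ := taylorT j hRan hR
    obtain ⟨i, rfl⟩ : ∃ i, j = i + 1 := ⟨j - 1, by omega⟩
    have hne : ((D : ℂ) - (i + 1)) ≠ 0 := by
      have : (D : ℂ) ≠ ((i + 1 : ℕ) : ℂ) := by exact_mod_cast (by omega : D ≠ i + 1)
      rw [sub_ne_zero]; simpa using this
    set k : ℂ → ℂ := fun z => c z / (D - (i + 1)) with hk
    have hka : AnalyticAt ℂ k z₀ := hc.div_const
    have hk2 : AnalyticAt ℂ (fun q : ℂ × ℂ => k q.2) (0, z₀) :=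
      AnalyticAt.comp' (f := fun q : ℂ × ℂ => q.2) hka analyticAt_snd
    have hdk2 : AnalyticAt ℂ (fun q : ℂ × ℂ => deriv k q.2) (0, z₀) :=
      AnalyticAt.comp' (f := fun q : ℂ × ℂ => q.2) hka.deriv analyticAt_snd
    set V' : ℂ × ℂ → ℂ := fun q => V q + k q.2 * q.1 ^ (i + 1) with hV'
    have hV'a : AnalyticAt ℂ V' (0, z₀) := hV.add (hk2.mul (analyticAt_fst.pow _))
    have hdO : (fun q : ℂ × ℂ => k q.2 * q.1 ^ (i + 1)) =O[𝓝 (0, z₀)] fun q => q.1 ^ (i + 1) := by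
      have := (bdd hk2).mul (isBigO_refl (fun q : ℂ × ℂ => q.1 ^ (i + 1)) (𝓝 (0, z₀)))
      simpa using this
    have hdO' : (fun q : ℂ × ℂ => deriv k q.2 * q.1 ^ (i + 1)) =O[𝓝 (0, z₀)] fun q => q.1 ^ (i + 1) := by
      have := (bdd hdk2).mul (isBigO_refl (fun q : ℂ × ℂ => q.1 ^ (i + 1)) (𝓝 (0, z₀)))
      simpa using this
    have hV'O : V' =O[𝓝 (0, z₀)] fun q => q.1 ^ (τ + 1) := hVO.add (hdO.trans (bigO_pow_mono hj))
    have hV'0 := zero_of hV'O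
    have hder : ∀ᶠ q in 𝓝 ((0:ℂ), z₀), dv V' q = dv V q + (i + 1) * k q.2 * q.1 ^ i ∧
        dz V' q = dz V q + deriv k q.2 * q.1 ^ (i + 1) := by
      have e2 : ∀ᶠ q : ℂ × ℂ in 𝓝 (0, z₀), AnalyticAt ℂ k q.2 :=
        (continuous_snd.tendsto ((0:ℂ), z₀)).eventually hka.eventually_analyticAt
      filter_upwards [hV.eventually_analyticAt, e2] with q h1 h2
      exact dv_sub_monomial i h1.differentiableAt h2.differentiableAt
    have hV'z : dz V' =O[𝓝 (0, z₀)] fun q => q.1 ^ (τ + 1) := by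
      refine IsBigO.congr' (hVz.add (hdO'.trans (bigO_pow_mono hj))) ?_ EventuallyEq.rfl
      filter_upwards [hder] with q hq
      exact hq.2.symm
    refine ⟨V', hV'a, hV'O, hV'z, ?_⟩
    have lip : ∀ {g : ℂ × ℂ × ℂ → ℂ}, AnalyticAt ℂ g (0, z₀, 0) →
        (fun q : ℂ × ℂ => g (q.1, q.2, V' q) - g (q.1, q.2, V q)) =O[𝓝 (0, z₀)] fun q => q.1 ^ (i + 1) := by
      intro g hg
      have h1 := hg.hasStrictFDerivAt.isBigO_sub
      have tt : ∀ {W : ℂ × ℂ → ℂ}, AnalyticAt ℂ W (0, z₀) → W (0, z₀) = 0 →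
          Tendsto (fun q : ℂ × ℂ => (q.1, q.2, W q)) (𝓝 (0, z₀)) (𝓝 (0, z₀, 0)) := by
        intro W hW h0
        have : ContinuousAt (fun q : ℂ × ℂ => (q.1, q.2, W q)) (0, z₀) :=
          continuousAt_fst.prodMk (continuousAt_snd.prodMk hW.continuousAt)
        have := this.tendsto
        simpa [h0] using this
      have h2 := h1.comp_tendsto ((tt hV'a hV'0).prodMk_nhds (tt hV hV0))
      refine h2.trans ?_
      refine IsBigO.trans ?_ hdO
      apply IsBigO.of_bound 1
      filter_upwards with q
      simp [Prod.norm_def, hV']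
      try positivity
    have X1 : (fun q : ℂ × ℂ => q.1 ^ τ * (a (q.1, q.2, V' q) * (deriv k q.2 * q.1 ^ (i + 1))))
        =O[𝓝 (0, z₀)] fun q => q.1 ^ (i + 1 + 1) := by
      have h1 := ((isBigO_refl (fun q : ℂ × ℂ => q.1 ^ τ) (𝓝 (0, z₀))).trans (bigO_pow_mono hτ)).mul
        ((bdd (comp3 ha hV'a hV'0)).mul hdO')
      refine h1.congr_right ?_
      intro q; simp; ring
    have X2 : (fun q : ℂ × ℂ => q.1 ^ τ * ((a (q.1, q.2, V' q) - a (q.1, q.2, V q)) * dz V q))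
        =O[𝓝 (0, z₀)] fun q => q.1 ^ (i + 1 + 1) := by
      have h1 := ((isBigO_refl (fun q : ℂ × ℂ => q.1 ^ τ) (𝓝 (0, z₀))).trans (bigO_pow_mono hτ)).mul
        ((lip ha).mul (bdd (analyticAt_dz hV)))
      refine h1.congr_right ?_
      intro q; simp; ring
    have X3 : (fun q : ℂ × ℂ => q.1 ^ (τ + 1) * (h (q.1, q.2, V' q) - h (q.1, q.2, V q)))
        =O[𝓝 (0, z₀)] fun q => q.1 ^ (i + 1 + 1) := by
      have h1 := ((isBigO_refl (fun q : ℂ × ℂ => q.1 ^ (τ + 1)) (𝓝 (0, z₀))).trans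
        (bigO_pow_mono (i := 1) (by omega))).mul (lip hh)
      refine h1.congr_right ?_
      intro q; simp; ring
    have X := ((hcO.add X1).add X2).sub X3
    refine IsBigO.congr' X ?_ EventuallyEq.rfl
    filter_upwards [hder] with q hq
    have hkc : c q.2 = k q.2 * (D - (i + 1)) := by rw [hk]; field_simp
    unfold Res
    rw [hq.1, hq.2, hkc]
    simp only [hV']
    ring

end SCM

namespace SCM
open Asymptotics

theorem global_curve {E : Type*} [NormedAddCommGroup E] [NormedSpace ℝ E] [CompleteSpace E]
    {X : E → E} {K : NNReal} (hX : ContDiff ℝ 1 X) (hL : LipschitzWith K X) (y : E) :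
    ∃ φ : ℝ → E, φ 0 = y ∧ ∀ t, HasDerivAt φ (X (φ t)) t := by
  have hloc : ∀ x : E, ∃ γ : ℝ → E, γ 0 = x ∧
      IsMIntegralCurveOn (I := modelWithCornersSelf ℝ E) γ X (Set.Ioo (-(1 / (K + 1) : ℝ)) (1 / (K + 1))) := by
    intro x
    have hK : (0:ℝ) < 1 / (K + 1) := by positivity
    have hpl : IsPicardLindelof (fun _ => X) (tmin := -(1 / (K + 1) : ℝ)) (tmax := 1 / (K + 1))
        ⟨0, by constructor <;> linarith⟩ x (‖X x‖₊) 0 (‖X x‖₊ + K * ‖X x‖₊) K := by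
      apply IsPicardLindelof.of_time_independent
      · intro w hw
        have h1 := hL.norm_sub_le w x
        rw [mem_closedBall_iff_norm] at hw
        have h2 : ‖X w‖ ≤ ‖X x‖ + ‖X w - X x‖ := norm_le_norm_add_norm_sub' _ _
        push_cast at *
        have : (K:ℝ) * ‖w - x‖ ≤ K * ‖X x‖ := by gcongr
        linarith
      · exact hL.lipschitzOnWith
      · push_cast
        simp only [sub_zero, zero_sub, neg_neg, max_self]
        apply le_of_eq
        field_simp
        ring
    obtain ⟨α, h1, h2⟩ := hpl.exists_eq_forall_mem_Icc_hasDerivWithinAt₀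
    refine ⟨α, h1, ?_⟩
    intro t ht
    have := (h2 t (Set.Ioo_subset_Icc_self ht)).mono Set.Ioo_subset_Icc_self
    exact this.hasFDerivWithinAt.hasMFDerivWithinAt
  have hsm : ContMDiff (modelWithCornersSelf ℝ E) (modelWithCornersSelf ℝ E).tangent 1
      (fun x ↦ (⟨x, X x⟩ : TangentBundle (modelWithCornersSelf ℝ E) E)) := by
    exact contMDiff_vectorSpace_iff_contDiff.2 hX
  obtain ⟨γ, h1, h2⟩ := exists_isMIntegralCurve_of_isMIntegralCurveOn hsm (by positivity) hloc y
  refine ⟨γ, h1, fun t => ?_⟩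
  have h3 : HasFDerivAt γ ((1 : ℝ →L[ℝ] ℝ).smulRight (X (γ t))) t := (h2 t).hasFDerivAt
  have h4 := h3.hasDerivAt
  simpa using h4

/-- derivative of flow w.r.t. an orbit parameter -/
theorem flow_deriv {E : Type*} [NormedAddCommGroup E] [NormedSpace ℂ E] [NormedSpace ℝ E] [IsScalarTower ℝ ℂ E]
    {X : E → E} {X' : E → E →L[ℂ] E} {c : E} {R : ℝ} {K : NNReal} (hR : 0 < R)
    (hX : ∀ y ∈ Metric.ball c R, HasFDerivAt X (X' y) y)
    (hXL : LipschitzOnWith K X (Metric.ball c R))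
    (hX' : LipschitzOnWith K X' (Metric.ball c R))
    {φ : ℂ → ℝ → E} {s : ℂ → E} {ζ μ : ℂ} {T : ℝ} (hT : 0 ≤ T)
    (hs : HasDerivAt s (μ • X (s ζ)) ζ)
    (h0 : ∀ᶠ ξ in 𝓝 ζ, φ ξ 0 = s ξ)
    (hin : ∀ᶠ ξ in 𝓝 ζ, ∀ t, 0 ≤ t → φ ξ t ∈ Metric.ball c (R / 2))
    (hφ : ∀ᶠ ξ in 𝓝 ζ, ∀ t, 0 ≤ t → HasDerivAt (φ ξ) (- X (φ ξ t)) t) :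
    HasDerivAt (fun ξ => φ ξ T) (μ • X (φ ζ T)) ζ := by
  have z0 := h0.self_of_nhds
  have zin := hin.self_of_nhds
  have zφ := hφ.self_of_nhds
  have hsub : Metric.ball c (R / 2) ⊆ Metric.ball c R := Metric.ball_subset_ball (by linarith)
  have hcc : c ∈ Metric.ball c R := Metric.mem_ball_self hR
  set Mx : ℝ := ‖X c‖ + K * R with hMx
  have hMb : ∀ y ∈ Metric.ball c R, ‖X y‖ ≤ Mx := by
    intro y hy
    have h1 := hXL.norm_sub_le hy hcc
    rw [mem_ball_iff_norm] at hy
    have h2 : ‖X y‖ ≤ ‖X c‖ + ‖X y - X c‖ := norm_le_norm_add_norm_sub' _ _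
    have : (K:ℝ) * ‖y - c‖ ≤ K * R := by gcongr
    linarith
  have hMx0 : 0 ≤ Mx := by positivity
  -- Taylor
  have htay : ∀ y ∈ Metric.ball c R, ∀ y' ∈ Metric.ball c R,
      ‖X y' - X y - X' y (y' - y)‖ ≤ K * ‖y' - y‖ * ‖y' - y‖ := by
    intro y hy y' hy'
    have hseg : segment ℝ y y' ⊆ Metric.ball c R := (convex_ball c R).segment_subset hy hy'
    have := (convex_segment y y').norm_image_sub_le_of_norm_hasFDerivWithin_le'
      (f := X) (f' := X') (φ := X' y) (C := K * ‖y' - y‖) (x := y) (y := y') (𝕜 := ℂ)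
      (fun w hw => (hX w (hseg hw)).hasFDerivWithinAt) (by
        intro w hw
        refine (hX'.norm_sub_le (hseg hw) hy).trans ?_
        gcongr
        rw [segment_eq_image'] at hw
        obtain ⟨θ, hθ, rfl⟩ := hw
        simp only [add_sub_cancel_left, norm_smul, Real.norm_eq_abs, abs_of_nonneg hθ.1]
        nlinarith [norm_nonneg (y' - y), hθ.2]) (left_mem_segment ℝ y y') (right_mem_segment ℝ y y')
    exact this
  rw [hasDerivAt_iff_isLittleO, isLittleO_iff]
  intro ε hε
  -- gronwall constants
  set Γ : ℝ := gronwallBound 1 K 1 T with hΓ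
  have hΓ0 : 0 < Γ := by
    have := gronwallBound_mono (δ := 1) (K := K) (ε := 1) zero_le_one zero_le_one K.2 hT
    rw [gronwallBound_x0] at this
    linarith
  have hlin : ∀ d : ℝ, gronwallBound d K d T = d * Γ := by
    intro d
    rw [hΓ]; unfold gronwallBound
    split_ifs <;> ring
  set d₀ : ℝ := ε / Γ with hd₀
  have hd0 : 0 < d₀ := by positivity
  rw [hasDerivAt_iff_isLittleO, isLittleO_iff] at hs
  -- smallness
  set C2 : ℝ := K * (‖μ‖ * Mx) * (‖μ‖ * Mx) with hC2
  have hC20 : 0 ≤ C2 := by positivity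
  have hsm : ∀ᶠ ξ in 𝓝 ζ, ‖ξ - ζ‖ * (‖μ‖ * Mx) < R / 2 ∧ ‖ξ - ζ‖ * C2 ≤ d₀ := by
    have t1 : Tendsto (fun ξ : ℂ => ‖ξ - ζ‖ * (‖μ‖ * Mx)) (𝓝 ζ) (𝓝 0) := by
      apply Continuous.tendsto' (by fun_prop); simp
    have t2 : Tendsto (fun ξ : ℂ => ‖ξ - ζ‖ * C2) (𝓝 ζ) (𝓝 0) := by
      apply Continuous.tendsto' (by fun_prop); simp
    exact (t1.eventually (gt_mem_nhds (by positivity))).and (t2.eventually (ge_mem_nhds hd0))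
  filter_upwards [h0, hin, hφ, hs hd0, hsm] with ξ x0 xin xφ hsξ hsmξ
  set δ : ℂ := (ξ - ζ) * μ with hδ
  have hδn : ∀ t, 0 ≤ t → ‖δ • X (φ ζ t)‖ ≤ ‖ξ - ζ‖ * (‖μ‖ * Mx) := by
    intro t ht
    rw [norm_smul, hδ, norm_mul, mul_assoc]
    gcongr
    exact hMb _ (hsub (zin t ht))
  set Y : ℝ → E := fun t => φ ζ t + δ • X (φ ζ t) with hY
  have hYin : ∀ t, 0 ≤ t → Y t ∈ Metric.ball c R := by
    intro t ht
    have h1 := zin t ht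
    rw [mem_ball_iff_norm] at h1 ⊢
    have : Y t - c = (φ ζ t - c) + δ • X (φ ζ t) := by rw [hY]; simp only; abel
    rw [this]
    refine (norm_add_le _ _).trans_lt ?_
    linarith [hδn t ht, hsmξ.1]
  have hYd : ∀ t, 0 ≤ t → HasDerivAt Y (- X (φ ζ t) + δ • (X' (φ ζ t)) (- X (φ ζ t))) t := by
    intro t ht
    have h1 : HasDerivAt (fun t => X (φ ζ t)) ((X' (φ ζ t)) (- X (φ ζ t))) t :=
      ((hX _ (hsub (zin t ht))).restrictScalars ℝ).comp_hasDerivAt t (zφ t ht)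
    exact (zφ t ht).add (h1.const_smul δ)
  have key := dist_le_of_approx_trajectories_ODE_of_mem (v := fun _ y => - X y)
    (s := fun _ => Metric.ball c R) (K := K) (a := 0) (b := T) (f := Y) (g := φ ξ)
    (f' := fun t => - X (φ ζ t) + δ • (X' (φ ζ t)) (- X (φ ζ t))) (g' := fun t => - X (φ ξ t))
    (εf := d₀ * ‖ξ - ζ‖) (εg := 0) (δ := d₀ * ‖ξ - ζ‖)
    (fun t _ => hXL.neg)
    (fun t ht => (hYd t ht.1).continuousAt.continuousWithinAt)
    (fun t ht => (hYd t ht.1).hasDerivWithinAt)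
    (by
      intro t ht
      rw [dist_eq_norm]
      have h1 := htay _ (hsub (zin t ht.1)) _ (hYin t ht.1)
      have e1 : Y t - φ ζ t = δ • X (φ ζ t) := by rw [hY]; simp
      rw [e1] at h1
      have e2 : -X (φ ζ t) + δ • (X' (φ ζ t)) (-X (φ ζ t)) - -X (Y t)
          = X (Y t) - X (φ ζ t) - (X' (φ ζ t)) (δ • X (φ ζ t)) := by
        rw [map_smul, map_neg, smul_neg]; abel
      rw [e2]
      refine h1.trans ?_
      have h3 := hδn t ht.1
      calc (K:ℝ) * ‖δ • X (φ ζ t)‖ * ‖δ • X (φ ζ t)‖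
          ≤ K * (‖ξ - ζ‖ * (‖μ‖ * Mx)) * (‖ξ - ζ‖ * (‖μ‖ * Mx)) := by gcongr
        _ = (‖ξ - ζ‖ * C2) * ‖ξ - ζ‖ := by rw [hC2]; ring
        _ ≤ d₀ * ‖ξ - ζ‖ := by gcongr; exact hsmξ.2)
    (fun t ht => hYin t ht.1)
    (fun t ht => (xφ t ht.1).continuousAt.continuousWithinAt)
    (fun t ht => (xφ t ht.1).hasDerivWithinAt)
    (fun t _ => by simp)
    (fun t ht => hsub (xin t ht.1))
    (by
      rw [dist_comm, dist_eq_norm, x0, hY]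
      simp only
      rw [z0]
      refine le_trans (le_of_eq ?_) hsξ
      congr 1
      rw [hδ, smul_smul]; abel) T ⟨hT, le_rfl⟩
  rw [add_zero, sub_zero, hlin, dist_comm, dist_eq_norm] at key
  have e3 : φ ξ T - φ ζ T - (ξ - ζ) • μ • X (φ ζ T) = φ ξ T - Y T := by
    rw [hY]; simp only; rw [hδ, smul_smul]; abel
  rw [e3]
  refine key.trans (le_of_eq ?_)
  rw [hd₀]; field_simp

end SCM

namespace SCM
open Asymptotics

theorem expBound {E : Type*} [NormedAddCommGroup E] [NormedSpace ℝ E] {f f' : ℝ → E} {C k : ℝ} (hk : k ≠ 0)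
    (hf : ∀ t, 0 ≤ t → HasDerivAt f (f' t) t) (hb : ∀ t, 0 ≤ t → ‖f' t‖ ≤ C * Real.exp (k * t))
    {a b : ℝ} (ha : 0 ≤ a) (hab : a ≤ b) :
    ‖f b - f a‖ ≤ C / k * (Real.exp (k * b) - Real.exp (k * a)) := by
  have := image_norm_le_of_norm_deriv_right_le_deriv_boundary (f := fun t => f t - f a) (f' := f')
    (a := a) (b := b) (B := fun t => C / k * (Real.exp (k * t) - Real.exp (k * a)))
    (B' := fun t => C * Real.exp (k * t))
    (fun t ht => ((hf t (ha.trans ht.1)).sub_const _).continuousAt.continuousWithinAt)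
    (fun t ht => ((hf t (ha.trans ht.1)).sub_const _).hasDerivWithinAt)
    (by simp)
    (by
      intro t
      have h1 : HasDerivAt (fun t : ℝ => Real.exp (k * t)) (Real.exp (k * t) * (k * 1)) t :=
        ((hasDerivAt_id t).const_mul k).exp
      have h2 := (h1.sub_const (Real.exp (k * a))).const_mul (C / k)
      exact h2.congr_deriv (by field_simp))
    (fun t ht => hb t (ha.trans ht.1)) (x := b) ⟨hab, le_rfl⟩
  exact this

noncomputable def Xf (τ D : ℕ) (a h : ℂ × ℂ × ℂ → ℂ) (y : ℂ × ℂ × ℂ) : ℂ × ℂ × ℂ :=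
  (y.1, y.1 ^ τ * a y, D * y.2.2 + y.1 ^ (τ + 1) * h y)

theorem v_formula {v : ℝ → ℂ} (h : ∀ t, 0 ≤ t → HasDerivAt v (- v t) t) :
    ∀ t, 0 ≤ t → v t = v 0 * (Real.exp (-t) : ℝ) := by
  intro t ht
  have h1 : ∀ s, 0 ≤ s → HasDerivAt (fun s : ℝ => ((Real.exp s : ℝ) : ℂ) * v s) 0 s := by
    intro s hs
    have := ((Real.hasDerivAt_exp s).ofReal_comp).mul (h s hs)
    exact this.congr_deriv (by push_cast; ring)
  have h2 := expBound (f := fun s : ℝ => ((Real.exp s : ℝ) : ℂ) * v s) (f' := fun _ => 0) (C := 0) (k := 1)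
    one_ne_zero h1 (by simp) le_rfl ht
  simp only [zero_div, zero_mul, norm_le_zero_iff, sub_eq_zero] at h2
  rw [Real.exp_zero] at h2
  have h3 : ((Real.exp t : ℝ) : ℂ) ≠ 0 := by exact_mod_cast (Real.exp_pos t).ne'
  rw [Real.exp_neg]
  push_cast at *
  field_simp
  rw [mul_comm]; rw [h2]; ring

theorem flow_exists {z₀ : ℂ} {τ D : ℕ} {a h : ℂ × ℂ × ℂ → ℂ} (hτ : 1 ≤ τ) (hD : 1 ≤ D)
    (ha : AnalyticAt ℂ a (0, z₀, 0)) (hh : AnalyticAt ℂ h (0, z₀, 0)) {R : ℝ} (hR : 0 < R) :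
    ∃ r > 0, r ≤ R ∧ ∃ Φ : ℂ × ℂ × ℂ → ℝ → ℂ × ℂ × ℂ, ∀ y ∈ Metric.ball ((0:ℂ), z₀, (0:ℂ)) r,
      Φ y 0 = y ∧ ∀ t, 0 ≤ t → Φ y t ∈ Metric.ball ((0:ℂ), z₀, (0:ℂ)) R ∧
        HasDerivAt (Φ y) (- Xf τ D a h (Φ y t)) t := by
  set c : ℂ × ℂ × ℂ := (0, z₀, 0) with hc
  set M : ℝ := ‖a c‖ + ‖h c‖ + 1 with hM
  have hM0 : 0 < M := by positivity
  have hev : ∀ᶠ y in 𝓝 c, AnalyticAt ℂ a y ∧ AnalyticAt ℂ h y ∧ ‖a y‖ ≤ M ∧ ‖h y‖ ≤ M := by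
    have e1 : ∀ᶠ y in 𝓝 c, ‖a y‖ ≤ M :=
      ha.continuousAt.norm.tendsto.eventually (ge_mem_nhds (by simp only [hM]; linarith [norm_nonneg (h c)]))
    have e2 : ∀ᶠ y in 𝓝 c, ‖h y‖ ≤ M :=
      hh.continuousAt.norm.tendsto.eventually (ge_mem_nhds (by simp only [hM]; linarith [norm_nonneg (a c)]))
    exact ha.eventually_analyticAt.and (hh.eventually_analyticAt.and (e1.and e2))
  obtain ⟨R₂, hR₂, hb⟩ := Metric.eventually_nhds_iff_ball.1 hev
  set R₁ : ℝ := min (min R 1) (R₂ / 2) with hR₁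
  have hR1 : 0 < R₁ := by simp only [hR₁]; positivity
  have hR1R : R₁ ≤ R := (min_le_left _ _).trans (min_le_left _ _)
  have hR11 : R₁ ≤ 1 := (min_le_left _ _).trans (min_le_right _ _)
  have hR12 : R₁ < R₂ := lt_of_le_of_lt (min_le_right _ _) (by linarith)
  let χ : ContDiffBump c := ⟨R₁ / 2, R₁, by linarith, by linarith⟩
  have hχs : tsupport χ = Metric.closedBall c R₁ := χ.tsupport_eq
  -- compactly supported pieces
  have hpiece : ∀ g : ℂ × ℂ × ℂ → ℂ, (∀ y ∈ Metric.ball c R₂, AnalyticAt ℂ g y) → ∀ n : ℕ,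
      ContDiff ℝ 1 (fun y : ℂ × ℂ × ℂ => χ y • (y.1 ^ n * g y)) ∧
      ∃ K, LipschitzWith K (fun y : ℂ × ℂ × ℂ => χ y • (y.1 ^ n * g y)) := by
    intro g hg n
    have hts : tsupport (fun y : ℂ × ℂ × ℂ => χ y • (y.1 ^ n * g y)) ⊆ Metric.closedBall c R₁ := by
      rw [← hχs]; exact tsupport_smul_subset_left _ _
    have h1 : ContDiff ℝ 1 (fun y : ℂ × ℂ × ℂ => χ y • (y.1 ^ n * g y)) := by
      rw [contDiff_iff_contDiffAt]
      intro y
      by_cases hyb : y ∈ Metric.ball c R₂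
      swap
      · have hy : y ∉ tsupport (fun y : ℂ × ℂ × ℂ => χ y • (y.1 ^ n * g y)) := fun hy =>
          hyb (Metric.closedBall_subset_ball hR12 (hts hy))
        exact contDiffAt_const.congr_of_eventuallyEq (notMem_tsupport_iff_eventuallyEq.1 hy)
      have h2 : ContDiffAt ℂ 1 (fun y : ℂ × ℂ × ℂ => y.1 ^ n * g y) y :=
        ((contDiffAt_fst.pow n)).mul ((hg y hyb).contDiffAt)
      exact (χ.contDiffAt).smul (h2.restrict_scalars ℝ)
    refine ⟨h1, ContDiff.lipschitzWith_of_hasCompactSupport (𝕂 := ℝ) (n := 1) ?_ h1 (by simp)⟩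
    exact (isCompact_closedBall c R₁).of_isClosed_subset (isClosed_tsupport _) hts
  obtain ⟨ca, Ka, hLa⟩ := hpiece a (fun y hy => (hb y hy).1) τ
  obtain ⟨ch, Kh, hLh⟩ := hpiece h (fun y hy => (hb y hy).2.1) (τ + 1)
  set X : ℂ × ℂ × ℂ → ℂ × ℂ × ℂ := fun y => (-y.1, -(χ y • (y.1 ^ τ * a y)),
    -((D : ℂ) * y.2.2) - χ y • (y.1 ^ (τ + 1) * h y)) with hX
  have hXc : ContDiff ℝ 1 X := by
    refine contDiff_fst.neg.prodMk (ca.neg.prodMk (ContDiff.sub ?_ ch))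
    exact (contDiff_const.mul (contDiff_snd.comp contDiff_snd)).neg
  have hXL : ∃ K, LipschitzWith K X := by
    have l1 : LipschitzWith 1 (fun y : ℂ × ℂ × ℂ => -y.1) := LipschitzWith.prod_fst.neg
    have l2 : LipschitzWith (‖(D:ℂ)‖₊ * (1 * 1)) (fun y : ℂ × ℂ × ℂ => -((D : ℂ) * y.2.2)) := by
      have := (lipschitzWith_smul (D:ℂ) (α := ℂ)).comp ((LipschitzWith.prod_snd (α := ℂ) (β := ℂ)).comp
        (LipschitzWith.prod_snd (α := ℂ) (β := ℂ × ℂ)))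
      exact this.neg
    exact ⟨_, l1.prodMk (hLa.neg.prodMk (l2.sub hLh))⟩
  obtain ⟨K, hXL⟩ := hXL
  choose Φ hΦ0 hΦ using global_curve hXc hXL
  have hM1 : 0 < 1 + M := by linarith
  set r : ℝ := R₁ / (4 * (1 + M)) with hr
  have hr0 : 0 < r := by positivity
  have hrM : r * (1 + M) = R₁ / 4 := by rw [hr]; field_simp
  have hrR : r ≤ R₁ / 4 := by nlinarith
  refine ⟨r, hr0, by linarith, Φ, fun y hy => ⟨hΦ0 y, ?_⟩⟩
  set φ := Φ y with hφ
  have hd := hΦ y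
  have d1 : ∀ t, HasDerivAt (fun t => (φ t).1) (-(φ t).1) t := fun t => by
    have := (hasFDerivAt_fst (𝕜 := ℝ) (p := φ t)).comp_hasDerivAt t (hd t)
    exact this
  have d2 : ∀ t, HasDerivAt (fun t => (φ t).2.1) (-(χ (φ t) • ((φ t).1 ^ τ * a (φ t)))) t := fun t => by
    have := ((hasFDerivAt_fst (𝕜 := ℝ) (p := (φ t).2)).comp (φ t) (hasFDerivAt_snd (𝕜 := ℝ) (p := φ t))).comp_hasDerivAt t (hd t)
    exact this
  have d3 : ∀ t, HasDerivAt (fun t => (φ t).2.2) (-((D : ℂ) * (φ t).2.2) - χ (φ t) • ((φ t).1 ^ (τ + 1) * h (φ t))) t := fun t => by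
    have := ((hasFDerivAt_snd (𝕜 := ℝ) (p := (φ t).2)).comp (φ t) (hasFDerivAt_snd (𝕜 := ℝ) (p := φ t))).comp_hasDerivAt t (hd t)
    exact this
  have hφ0 : φ 0 = y := hΦ0 y
  have hvf := v_formula (fun t _ => d1 t)
  rw [hφ0] at hvf
  rw [Metric.mem_ball, Prod.dist_eq, Prod.dist_eq, max_lt_iff, max_lt_iff] at hy
  simp only [hc, dist_eq_norm, sub_zero] at hy
  obtain ⟨hy1, hy2, hy3⟩ := hy
  have hv : ∀ t, 0 ≤ t → ‖(φ t).1‖ = ‖y.1‖ * Real.exp (-t) := by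
    intro t ht
    rw [hvf t ht, norm_mul, Complex.norm_real, Real.norm_eq_abs, abs_of_pos (Real.exp_pos _)]
  have hv1 : ∀ t, 0 ≤ t → ‖(φ t).1‖ ≤ r := by
    intro t ht
    rw [hv t ht]
    have : Real.exp (-t) ≤ 1 := Real.exp_le_one_iff.2 (by linarith)
    nlinarith [norm_nonneg y.1]
  have hcut : ∀ g : ℂ × ℂ × ℂ → ℂ, (∀ y ∈ Metric.ball c R₂, ‖g y‖ ≤ M) → ∀ n, 1 ≤ n → ∀ t, 0 ≤ t →
      ‖χ (φ t) • ((φ t).1 ^ n * g (φ t))‖ ≤ M * r * Real.exp (-t) := by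
    intro g hg n hn t ht
    by_cases hin : φ t ∈ Metric.ball c R₂
    · rw [norm_smul, norm_mul, norm_pow, Real.norm_eq_abs, abs_of_nonneg χ.nonneg]
      have h1 : ‖(φ t).1‖ ^ n ≤ ‖(φ t).1‖ ^ 1 := by
        apply pow_le_pow_of_le_one (norm_nonneg _) _ hn
        linarith [hv1 t ht]
      rw [pow_one, hv t ht] at h1
      have h2 := hg _ hin
      have h3 : χ (φ t) ≤ 1 := χ.le_one
      rw [hv t ht] at *
      calc χ (φ t) * ((‖y.1‖ * Real.exp (-t)) ^ n * ‖g (φ t)‖)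
          ≤ 1 * ((r * Real.exp (-t)) * M) := by gcongr; exact h1.trans (by gcongr)
        _ = _ := by ring
    · have : χ (φ t) = 0 := χ.zero_of_le_dist (by
        have : R₂ ≤ dist (φ t) c := by simpa using hin
        show R₁ ≤ _
        linarith)
      rw [this, zero_smul, norm_zero]; positivity
  have hin : ∀ t, 0 ≤ t → φ t ∈ Metric.closedBall c (R₁ / 2) := by
    intro t ht
    rw [Metric.mem_closedBall, Prod.dist_eq, Prod.dist_eq, max_le_iff, max_le_iff]
    simp only [hc, dist_eq_norm, sub_zero]
    refine ⟨by linarith [hv1 t ht], ?_, ?_⟩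
    · have h1 := expBound (f := fun t => (φ t).2.1) (C := M * r) (k := -1) (by norm_num) (fun t _ => d2 t) (by
        intro t ht
        rw [norm_neg]
        have := hcut a (fun y hy => (hb y hy).2.2.1) τ hτ t ht
        simpa using this) le_rfl ht
      simp only [hφ0, mul_zero, Real.exp_zero] at h1
      have h2 : ‖(φ t).2.1 - y.2.1‖ ≤ M * r := by
        refine h1.trans ?_
        have : 0 < Real.exp (-1 * t) := Real.exp_pos _
        have : 0 < M * r := by positivity
        rw [div_neg, div_one]
        nlinarith
      have h3 : (φ t).2.1 - z₀ = ((φ t).2.1 - y.2.1) + (y.2.1 - z₀) := by ring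
      rw [h3]
      refine (norm_add_le _ _).trans ?_
      nlinarith
    · have d4 : ∀ t, 0 ≤ t → HasDerivAt (fun t : ℝ => ((Real.exp (D * t) : ℝ) : ℂ) * (φ t).2.2)
          (-(((Real.exp (D * t) : ℝ) : ℂ) * (χ (φ t) • ((φ t).1 ^ (τ + 1) * h (φ t))))) t := by
        intro t _
        have h1 : HasDerivAt (fun t : ℝ => Real.exp (D * t)) (Real.exp (D * t) * (D * 1)) t :=
          ((hasDerivAt_id t).const_mul (D:ℝ)).exp
        have := (h1.ofReal_comp).mul (d3 t)
        exact this.congr_deriv (by push_cast; ring)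
      have hD0 : (0:ℝ) < D := by exact_mod_cast hD
      have hD1 : (1:ℝ) ≤ D := by exact_mod_cast hD
      have h1 := expBound (C := M * r) (k := D) hD0.ne' d4 (by
        intro t ht
        rw [norm_neg, norm_mul, Complex.norm_real, Real.norm_eq_abs, abs_of_pos (Real.exp_pos _)]
        have := hcut h (fun y hy => (hb y hy).2.2.2) (τ + 1) (by omega) t ht
        have h5 : Real.exp (-t) ≤ 1 := Real.exp_le_one_iff.2 (by linarith)
        have : ‖χ (φ t) • ((φ t).1 ^ (τ + 1) * h (φ t))‖ ≤ M * r := this.trans (by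
          have : 0 < M * r := by positivity
          nlinarith)
        rw [mul_comm]
        gcongr) le_rfl ht
      simp only [hφ0, mul_zero, Real.exp_zero, Complex.ofReal_one, one_mul] at h1
      have hX0 : 1 ≤ Real.exp (D * t) := Real.one_le_exp (by positivity)
      set Ex := Real.exp (D * t) with hEx
      have h2 : ‖(Ex : ℂ) * (φ t).2.2‖ ≤ r + M * r * Ex := by
        have e : (Ex : ℂ) * (φ t).2.2 = ((Ex : ℂ) * (φ t).2.2 - y.2.2) + y.2.2 := by ring
        rw [e]
        refine (norm_add_le _ _).trans ?_
        have h6 : M * r / D * (Ex - 1) ≤ M * r * Ex := by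
          have : M * r / D ≤ M * r := div_le_self (by positivity) hD1
          have : 0 < M * r := by positivity
          calc M * r / D * (Ex - 1) ≤ M * r * (Ex - 1) := by gcongr
            _ ≤ _ := by nlinarith
        linarith
      rw [norm_mul, Complex.norm_real, Real.norm_eq_abs, abs_of_pos (by linarith)] at h2
      have h7 : Ex * ‖(φ t).2.2‖ ≤ Ex * (r * (1 + M)) := by nlinarith
      have h8 := le_of_mul_le_mul_left h7 (by linarith)
      linarith
  intro t ht
  refine ⟨Metric.closedBall_subset_ball (by linarith) (hin t ht), ?_⟩
  have h1 : χ (φ t) = 1 := χ.one_of_mem_closedBall (hin t ht)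
  refine (hd t).congr_deriv ?_
  rw [← hφ]
  simp only [hX, Xf, h1, one_smul, Prod.neg_mk]
  refine Prod.ext rfl (Prod.ext rfl ?_)
  show _ = -((D:ℂ) * (φ t).2.2 + (φ t).1 ^ (τ + 1) * h (φ t))
  ring

end SCM

namespace SCM
open Asymptotics

structure Reg (z₀ : ℂ) (τ D : ℕ) (a h : ℂ × ℂ × ℂ → ℂ) (ε : ℝ) (V : ℂ × ℂ → ℂ) (c₀ : ℂ → ℂ)
    (R K : ℝ) (Kn : NNReal) : Prop where
  hR : 0 < R
  hR1 : R ≤ 1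
  hK : 1 ≤ K
  hKR : K * R ≤ 1 / 2
  hX : ∀ y ∈ Metric.ball ((0:ℂ), z₀, (0:ℂ)) R, HasFDerivAt (Xf τ D a h) (fderiv ℂ (Xf τ D a h) y) y
  hXL : LipschitzOnWith Kn (Xf τ D a h) (Metric.ball ((0:ℂ), z₀, (0:ℂ)) R)
  hXL' : LipschitzOnWith Kn (fderiv ℂ (Xf τ D a h)) (Metric.ball ((0:ℂ), z₀, (0:ℂ)) R)
  hV : ∀ y ∈ Metric.ball ((0:ℂ), z₀, (0:ℂ)) R, DifferentiableAt ℂ V (y.1, y.2.1)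
  hVb : ∀ y ∈ Metric.ball ((0:ℂ), z₀, (0:ℂ)) R, ‖V (y.1, y.2.1)‖ ≤ K * ‖y.1‖ ^ (τ + 1)
  hV1 : ∀ y ∈ Metric.ball ((0:ℂ), z₀, (0:ℂ)) R, ‖y.2.2 - V (y.1, y.2.1)‖ ≤ 1
  hc : ∀ z ∈ Metric.ball z₀ R, ‖c₀ z‖ ≤ K
  hcL : ∀ z ∈ Metric.ball z₀ R, ∀ z' ∈ Metric.ball z₀ R, ‖c₀ z - c₀ z'‖ ≤ K * ‖z - z'‖
  ha : ∀ y ∈ Metric.ball ((0:ℂ), z₀, (0:ℂ)) R, ‖a y - a (0, z₀, 0)‖ ≤ ε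
  hΞ : ∀ y ∈ Metric.ball ((0:ℂ), z₀, (0:ℂ)) R,
    ‖(D * y.2.2 + y.1 ^ (τ + 1) * h y - y.1 * dv V (y.1, y.2.1) - y.1 ^ τ * a y * dz V (y.1, y.2.1))
      - D * (y.2.2 - V (y.1, y.2.1)) + c₀ y.2.1 * y.1 ^ D‖ ≤
      K * ‖y.1‖ ^ (D + 1) + K * ‖y.1‖ ^ (τ + 1) * ‖y.2.2 - V (y.1, y.2.1)‖

theorem exists_Reg {z₀ : ℂ} {τ D : ℕ} {a h : ℂ × ℂ × ℂ → ℂ} (hτ : 1 ≤ τ) (hD : τ + 1 ≤ D)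
    (ha : AnalyticAt ℂ a (0, z₀, 0)) (hh : AnalyticAt ℂ h (0, z₀, 0)) {ε : ℝ} (hε : 0 < ε) :
    ∃ V c₀ R K Kn, Reg z₀ τ D a h ε V c₀ R K Kn := by
  obtain ⟨V, hV, hVO, hVzO, hRO⟩ := exists_V hτ ha hh D hD le_rfl
  have hV0 : V (0, z₀) = 0 := by
    have := hVO.eq_zero_imp.self_of_nhds
    apply this; simp
  have hRA : AnalyticAt ℂ (Res τ D a h V) (0, z₀) := by
    have comp3 : ∀ {g : ℂ × ℂ × ℂ → ℂ}, AnalyticAt ℂ g (0, z₀, 0) →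
        AnalyticAt ℂ (fun q : ℂ × ℂ => g (q.1, q.2, V q)) (0, z₀) := by
      intro g hg
      refine AnalyticAt.comp' (f := fun q : ℂ × ℂ => (q.1, q.2, V q)) (by simpa [hV0] using hg) ?_
      exact analyticAt_fst.prod (analyticAt_snd.prod hV)
    have h1 := comp3 ha
    have h2 := comp3 hh
    have h3 := analyticAt_dv hV
    have h4 := analyticAt_dz hV
    have h5 : AnalyticAt ℂ (fun q : ℂ × ℂ => q.1) (0, z₀) := analyticAt_fst
    unfold Res
    exact (((h5.mul h3).add (((h5.pow τ).mul h1).mul h4)).sub (analyticAt_const.mul hV)).sub ((h5.pow _).mul h2)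
  obtain ⟨c₀, hc₀, hTO⟩ := taylorT D hRA hRO
  obtain ⟨C1, hC1⟩ := hVO.bound
  obtain ⟨C2, hC2⟩ := hVzO.bound
  obtain ⟨C3, hC3⟩ := hTO.bound
  set c : ℂ × ℂ × ℂ := (0, z₀, 0) with hc
  have hXA : AnalyticAt ℂ (Xf τ D a h) c := by
    have h5 : AnalyticAt ℂ (fun y : ℂ × ℂ × ℂ => y.1) c := analyticAt_fst
    have h6 : AnalyticAt ℂ (fun y : ℂ × ℂ × ℂ => y.2.2) c := analyticAt_snd.comp' analyticAt_snd
    unfold Xf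
    exact h5.prod (((h5.pow _).mul ha).prod ((analyticAt_const.mul h6).add ((h5.pow _).mul hh)))
  obtain ⟨k1, t1, ht1, hl1⟩ := (hXA.contDiffAt (n := 1)).exists_lipschitzOnWith
  obtain ⟨k2, t2, ht2, hl2⟩ := (hXA.fderiv.contDiffAt (n := 1)).exists_lipschitzOnWith
  obtain ⟨k3, t3, ht3, hl3⟩ := (ha.contDiffAt (n := 1)).exists_lipschitzOnWith
  obtain ⟨k4, t4, ht4, hl4⟩ := (hh.contDiffAt (n := 1)).exists_lipschitzOnWith
  obtain ⟨k5, t5, ht5, hl5⟩ := (hc₀.contDiffAt (n := 1)).exists_lipschitzOnWith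
  have hproj : Tendsto (fun y : ℂ × ℂ × ℂ => (y.1, y.2.1)) (𝓝 c) (𝓝 (0, z₀)) := by
    apply Continuous.tendsto' (by fun_prop); simp [hc]
  have hVt : Tendsto (fun y : ℂ × ℂ × ℂ => V (y.1, y.2.1)) (𝓝 c) (𝓝 0) := by
    have := hV.continuousAt.tendsto.comp hproj
    rwa [hV0] at this
  have hYt : Tendsto (fun y : ℂ × ℂ × ℂ => (y.1, y.2.1, V (y.1, y.2.1))) (𝓝 c) (𝓝 c) := by
    have h1 : Tendsto (fun y : ℂ × ℂ × ℂ => y.1) (𝓝 c) (𝓝 0) := by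
      apply Continuous.tendsto' (by fun_prop); simp [hc]
    have h2 : Tendsto (fun y : ℂ × ℂ × ℂ => y.2.1) (𝓝 c) (𝓝 z₀) := by
      apply Continuous.tendsto' (by fun_prop); simp [hc]
    exact h1.prodMk_nhds (h2.prodMk_nhds hVt)
  have e1 : ∀ᶠ y : ℂ × ℂ × ℂ in 𝓝 c, ‖y.2.2 - V (y.1, y.2.1)‖ ≤ 1 := by
    have h1 : Tendsto (fun y : ℂ × ℂ × ℂ => y.2.2) (𝓝 c) (𝓝 0) := by
      apply Continuous.tendsto' (by fun_prop); simp [hc]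
    have := (h1.sub hVt).norm
    rw [sub_zero, norm_zero] at this
    exact this.eventually (ge_mem_nhds one_pos)
  have e2 : ∀ᶠ y in 𝓝 c, ‖a y - a c‖ ≤ ε := by
    have := (ha.continuousAt.tendsto.sub_const (a c)).norm
    rw [sub_self, norm_zero] at this
    exact this.eventually (ge_mem_nhds hε)
  have e3 : ∀ᶠ z in 𝓝 z₀, ‖c₀ z‖ ≤ ‖c₀ z₀‖ + 1 :=
    hc₀.continuousAt.norm.tendsto.eventually (ge_mem_nhds (by linarith))
  have E1 : ∀ᶠ y in 𝓝 c, (AnalyticAt ℂ (Xf τ D a h) y ∧ y ∈ t1 ∧ y ∈ t2 ∧ y ∈ t3 ∧ y ∈ t4 ∧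
      (y.1, y.2.1, V (y.1, y.2.1)) ∈ t3 ∧ (y.1, y.2.1, V (y.1, y.2.1)) ∈ t4) ∧
      AnalyticAt ℂ V (y.1, y.2.1) ∧ ‖V (y.1, y.2.1)‖ ≤ C1 * ‖y.1 ^ (τ + 1)‖ ∧
      ‖dz V (y.1, y.2.1)‖ ≤ C2 * ‖y.1 ^ (τ + 1)‖ ∧
      ‖Res τ D a h V (y.1, y.2.1) - c₀ y.2.1 * y.1 ^ D‖ ≤ C3 * ‖y.1 ^ (D + 1)‖ := by
    refine Filter.Eventually.and ?_ ?_
    · exact hXA.eventually_analyticAt.and (Filter.Eventually.and ht1 (Filter.Eventually.and ht2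
        (Filter.Eventually.and ht3 (Filter.Eventually.and ht4 (Filter.Eventually.and (hYt.eventually ht3) (hYt.eventually ht4))))))
    · exact (hproj.eventually hV.eventually_analyticAt).and ((hproj.eventually hC1).and
        ((hproj.eventually hC2).and (hproj.eventually hC3)))
  obtain ⟨R1, hR1, hb1⟩ := Metric.eventually_nhds_iff_ball.1 (E1.and (e1.and e2))
  obtain ⟨R2, hR2, hb2⟩ := Metric.eventually_nhds_iff_ball.1 (e3.and ht5)
  set K : ℝ := 1 + |C1| + |C2| * k3 + |C3| + k4 + k5 + ‖c₀ z₀‖ with hK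
  have hK1 : 1 ≤ K := by simp only [hK]; have := norm_nonneg (c₀ z₀); have : 0 ≤ |C1| + |C2| * k3 + |C3| + k4 + k5 := by positivity
                         linarith
  set R : ℝ := min (min R1 R2) (1 / (2 * K)) with hR
  have hRp : 0 < R := by simp only [hR]; positivity
  have hRR1 : R ≤ R1 := (min_le_left _ _).trans (min_le_left _ _)
  have hRR2 : R ≤ R2 := (min_le_left _ _).trans (min_le_right _ _)
  have hRK : R ≤ 1 / (2 * K) := min_le_right _ _
  have hKR : K * R ≤ 1 / 2 := by
    rw [le_div_iff₀ (by positivity)] at hRK; linarith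
  have hR1' : R ≤ 1 := by nlinarith
  have hb1' : ∀ y ∈ Metric.ball c R, _ := fun y hy => hb1 y (Metric.ball_subset_ball hRR1 hy)
  have hb2' : ∀ z ∈ Metric.ball z₀ R, _ := fun y hy => hb2 y (Metric.ball_subset_ball hRR2 hy)
  have k1l : k1 ≤ max k1 k2 := le_max_left _ _
  have k2l : k2 ≤ max k1 k2 := le_max_right _ _
  have hy1 : ∀ y ∈ Metric.ball c R, ‖y.1‖ ≤ 1 := by
    intro y hy
    rw [Metric.mem_ball, Prod.dist_eq, max_lt_iff] at hy
    have := hy.1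
    simp only [hc, dist_eq_norm, sub_zero] at this
    linarith
  refine ⟨V, c₀, R, K, max k1 k2, hRp, hR1', hK1, hKR, ?_, ?_, ?_, ?_, ?_, ?_, ?_, ?_, ?_, ?_⟩
  · intro y hy
    exact (hb1' y hy).1.1.1.differentiableAt.hasFDerivAt
  · exact (hl1.mono fun y hy => (hb1' y hy).1.1.2.1).weaken k1l
  · exact (hl2.mono fun y hy => (hb1' y hy).1.1.2.2.1).weaken k2l
  · intro y hy
    exact (hb1' y hy).1.2.1.differentiableAt
  · intro y hy
    have := (hb1' y hy).1.2.2.1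
    rw [norm_pow] at this
    refine this.trans ?_
    gcongr
    simp only [hK]
    have := norm_nonneg (c₀ z₀); have := le_abs_self C1
    have : 0 ≤ |C2| * k3 + |C3| + k4 + k5 := by positivity
    linarith
  · exact fun y hy => (hb1' y hy).2.1
  · intro z hz
    refine (hb2' z hz).1.trans ?_
    simp only [hK]
    have : 0 ≤ |C1| + |C2| * k3 + |C3| + k4 + k5 := by positivity
    linarith
  · intro z hz z' hz'
    refine (hl5.norm_sub_le (hb2' z hz).2 (hb2' z' hz').2).trans ?_
    gcongr
    simp only [hK]
    have : 0 ≤ |C1| + |C2| * k3 + |C3| + k4 + ‖c₀ z₀‖ := by positivity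
    linarith
  · exact fun y hy => (hb1' y hy).2.2
  · intro y hy
    obtain ⟨⟨⟨_, _, _, m3, m4, m5, m6⟩, _, b1, b2, b3⟩, _, _⟩ := hb1' y hy
    have n1 := hy1 y hy
    have l3 := hl3.norm_sub_le m3 m5
    have l4 := hl4.norm_sub_le m4 m6
    have hdiff : ‖y - (y.1, y.2.1, V (y.1, y.2.1))‖ = ‖y.2.2 - V (y.1, y.2.1)‖ := by
      have : y - (y.1, y.2.1, V (y.1, y.2.1)) = (0, 0, y.2.2 - V (y.1, y.2.1)) := by
        refine Prod.ext ?_ (Prod.ext ?_ ?_) <;> simp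
      rw [this]; simp [Prod.norm_def]
    rw [hdiff] at l3 l4
    set W := V (y.1, y.2.1) with hW
    set δ := ‖y.2.2 - W‖ with hδ
    have e : (D * y.2.2 + y.1 ^ (τ + 1) * h y - y.1 * dv V (y.1, y.2.1) - y.1 ^ τ * a y * dz V (y.1, y.2.1))
      - D * (y.2.2 - W) + c₀ y.2.1 * y.1 ^ D = -(Res τ D a h V (y.1, y.2.1) - c₀ y.2.1 * y.1 ^ D)
        + y.1 ^ (τ + 1) * (h y - h (y.1, y.2.1, W)) - y.1 ^ τ * (a y - a (y.1, y.2.1, W)) * dz V (y.1, y.2.1) := by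
      simp only [Res]; ring
    rw [e]
    refine (norm_sub_le _ _).trans ?_
    refine (add_le_add_left (norm_add_le _ _) _).trans ?_
    rw [norm_neg, norm_mul, norm_mul, norm_mul]
    rw [norm_pow] at b1 b2 b3
    rw [norm_pow, norm_pow]
    have f1 : ‖y.1‖ ^ τ * ‖a y - a (y.1, y.2.1, W)‖ * ‖dz V (y.1, y.2.1)‖ ≤ |C2| * k3 * ‖y.1‖ ^ (τ + 1) * δ := by
      calc _ ≤ 1 * (k3 * δ) * (|C2| * ‖y.1‖ ^ (τ + 1)) := by
            gcongr
            · exact pow_le_one₀ (norm_nonneg _) n1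
            · exact b2.trans (by gcongr; exact le_abs_self _)
        _ = _ := by ring
    have f2 : ‖y.1‖ ^ (τ + 1) * ‖h y - h (y.1, y.2.1, W)‖ ≤ k4 * ‖y.1‖ ^ (τ + 1) * δ := by
      calc _ ≤ ‖y.1‖ ^ (τ + 1) * (k4 * δ) := by gcongr
        _ = _ := by ring
    have f3 : ‖Res τ D a h V (y.1, y.2.1) - c₀ y.2.1 * y.1 ^ D‖ ≤ K * ‖y.1‖ ^ (D + 1) := by
      refine b3.trans ?_
      gcongr
      simp only [hK]
      have := norm_nonneg (c₀ z₀); have := le_abs_self C3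
      have : 0 ≤ |C1| + |C2| * k3 + k4 + k5 := by positivity
      linarith
    have f4 : |C2| * k3 * ‖y.1‖ ^ (τ + 1) * δ + k4 * ‖y.1‖ ^ (τ + 1) * δ ≤ K * ‖y.1‖ ^ (τ + 1) * δ := by
      have : |C2| * k3 + k4 ≤ K := by
        simp only [hK]
        have : 0 ≤ |C1| + |C3| + k5 + ‖c₀ z₀‖ := by positivity
        linarith
      have h0 : 0 ≤ ‖y.1‖ ^ (τ + 1) * δ := by positivity
      nlinarith
    linarith

end SCM

namespace SCM
open Asymptotics

theorem limLemma {E : Type*} [NormedAddCommGroup E] [NormedSpace ℝ E] [CompleteSpace E] {f f' : ℝ → E} {C k : ℝ} (hk : 0 < k)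
    (hC : 0 ≤ C)
    (hf : ∀ t, 0 ≤ t → HasDerivAt f (f' t) t) (hb : ∀ t, 0 ≤ t → ‖f' t‖ ≤ C * Real.exp (-(k * t))) :
    ∃ l, Tendsto f atTop (𝓝 l) ∧ ∀ t, 0 ≤ t → ‖f t - l‖ ≤ C / k * Real.exp (-(k * t)) := by
  have key : ∀ a b, 0 ≤ a → a ≤ b → ‖f b - f a‖ ≤ C / k * Real.exp (-(k * a)) := by
    intro a b ha hab
    have := expBound (k := -k) (by linarith) hf (fun t ht => by simpa using hb t ht) ha hab
    refine this.trans ?_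
    rw [div_neg, neg_mul_comm, neg_sub, neg_mul, neg_mul]
    gcongr
    have := Real.exp_pos (-(k*b))
    linarith
  have hexp : Tendsto (fun t => C / k * Real.exp (-(k * t))) atTop (𝓝 0) := by
    have h1 : Tendsto (fun t => k * t) atTop atTop := tendsto_id.const_mul_atTop hk
    have h2 := (Real.tendsto_exp_neg_atTop_nhds_zero.comp h1).const_mul (C / k)
    simpa using h2
  have hcau : CauchySeq f := by
    rw [Metric.cauchySeq_iff']
    intro e he
    obtain ⟨T, hT⟩ := ((hexp.eventually (gt_mem_nhds he)).and (eventually_ge_atTop 0)).exists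
    refine ⟨T, fun n hn => ?_⟩
    rw [dist_eq_norm]
    exact (key T n hT.2 hn).trans_lt hT.1
  obtain ⟨l, hl⟩ := cauchySeq_tendsto_of_complete hcau
  refine ⟨l, hl, fun t ht => ?_⟩
  rw [norm_sub_rev]
  refine le_of_tendsto ((hl.sub_const (f t)).norm) ?_
  filter_upwards [eventually_ge_atTop t] with b hb
  exact key t b ht hb

noncomputable def Gf (D : ℕ) (V : ℂ × ℂ → ℂ) (y : ℂ × ℂ × ℂ) : ℂ := (y.2.2 - V (y.1, y.2.1)) * (y.1 ^ D)⁻¹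

noncomputable def XG (τ D : ℕ) (a h : ℂ × ℂ × ℂ → ℂ) (V : ℂ × ℂ → ℂ) (y : ℂ × ℂ × ℂ) : ℂ :=
  ((D * y.2.2 + y.1 ^ (τ + 1) * h y - y.1 * dv V (y.1, y.2.1) - y.1 ^ τ * a y * dz V (y.1, y.2.1))
      - D * (y.2.2 - V (y.1, y.2.1))) * (y.1 ^ D)⁻¹

theorem Gf_deriv {τ D : ℕ} {a h : ℂ × ℂ × ℂ → ℂ} {V : ℂ × ℂ → ℂ} {y : ℂ × ℂ × ℂ}
    (hV : DifferentiableAt ℂ V (y.1, y.2.1)) (hy : y.1 ≠ 0) :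
    ∃ L : ℂ × ℂ × ℂ →L[ℂ] ℂ, HasFDerivAt (Gf D V) L y ∧ L (Xf τ D a h y) = XG τ D a h V y := by
  have h1 : HasFDerivAt (fun y : ℂ × ℂ × ℂ => y.1) (ContinuousLinearMap.fst ℂ ℂ (ℂ × ℂ)) y := hasFDerivAt_fst
  have h2 : HasFDerivAt (fun y : ℂ × ℂ × ℂ => y.2.1) ((ContinuousLinearMap.fst ℂ ℂ ℂ).comp (ContinuousLinearMap.snd ℂ ℂ (ℂ × ℂ))) y :=
    hasFDerivAt_fst.comp y hasFDerivAt_snd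
  have h3 : HasFDerivAt (fun y : ℂ × ℂ × ℂ => y.2.2) ((ContinuousLinearMap.snd ℂ ℂ ℂ).comp (ContinuousLinearMap.snd ℂ ℂ (ℂ × ℂ))) y :=
    hasFDerivAt_snd.comp y hasFDerivAt_snd
  have h4 := hV.hasFDerivAt.comp y (h1.prodMk h2)
  have h5 : HasDerivAt (fun v : ℂ => (v ^ D)⁻¹) (-(D * y.1 ^ (D - 1)) / (y.1 ^ D) ^ 2) y.1 :=
    (hasDerivAt_pow D y.1).inv (pow_ne_zero _ hy)
  have h6 := h5.hasFDerivAt.comp y h1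
  refine ⟨_, (h3.sub h4).mul h6, ?_⟩
  have hlin : fderiv ℂ V (y.1, y.2.1) (y.1, y.1 ^ τ * a y) = y.1 * dv V (y.1, y.2.1) + y.1 ^ τ * a y * dz V (y.1, y.2.1) := by
    have : ((y.1, y.1 ^ τ * a y) : ℂ × ℂ) = y.1 • ((1:ℂ), (0:ℂ)) + (y.1 ^ τ * a y) • ((0:ℂ), (1:ℂ)) := by
      simp
    rw [this, map_add, map_smul, map_smul]
    rfl
  simp only [Xf, XG, ContinuousLinearMap.add_apply, ContinuousLinearMap.sub_apply, ContinuousLinearMap.smul_apply,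
    ContinuousLinearMap.comp_apply, ContinuousLinearMap.prod_apply, ContinuousLinearMap.coe_fst', ContinuousLinearMap.coe_snd',
    hlin, smul_eq_mul, Function.comp]
  have h7 : y.1 * (-(D * y.1 ^ (D - 1)) / (y.1 ^ D) ^ 2) = - D * (y.1 ^ D)⁻¹ := by
    rcases Nat.eq_zero_or_pos D with h | h
    · subst h; simp
    · have : y.1 * y.1 ^ (D - 1) = y.1 ^ D := by rw [← pow_succ']; congr 1; omega
      rw [← this]
      have := pow_ne_zero (D-1) hy
      field_simp
  simp [ContinuousLinearMap.toSpanSingleton_apply]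
  have h8 : (y.1 * (-(D * y.1 ^ (D - 1)) / (y.1 ^ D) ^ 2)) = - D * (y.1 ^ D)⁻¹ := h7
  linear_combination (y.2.2 - V (y.1, y.2.1)) * h8

theorem XG_bound {z₀ : ℂ} {τ D : ℕ} {a h : ℂ × ℂ × ℂ → ℂ} {ε : ℝ} {V : ℂ × ℂ → ℂ} {c₀ : ℂ → ℂ}
    {R K : ℝ} {Kn : NNReal} (rg : Reg z₀ τ D a h ε V c₀ R K Kn) {y : ℂ × ℂ × ℂ}
    (hy : y ∈ Metric.ball ((0:ℂ), z₀, (0:ℂ)) R) (hy0 : y.1 ≠ 0) :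
    ‖XG τ D a h V y + c₀ y.2.1‖ ≤ K * ‖y.1‖ + K * ‖y.1‖ ^ (τ + 1) * ‖Gf D V y‖ := by
  have h1 := rg.hΞ y hy
  have h2 : y.1 ^ D ≠ 0 := pow_ne_zero _ hy0
  have h3 : 0 < ‖y.1‖ ^ D := by positivity
  have e : XG τ D a h V y + c₀ y.2.1 = ((D * y.2.2 + y.1 ^ (τ + 1) * h y - y.1 * dv V (y.1, y.2.1) - y.1 ^ τ * a y * dz V (y.1, y.2.1))
      - D * (y.2.2 - V (y.1, y.2.1)) + c₀ y.2.1 * y.1 ^ D) * (y.1 ^ D)⁻¹ := by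
    rw [XG, add_mul _ (c₀ y.2.1 * y.1 ^ D), mul_assoc (c₀ _), mul_inv_cancel₀ h2, mul_one]
  rw [e, norm_mul, norm_inv, norm_pow, ← div_eq_mul_inv, div_le_iff₀ h3]
  refine h1.trans (le_of_eq ?_)
  rw [Gf, norm_mul, norm_inv, norm_pow]
  field_simp
  ring

set_option maxHeartbeats 1000000 in
theorem ray {z₀ : ℂ} {τ D q : ℕ} {a h : ℂ × ℂ × ℂ → ℂ} {ε : ℝ} {V : ℂ × ℂ → ℂ} {c₀ : ℂ → ℂ}
    {R K : ℝ} {Kn : NNReal} (hτ : 1 ≤ τ) (hD : D = τ + 1 + q) (rg : Reg z₀ τ D a h ε V c₀ R K Kn)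
    (hε : 0 ≤ ε) (haε : ‖a (0, z₀, 0)‖ + ε ≤ 2)
    {φ : ℝ → ℂ × ℂ × ℂ} (hin : ∀ t, 0 ≤ t → φ t ∈ Metric.ball ((0:ℂ), z₀, (0:ℂ)) (R / 2))
    (hd : ∀ t, 0 ≤ t → HasDerivAt φ (- Xf τ D a h (φ t)) t) (hv0 : (φ 0).1 ≠ 0) :
    ∃ P Ch : ℂ, Tendsto (fun t => (φ t).2.1) atTop (𝓝 P) ∧ P ∈ Metric.ball z₀ R ∧
      ‖(φ 0).2.1 - P - a (0, z₀, 0) / τ * (φ 0).1 ^ τ‖ ≤ ε * ‖(φ 0).1‖ ^ τ ∧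
      (∀ t, 0 ≤ t → ‖(φ t).1 ^ τ * a (φ t)‖ ≤ 2 * Real.exp (-t)) ∧
      (∀ t, 0 ≤ t → (φ t).1 ≠ 0) ∧
      Tendsto (fun t => Gf D V (φ t) - c₀ P * t) atTop (𝓝 Ch) ∧
      (∀ t, 0 ≤ t → ‖XG τ D a h V (φ t) + c₀ P‖ ≤ 8 * K ^ 2 * (‖(φ 0).1‖⁻¹) ^ q * Real.exp (-(1/2 * t))) ∧
      ‖(φ 0).2.2 * ((φ 0).1 ^ D)⁻¹ - Ch‖ ≤ 17 * K ^ 2 * (‖(φ 0).1‖⁻¹) ^ q := by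
  have hK := rg.hK
  have hR := rg.hR
  have hR1 := rg.hR1
  have hKR := rg.hKR
  have hsub : Metric.ball ((0:ℂ), z₀, (0:ℂ)) (R / 2) ⊆ Metric.ball ((0:ℂ), z₀, (0:ℂ)) R := Metric.ball_subset_ball (by linarith)
  set a₀ := a (0, z₀, 0) with ha₀
  have d1 : ∀ t, 0 ≤ t → HasDerivAt (fun t => (φ t).1) (-(φ t).1) t := fun t ht => by
    have := (hasFDerivAt_fst (𝕜 := ℝ) (p := φ t)).comp_hasDerivAt t (hd t ht)
    exact this
  have d2 : ∀ t, 0 ≤ t → HasDerivAt (fun t => (φ t).2.1) (-((φ t).1 ^ τ * a (φ t))) t := fun t ht => by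
    have := ((hasFDerivAt_fst (𝕜 := ℝ) (p := (φ t).2)).comp (φ t) (hasFDerivAt_snd (𝕜 := ℝ) (p := φ t))).comp_hasDerivAt t (hd t ht)
    exact this
  have hvf := v_formula d1
  set v₀ := (φ 0).1 with hv₀
  set ρ := ‖v₀‖ with hρ
  have hρ0 : 0 < ρ := norm_pos_iff.2 hv0
  have hv : ∀ t, 0 ≤ t → ‖(φ t).1‖ = ρ * Real.exp (-t) := by
    intro t ht
    rw [hvf t ht, norm_mul, Complex.norm_real, Real.norm_eq_abs, abs_of_pos (Real.exp_pos _)]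
  have hvne : ∀ t, 0 ≤ t → (φ t).1 ≠ 0 := by
    intro t ht
    rw [← norm_pos_iff, hv t ht]; positivity
  have hmem : ∀ t, 0 ≤ t → ‖(φ t).1‖ < R / 2 ∧ (φ t).2.1 ∈ Metric.ball z₀ (R / 2) := by
    intro t ht
    have := hin t ht
    rw [Metric.mem_ball, Prod.dist_eq, Prod.dist_eq, max_lt_iff, max_lt_iff] at this
    refine ⟨?_, this.2.1⟩
    simpa using this.1
  have hρR : ρ < R / 2 := (hmem 0 le_rfl).1
  have hρ1 : ρ ≤ 1 := by linarith
  have hexp1 : ∀ t : ℝ, 0 ≤ t → Real.exp (-t) ≤ 1 := fun t ht => Real.exp_le_one_iff.2 (by linarith)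
  have hvτ : ∀ t, 0 ≤ t → ‖(φ t).1‖ ^ τ = ρ ^ τ * Real.exp (-(τ * t)) := by
    intro t ht
    rw [hv t ht, mul_pow, ← Real.exp_nat_mul]; congr 2; ring
  have hτ0 : (0:ℝ) < τ := by exact_mod_cast hτ
  have hτ1 : (1:ℝ) ≤ τ := by exact_mod_cast hτ
  have haB : ∀ t, 0 ≤ t → ‖a (φ t)‖ ≤ 2 := by
    intro t ht
    have h1 := rg.ha _ (hsub (hin t ht))
    have : a (φ t) = (a (φ t) - a₀) + a₀ := by ring
    rw [this]
    refine (norm_add_le _ _).trans ?_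
    linarith
  have hzb : ∀ t, 0 ≤ t → ‖-((φ t).1 ^ τ * a (φ t))‖ ≤ 2 * ρ ^ τ * Real.exp (-(τ * t)) := by
    intro t ht
    rw [norm_neg, norm_mul, norm_pow, hvτ t ht]
    have h1 := haB t ht
    calc _ ≤ ρ ^ τ * Real.exp (-(τ * t)) * 2 := by gcongr
      _ = _ := by ring
  obtain ⟨P, hP, hPb⟩ := limLemma hτ0 (by positivity) d2 hzb
  -- refined limit
  have d3 : ∀ t, 0 ≤ t → HasDerivAt (fun t => (φ t).2.1 - a₀ / τ * (φ t).1 ^ τ) (-((φ t).1 ^ τ * (a (φ t) - a₀))) t := by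
    intro t ht
    have h1 := ((d1 t ht).pow τ).const_mul (a₀ / τ)
    refine ((d2 t ht).sub h1).congr_deriv ?_
    have hτc : (τ : ℂ) ≠ 0 := by exact_mod_cast hτ0.ne'
    have : (φ t).1 ^ τ = (φ t).1 ^ (τ - 1) * (φ t).1 := by rw [← pow_succ]; congr 1; omega
    rw [this]
    field_simp
    ring
  have hb3 : ∀ t, 0 ≤ t → ‖-((φ t).1 ^ τ * (a (φ t) - a₀))‖ ≤ ε * ρ ^ τ * Real.exp (-(τ * t)) := by
    intro t ht
    rw [norm_neg, norm_mul, norm_pow, hvτ t ht]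
    have h1 := rg.ha _ (hsub (hin t ht))
    calc _ ≤ ρ ^ τ * Real.exp (-(τ * t)) * ε := by gcongr
      _ = _ := by ring
  obtain ⟨P', hP', hPb'⟩ := limLemma hτ0 (by positivity) d3 hb3
  have hvlim : Tendsto (fun t => a₀ / τ * (φ t).1 ^ τ) atTop (𝓝 0) := by
    have h1 : Tendsto (fun t => (φ t).1) atTop (𝓝 0) := by
      rw [tendsto_zero_iff_norm_tendsto_zero]
      have h2 := (Real.tendsto_exp_neg_atTop_nhds_zero).const_mul ρ
      rw [mul_zero] at h2
      refine h2.congr' ?_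
      filter_upwards [eventually_ge_atTop 0] with t ht
      exact (hv t ht).symm
    have := (h1.pow τ).const_mul (a₀ / τ)
    rwa [zero_pow (by omega), mul_zero] at this
  have hPP : P' = P := by
    have := hP.sub hvlim
    rw [sub_zero] at this
    exact tendsto_nhds_unique hP' this
  subst hPP
  have hzP : ∀ t, 0 ≤ t → ‖(φ t).2.1 - P'‖ ≤ 2 * Real.exp (-t) := by
    intro t ht
    refine (hPb t ht).trans ?_
    have h1 : 2 * ρ ^ τ / τ ≤ 2 := by
      rw [div_le_iff₀ hτ0]
      have : ρ ^ τ ≤ 1 := pow_le_one₀ hρ0.le hρ1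
      linarith
    have h2 : Real.exp (-(τ * t)) ≤ Real.exp (-t) := Real.exp_le_exp.2 (by nlinarith)
    gcongr
  have hPmem : P' ∈ Metric.ball z₀ R := by
    have h1 : P' ∈ Metric.closedBall z₀ (R / 2) := by
      refine Metric.isClosed_closedBall.mem_of_tendsto hP ?_
      filter_upwards [eventually_ge_atTop 0] with t ht
      exact Metric.ball_subset_closedBall (hmem t ht).2
    exact Metric.closedBall_subset_ball (by linarith) h1
  -- G
  have dG : ∀ t, 0 ≤ t → HasDerivAt (fun t => Gf D V (φ t)) (-XG τ D a h V (φ t)) t := by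
    intro t ht
    obtain ⟨L, hL1, hL2⟩ := Gf_deriv (τ := τ) (D := D) (a := a) (h := h) (rg.hV _ (hsub (hin t ht))) (hvne t ht)
    have := (hL1.restrictScalars ℝ).comp_hasDerivAt t (hd t ht)
    refine this.congr_deriv ?_
    show L (-Xf τ D a h (φ t)) = _
    rw [map_neg, hL2]
  have hXGb : ∀ t, 0 ≤ t → ‖XG τ D a h V (φ t) + c₀ (φ t).2.1‖ ≤ K * (ρ * Real.exp (-t)) + K * (ρ * Real.exp (-t)) ^ (τ + 1) * ‖Gf D V (φ t)‖ := by
    intro t ht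
    have := XG_bound rg (hsub (hin t ht)) (hvne t ht)
    rwa [hv t ht] at this
  have hKρ : K * ρ ≤ 1 / 2 := by nlinarith
  have hG0 : ‖Gf D V (φ 0)‖ ≤ (ρ⁻¹) ^ D := by
    rw [Gf, norm_mul, norm_inv, norm_pow, inv_pow]
    have := rg.hV1 _ (hsub (hin 0 le_rfl))
    calc _ ≤ 1 * (ρ ^ D)⁻¹ := by gcongr
      _ = _ := one_mul _
  have hρi : 1 ≤ ρ⁻¹ := (one_le_inv₀ hρ0).2 hρ1
  have hGb : ∀ t, 0 ≤ t → ‖Gf D V (φ t)‖ ≤ 5 * K * (ρ⁻¹) ^ D * Real.exp (1 / 2 * t) := by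
    intro t ht
    have := norm_le_gronwallBound_of_norm_deriv_right_le (f := fun t => Gf D V (φ t)) (f' := fun t => -XG τ D a h V (φ t))
      (δ := (ρ⁻¹) ^ D) (K := 1 / 2) (ε := 2 * K) (a := 0) (b := t)
      (fun x hx => (dG x hx.1).continuousAt.continuousWithinAt) (fun x hx => (dG x hx.1).hasDerivWithinAt) hG0
      (by
        intro x hx
        rw [norm_neg]
        have h1 := hXGb x hx.1
        have h2 := rg.hc _ (Metric.ball_subset_ball (by linarith) (hmem x hx.1).2)
        have h3 : XG τ D a h V (φ x) = (XG τ D a h V (φ x) + c₀ (φ x).2.1) - c₀ (φ x).2.1 := by ring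
        rw [h3]
        refine (norm_sub_le _ _).trans ?_
        have h4 := hexp1 x hx.1
        have h5 : ρ * Real.exp (-x) ≤ ρ := by nlinarith
        have h5' : 0 ≤ ρ * Real.exp (-x) := by positivity
        have h6 : K * (ρ * Real.exp (-x)) ^ (τ + 1) ≤ 1 / 2 := by
          have : (ρ * Real.exp (-x)) ^ (τ + 1) ≤ (ρ * Real.exp (-x)) ^ 1 :=
            pow_le_pow_of_le_one h5' (h5.trans hρ1) (by omega)
          rw [pow_one] at this
          nlinarith
        have h7 : K * (ρ * Real.exp (-x)) ^ (τ + 1) * ‖Gf D V (φ x)‖ ≤ 1 / 2 * ‖Gf D V (φ x)‖ := by gcongr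
        have h8 : K * (ρ * Real.exp (-x)) ≤ K := by nlinarith
        linarith) t ⟨ht, le_rfl⟩
    rw [gronwallBound_of_K_ne_0 (by norm_num), sub_zero] at this
    refine this.trans ?_
    have h1 : 1 ≤ (ρ⁻¹) ^ D := one_le_pow₀ hρi
    have h2 : 0 < Real.exp (1 / 2 * t) := Real.exp_pos _
    have h3 : (ρ⁻¹) ^ D ≤ K * (ρ⁻¹) ^ D := by nlinarith
    have h4 : K ≤ K * (ρ⁻¹) ^ D := by nlinarith
    have : 2 * K / (1 / 2) * (Real.exp (1 / 2 * t) - 1) ≤ 4 * (K * (ρ⁻¹) ^ D) * Real.exp (1/2 * t) := by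
      have : 2 * K / (1 / 2) = 4 * K := by ring
      rw [this]
      calc 4 * K * (Real.exp (1 / 2 * t) - 1) ≤ 4 * K * Real.exp (1 / 2 * t) := by nlinarith
        _ ≤ _ := by gcongr
    have : (ρ⁻¹) ^ D * Real.exp (1 / 2 * t) ≤ (K * (ρ⁻¹) ^ D) * Real.exp (1/2 * t) := by gcongr
    nlinarith
  have hq1 : 1 ≤ (ρ⁻¹) ^ q := one_le_pow₀ hρi
  have hmain : ∀ t, 0 ≤ t → ‖XG τ D a h V (φ t) + c₀ P'‖ ≤ 8 * K ^ 2 * (ρ⁻¹) ^ q * Real.exp (-(1/2 * t)) := by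
    intro t ht
    have h1 := hXGb t ht
    have h2 := rg.hcL P' hPmem _ (Metric.ball_subset_ball (by linarith) (hmem t ht).2)
    rw [norm_sub_rev P'] at h2
    have e : XG τ D a h V (φ t) + c₀ P' = (XG τ D a h V (φ t) + c₀ (φ t).2.1) + (c₀ P' - c₀ (φ t).2.1) := by ring
    rw [e]
    refine (norm_add_le _ _).trans ?_
    have h3 : K * (ρ * Real.exp (-t)) ^ (τ + 1) * ‖Gf D V (φ t)‖ ≤ 5 * K ^ 2 * (ρ⁻¹) ^ q * Real.exp (-(1/2 * t)) := by
      have e1 : (ρ * Real.exp (-t)) ^ (τ + 1) ≤ ρ ^ (τ + 1) * Real.exp (-t) := by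
        rw [mul_pow]
        gcongr
        exact pow_le_of_le_one (Real.exp_pos _).le (hexp1 t ht) (by omega)
      calc _ ≤ K * (ρ ^ (τ + 1) * Real.exp (-t)) * (5 * K * (ρ⁻¹) ^ D * Real.exp (1 / 2 * t)) := by
            gcongr; exact hGb t ht
        _ = 5 * K ^ 2 * (ρ ^ (τ + 1) * (ρ⁻¹) ^ (τ + 1)) * (ρ⁻¹) ^ q * (Real.exp (-t) * Real.exp (1 / 2 * t)) := by
            rw [hD, pow_add _ (τ + 1) q]; ring
        _ = _ := by
            rw [← mul_pow, mul_inv_cancel₀ hρ0.ne', one_pow, mul_one, ← Real.exp_add]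
            congr 2; ring
    have h4 : Real.exp (-t) ≤ Real.exp (-(1/2 * t)) := Real.exp_le_exp.2 (by linarith)
    have h5 : K * (ρ * Real.exp (-t)) ≤ K ^ 2 * (ρ⁻¹) ^ q * Real.exp (-(1/2 * t)) := by
      calc _ ≤ K * (1 * Real.exp (-(1/2 * t))) := by gcongr
        _ ≤ K ^ 2 * (ρ⁻¹) ^ q * Real.exp (-(1/2 * t)) := by
          rw [one_mul]; gcongr; nlinarith
    have h6 : K * ‖(φ t).2.1 - P'‖ ≤ 2 * (K ^ 2 * (ρ⁻¹) ^ q * Real.exp (-(1/2 * t))) := by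
      calc _ ≤ K * (2 * Real.exp (-(1/2 * t))) := by gcongr; exact (hzP t ht).trans (by gcongr)
        _ = 2 * (K * Real.exp (-(1/2 * t))) := by ring
        _ ≤ _ := by
          gcongr; nlinarith
    linarith
  have dG2 : ∀ t, 0 ≤ t → HasDerivAt (fun t : ℝ => Gf D V (φ t) - c₀ P' * t) (-(XG τ D a h V (φ t) + c₀ P')) t := by
    intro t ht
    have h1 : HasDerivAt (fun t : ℝ => c₀ P' * (t : ℂ)) (c₀ P' * 1) t :=
      (Complex.ofRealCLM.hasDerivAt (x := t)).const_mul (c₀ P')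
    exact ((dG t ht).sub h1).congr_deriv (by ring)
  obtain ⟨Ch, hCh, hChb⟩ := limLemma (k := 1 / 2) (C := 8 * K ^ 2 * (ρ⁻¹) ^ q) (by norm_num) (by positivity) dG2
    (fun t ht => by rw [norm_neg]; exact hmain t ht)
  refine ⟨P', Ch, hP, hPmem, ?_, ?_, hvne, hCh, hmain, ?_⟩
  · have := hPb' 0 le_rfl
    rw [mul_zero, neg_zero, Real.exp_zero, mul_one] at this
    rw [sub_right_comm]
    refine this.trans ?_
    rw [div_le_iff₀ hτ0]
    have : 0 ≤ ε * ρ ^ τ := by positivity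
    nlinarith
  · intro t ht
    have := hzb t ht
    rw [norm_neg] at this
    refine this.trans ?_
    have h1 : ρ ^ τ ≤ 1 := pow_le_one₀ hρ0.le hρ1
    have h2 : Real.exp (-(τ * t)) ≤ Real.exp (-t) := Real.exp_le_exp.2 (by nlinarith)
    calc _ ≤ 2 * 1 * Real.exp (-t) := by gcongr
      _ = _ := by ring
  · have h1 := hChb 0 le_rfl
    simp only [mul_zero, neg_zero, Real.exp_zero, mul_one, Complex.ofReal_zero, sub_zero] at h1
    have h2 : ‖V ((φ 0).1, (φ 0).2.1) * ((φ 0).1 ^ D)⁻¹‖ ≤ K * (ρ⁻¹) ^ q := by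
      rw [norm_mul, norm_inv, norm_pow]
      calc _ ≤ K * ρ ^ (τ + 1) * (ρ ^ D)⁻¹ := by
            gcongr; exact rg.hVb _ (hsub (hin 0 le_rfl))
        _ = _ := by
            rw [hD, pow_add _ (τ + 1) q, inv_pow]; field_simp
    have e : (φ 0).2.2 * ((φ 0).1 ^ D)⁻¹ - Ch = (Gf D V (φ 0) - Ch) + V ((φ 0).1, (φ 0).2.1) * ((φ 0).1 ^ D)⁻¹ := by
      rw [Gf]; ring
    rw [hv₀, e]
    refine (norm_add_le _ _).trans ?_
    have h3 : K * (ρ⁻¹) ^ q ≤ K ^ 2 * (ρ⁻¹) ^ q := by gcongr; nlinarith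
    have h4 : 8 * K ^ 2 * (ρ⁻¹) ^ q / (1 / 2) = 16 * K ^ 2 * (ρ⁻¹) ^ q := by ring
    rw [h4] at h1
    linarith

end SCM

namespace SCM
open Asymptotics

/-- local constancy on an interval -/
theorem const_of_local {f : ℝ → ℂ} {a b : ℝ} (hf : ∀ s ∈ Set.Icc a b, ∀ᶠ s' in 𝓝[Set.Icc a b] s, f s' = f s) :
    ∀ s ∈ Set.Icc a b, f s = f a := by
  intro s hs
  have hsub : Set.Icc a s ⊆ Set.Icc a b := Set.Icc_subset_Icc le_rfl hs.2
  have hcont : ContinuousOn f (Set.Icc a s) := by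
    intro x hx
    have h1 : Tendsto f (𝓝[Set.Icc a b] x) (𝓝 (f x)) :=
      tendsto_const_nhds.congr' (by filter_upwards [hf x (hsub hx)] with y hy using hy.symm)
    exact h1.mono_left (nhdsWithin_mono _ hsub)
  have := pathLemma (H := f) (L := fun _ => 0) (C := 0) hs.1 hcont (fun _ _ _ _ _ => le_rfl) le_rfl (by
    intro t h1 h2
    have h3 := hf t ⟨h1, h2.le.trans hs.2⟩
    have h4 : 𝓝[>] t ≤ 𝓝[Set.Icc a b] t := by
      rw [← nhdsWithin_Ioo_eq_nhdsGT (h2.trans_le hs.2)]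
      exact nhdsWithin_mono _ (fun x hx => ⟨h1.trans hx.1.le, hx.2.le⟩)
    filter_upwards [h4 h3] with t' ht'
    rw [ht']; simp)
  simp only [sub_self, mul_zero, norm_le_zero_iff, sub_eq_zero] at this
  exact this

structure Germ (τ D : ℕ) (a h : ℂ × ℂ × ℂ → ℂ) (ζ₀ : ℂ) (l k μ : ℂ → ℂ) : Prop where
  hμ : ContinuousAt μ ζ₀
  hl : ∀ᶠ ζ in 𝓝 ζ₀, HasDerivAt l (μ ζ) ζ
  hk : ∀ᶠ ζ in 𝓝 ζ₀, HasDerivAt k (μ ζ * (D * k ζ + Complex.exp (l ζ) ^ (τ + 1) * h (Complex.exp (l ζ), ζ, k ζ))) ζ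
  h1 : ∀ᶠ ζ in 𝓝 ζ₀, μ ζ * (Complex.exp (l ζ) ^ τ * a (Complex.exp (l ζ), ζ, k ζ)) = 1

set_option maxHeartbeats 1000000 in
theorem germ_const {z₀ : ℂ} {τ D q : ℕ} {a h : ℂ × ℂ × ℂ → ℂ} {ε : ℝ} {V : ℂ × ℂ → ℂ} {c₀ : ℂ → ℂ}
    {R K r : ℝ} {Kn : NNReal} (hτ : 1 ≤ τ) (hD : D = τ + 1 + q) (rg : Reg z₀ τ D a h ε V c₀ R K Kn)
    (hε : 0 ≤ ε) (haε : ‖a (0, z₀, 0)‖ + ε ≤ 2) {Φ : ℂ × ℂ × ℂ → ℝ → ℂ × ℂ × ℂ}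
    (hΦ : ∀ y ∈ Metric.ball ((0:ℂ), z₀, (0:ℂ)) r,
      Φ y 0 = y ∧ ∀ t, 0 ≤ t → Φ y t ∈ Metric.ball ((0:ℂ), z₀, (0:ℂ)) (R / 2) ∧
        HasDerivAt (Φ y) (- Xf τ D a h (Φ y t)) t)
    {ζ₀ : ℂ} {l k μ : ℂ → ℂ} (hg : Germ τ D a h ζ₀ l k μ)
    (hmem : (Complex.exp (l ζ₀), ζ₀, k ζ₀) ∈ Metric.ball ((0:ℂ), z₀, (0:ℂ)) r) :
    ∀ᶠ ζ in 𝓝 ζ₀, ∀ P Ch P₀ Ch₀ : ℂ,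
      Tendsto (fun t => (Φ (Complex.exp (l ζ), ζ, k ζ) t).2.1) atTop (𝓝 P) →
      Tendsto (fun t => Gf D V (Φ (Complex.exp (l ζ), ζ, k ζ) t) - c₀ P * t) atTop (𝓝 Ch) →
      Tendsto (fun t => (Φ (Complex.exp (l ζ₀), ζ₀, k ζ₀) t).2.1) atTop (𝓝 P₀) →
      Tendsto (fun t => Gf D V (Φ (Complex.exp (l ζ₀), ζ₀, k ζ₀) t) - c₀ P₀ * t) atTop (𝓝 Ch₀) →
      P = P₀ ∧ Ch + c₀ P * l ζ = Ch₀ + c₀ P₀ * l ζ₀ := by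
  set s : ℂ → ℂ × ℂ × ℂ := fun ζ => (Complex.exp (l ζ), ζ, k ζ) with hs
  have hsd : ∀ᶠ ζ in 𝓝 ζ₀, HasDerivAt s (μ ζ • Xf τ D a h (s ζ)) ζ := by
    filter_upwards [hg.hl, hg.hk, hg.h1] with ζ e1 e2 e3
    have := (e1.cexp).prodMk ((hasDerivAt_id ζ).prodMk e2)
    refine this.congr_deriv ?_
    refine Prod.ext ?_ (Prod.ext ?_ ?_)
    · simp [Xf, hs, mul_comm]
    · simp only [Xf, hs, Prod.smul_mk, smul_eq_mul]; exact e3.symm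
    · simp only [Xf, hs, Prod.smul_mk, smul_eq_mul]
  have hsc : ContinuousAt s ζ₀ := hsd.self_of_nhds.continuousAt
  have hsm : ∀ᶠ ζ in 𝓝 ζ₀, s ζ ∈ Metric.ball ((0:ℂ), z₀, (0:ℂ)) r :=
    hsc.eventually (Metric.isOpen_ball.mem_nhds hmem)
  have hlc : ContinuousAt l ζ₀ := hg.hl.self_of_nhds.continuousAt
  set Mμ : ℝ := ‖μ ζ₀‖ + 1 with hMμ
  have hMμ0 : 0 ≤ Mμ := by positivity
  set Mv : ℝ := ‖Complex.exp (l ζ₀)‖⁻¹ + 1 with hMv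
  have hMv0 : 0 ≤ Mv := by positivity
  have e1 : ∀ᶠ ζ in 𝓝 ζ₀, ‖μ ζ‖ ≤ Mμ := hg.hμ.norm.tendsto.eventually (ge_mem_nhds (by simp only [hMμ]; linarith))
  have e2 : ∀ᶠ ζ in 𝓝 ζ₀, ‖Complex.exp (l ζ)‖⁻¹ ≤ Mv := by
    have : ContinuousAt (fun ζ => ‖Complex.exp (l ζ)‖⁻¹) ζ₀ :=
      (hlc.cexp.norm).inv₀ (by simp)
    exact this.tendsto.eventually (ge_mem_nhds (by simp only [hMv]; linarith))
  obtain ⟨δ, hδ, hb⟩ := Metric.eventually_nhds_iff_ball.1 (hsd.and (hsm.and (e1.and (e2.and hg.hl))))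
  have hflow : ∀ ζ ∈ Metric.ball ζ₀ δ, ∀ T, 0 ≤ T → HasDerivAt (fun ξ => Φ (s ξ) T) (μ ζ • Xf τ D a h (Φ (s ζ) T)) ζ := by
    intro ζ hζ T hT
    have hev : ∀ᶠ ξ in 𝓝 ζ, ξ ∈ Metric.ball ζ₀ δ := Metric.isOpen_ball.mem_nhds hζ
    refine flow_deriv (φ := fun ξ => Φ (s ξ)) rg.hR rg.hX rg.hXL rg.hXL' hT (hb ζ hζ).1 ?_ ?_ ?_
    · filter_upwards [hev] with ξ hξ
      exact (hΦ _ (hb ξ hξ).2.1).1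
    · filter_upwards [hev] with ξ hξ t ht
      exact ((hΦ _ (hb ξ hξ).2.1).2 t ht).1
    · filter_upwards [hev] with ξ hξ t ht
      exact ((hΦ _ (hb ξ hξ).2.1).2 t ht).2
  have hray : ∀ ζ ∈ Metric.ball ζ₀ δ, _ := fun ζ hζ => ray (φ := Φ (s ζ)) hτ hD rg hε haε
    (fun t ht => ((hΦ _ (hb ζ hζ).2.1).2 t ht).1) (fun t ht => ((hΦ _ (hb ζ hζ).2.1).2 t ht).2)
    (by rw [(hΦ _ (hb ζ hζ).2.1).1]; exact Complex.exp_ne_zero _)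
  have hconv : Convex ℝ (Metric.ball ζ₀ δ) := convex_ball _ _
  have hζ₀ : ζ₀ ∈ Metric.ball ζ₀ δ := Metric.mem_ball_self hδ
  have hPe : ∀ ζ ∈ Metric.ball ζ₀ δ, ∀ P P₀ : ℂ, Tendsto (fun t => (Φ (s ζ) t).2.1) atTop (𝓝 P) →
      Tendsto (fun t => (Φ (s ζ₀) t).2.1) atTop (𝓝 P₀) → P = P₀ := by
    intro ζ hζ P P₀ h1 h2
    have hbd : ∀ t, 0 ≤ t → ‖(Φ (s ζ) t).2.1 - (Φ (s ζ₀) t).2.1‖ ≤ Mμ * (2 * Real.exp (-t)) * ‖ζ - ζ₀‖ := by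
      intro t ht
      refine Convex.norm_image_sub_le_of_norm_hasDerivWithin_le (f := fun ξ => (Φ (s ξ) t).2.1)
        (f' := fun ξ => μ ξ * ((Φ (s ξ) t).1 ^ τ * a (Φ (s ξ) t))) ?_ ?_ hconv hζ₀ hζ
      · intro ξ hξ
        have := ((hasFDerivAt_fst (𝕜 := ℂ) (p := (Φ (s ξ) t).2)).comp (Φ (s ξ) t)
          (hasFDerivAt_snd (𝕜 := ℂ) (p := Φ (s ξ) t))).comp_hasDerivAt ξ (hflow ξ hξ t ht)
        exact this.hasDerivWithinAt
      · intro ξ hξ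
        obtain ⟨_, _, _, _, _, h6, _⟩ := hray ξ hξ
        rw [norm_mul]
        exact mul_le_mul (hb ξ hξ).2.2.1 (h6 t ht) (norm_nonneg _) hMμ0
    have hl0 : Tendsto (fun t => Mμ * (2 * Real.exp (-t)) * ‖ζ - ζ₀‖) atTop (𝓝 0) := by
      have := ((Real.tendsto_exp_neg_atTop_nhds_zero.const_mul 2).const_mul Mμ).mul_const ‖ζ - ζ₀‖
      simpa using this
    have h3 := le_of_tendsto_of_tendsto (h1.sub h2).norm hl0 (by
      filter_upwards [eventually_ge_atTop 0] with t ht using hbd t ht)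
    exact sub_eq_zero.1 (norm_le_zero_iff.1 h3)
  filter_upwards [Metric.ball_mem_nhds ζ₀ hδ] with ζ hζ P Ch P₀ Ch₀ t1 t2 t3 t4
  have hPP : P = P₀ := hPe ζ hζ P P₀ t1 t3
  refine ⟨hPP, ?_⟩
  subst hPP
  have hbd : ∀ t, 0 ≤ t → ‖(Gf D V (Φ (s ζ) t) + c₀ P * l ζ) - (Gf D V (Φ (s ζ₀) t) + c₀ P * l ζ₀)‖ ≤
      Mμ * (8 * K ^ 2 * Mv ^ q * Real.exp (-(1/2 * t))) * ‖ζ - ζ₀‖ := by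
    intro t ht
    refine Convex.norm_image_sub_le_of_norm_hasDerivWithin_le (f := fun ξ => Gf D V (Φ (s ξ) t) + c₀ P * l ξ)
        (f' := fun ξ => μ ξ * (XG τ D a h V (Φ (s ξ) t) + c₀ P)) ?_ ?_ hconv hζ₀ hζ
    · intro ξ hξ
      obtain ⟨_, _, _, _, _, _, h7, _⟩ := hray ξ hξ
      have hin := Metric.ball_subset_ball (half_le_self rg.hR.le) ((hΦ _ (hb ξ hξ).2.1).2 t ht).1
      obtain ⟨L, hL1, hL2⟩ := Gf_deriv (τ := τ) (D := D) (a := a) (h := h) (rg.hV _ hin) (h7 t ht)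
      have := (hL1.comp_hasDerivAt ξ (hflow ξ hξ t ht)).add (((hb ξ hξ).2.2.2.2).const_mul (c₀ P))
      refine (this.congr_deriv ?_).hasDerivWithinAt
      rw [map_smul, hL2, smul_eq_mul]; ring
    · intro ξ hξ
      obtain ⟨P', _, h3, _, _, _, _, _, h8, _⟩ := hray ξ hξ
      have hP' : P' = P := hPe ξ hξ P' P h3 t3
      subst hP'
      rw [norm_mul]
      refine mul_le_mul (hb ξ hξ).2.2.1 ((h8 t ht).trans ?_) (norm_nonneg _) hMμ0
      rw [(hΦ _ (hb ξ hξ).2.1).1]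
      have := (hb ξ hξ).2.2.2.1
      gcongr
  have hl0 : Tendsto (fun t => Mμ * (8 * K ^ 2 * Mv ^ q * Real.exp (-(1/2 * t))) * ‖ζ - ζ₀‖) atTop (𝓝 0) := by
    have h1 : Tendsto (fun t : ℝ => 1 / 2 * t) atTop atTop := tendsto_id.const_mul_atTop (by norm_num)
    have := (((Real.tendsto_exp_neg_atTop_nhds_zero.comp h1).const_mul (8 * K ^ 2 * Mv ^ q)).const_mul Mμ).mul_const ‖ζ - ζ₀‖
    simpa using this
  have hlim := ((t2.sub t4).add_const (c₀ P * l ζ - c₀ P * l ζ₀)).norm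
  have h3 := le_of_tendsto_of_tendsto hlim hl0 (by
    filter_upwards [eventually_ge_atTop 0] with t ht
    refine le_trans (le_of_eq ?_) (hbd t ht)
    congr 1; ring)
  have h4 := norm_le_zero_iff.1 h3
  linear_combination h4

set_option maxHeartbeats 1000000 in
theorem chordAbs {z₀ : ℂ} {τ D q N1 : ℕ} {a h : ℂ × ℂ × ℂ → ℂ} (hτ : 1 ≤ τ) (hq : 1 ≤ q) (hD : D = τ + 1 + q)
    (hN1 : 1 ≤ N1) (hNτ : N1 ≤ τ)
    (ha : AnalyticAt ℂ a (0, z₀, 0)) (hh : AnalyticAt ℂ h (0, z₀, 0)) (ha1 : ‖a (0, z₀, 0)‖ = 1) :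
    ∃ r > 0, ∃ K > 0, ∀ (γ lam k : ℝ → ℂ) (L : ℝ → ℝ) (s₁ s₂ : ℝ), s₁ ≤ s₂ →
      ContinuousOn γ (Set.Icc s₁ s₂) → ContinuousOn lam (Set.Icc s₁ s₂) →
      (∀ s ∈ Set.Icc s₁ s₂, ∀ t ∈ Set.Icc s₁ s₂, s ≤ t → ‖γ t - γ s‖ ≤ L t - L s) →
      (∀ s ∈ Set.Icc s₁ s₂, (Complex.exp (lam s), γ s, k s) ∈ Metric.ball ((0:ℂ), z₀, (0:ℂ)) r) →
      (∀ s ∈ Set.Icc s₁ s₂, ∃ l k' μ, Germ τ D a h (γ s) l k' μ ∧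
        ∀ᶠ s' in 𝓝[Set.Icc s₁ s₂] s, lam s' = l (γ s') ∧ k s' = k' (γ s')) →
      (∀ s ∈ Set.Icc s₁ s₂, ∀ t ∈ Set.Icc s₁ s₂, γ s = γ t →
        ∃ n : ℤ, N1 * (lam t - lam s) = n * (2 * Real.pi * Complex.I)) →
      (∀ s ∈ Set.Icc s₁ s₂, ∀ t ∈ Set.Icc s₁ s₂, γ s = γ t →
        lam t - lam s = 2 * Real.pi * Complex.I → k s = k t) →
      (∀ s ∈ Set.Icc s₁ s₂, ∀ t ∈ Set.Icc s₁ s₂, ‖Complex.exp (lam t)‖ ^ τ ≤ 1.1 * ‖Complex.exp (lam s)‖ ^ τ + 2 * τ * ‖γ t - γ s‖) ∧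
      ∀ m, 0 < m → m ≤ ‖Complex.exp (lam s₁)‖ → m ≤ ‖Complex.exp (lam s₂)‖ →
        ‖k s₂ * (Complex.exp (lam s₂) ^ D)⁻¹ - k s₁ * (Complex.exp (lam s₁) ^ D)⁻¹‖ ≤
          K * ((m⁻¹) ^ τ * (L s₂ - L s₁) + (m⁻¹) ^ q) := by
  have hτ0 : (0:ℝ) < τ := by exact_mod_cast hτ
  have hτ1 : (1:ℝ) ≤ τ := by exact_mod_cast hτ
  set ε : ℝ := 1 / (100 * τ) with hε
  have hε0 : 0 < ε := by positivity
  have hε1 : ε ≤ 1 := by rw [hε, div_le_one (by positivity)]; linarith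
  obtain ⟨V, c₀, R, K, Kn, rg⟩ := exists_Reg (ε := ε) hτ (by omega : τ + 1 ≤ D) ha hh hε0
  have hK := rg.hK
  have hR := rg.hR
  obtain ⟨r, hr, hrR, Φ, hΦ⟩ := flow_exists (τ := τ) (D := D) hτ (by omega) ha hh (R := R / 2) (by linarith)
  have haε : ‖a (0, z₀, 0)‖ + ε ≤ 2 := by linarith
  refine ⟨r, hr, 17 * K ^ 2 * (200 * τ), by positivity, ?_⟩
  intro γ lam k L s₁ s₂ h12 hγ hlam hL hmem hgerm hN hsame
  set A : ℂ := a (0, z₀, 0) / τ with hA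
  have hAn : ‖A‖ = 1 / τ := by rw [hA, norm_div, ha1]; simp
  have hAne : A ≠ 0 := by rw [← norm_pos_iff, hAn]; positivity
  set y : ℝ → ℂ × ℂ × ℂ := fun s => (Complex.exp (lam s), γ s, k s) with hy
  have hray : ∀ s, ∃ P Ch : ℂ, s ∈ Set.Icc s₁ s₂ → _ := fun s => by
    by_cases hs : s ∈ Set.Icc s₁ s₂
    · obtain ⟨P, Ch, hPC⟩ := ray (φ := Φ (y s)) hτ hD rg hε0.le haε
        (fun t ht => ((hΦ _ (hmem s hs)).2 t ht).1) (fun t ht => ((hΦ _ (hmem s hs)).2 t ht).2)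
        (by rw [(hΦ _ (hmem s hs)).1]; exact Complex.exp_ne_zero _)
      exact ⟨P, Ch, fun _ => hPC⟩
    · exact ⟨0, 0, fun h => absurd h hs⟩
  choose P Ch hPC using hray
  have hyb : ∀ s ∈ Set.Icc s₁ s₂, Φ (y s) 0 = y s := fun s hs => (hΦ _ (hmem s hs)).1
  have hloc : ∀ s ∈ Set.Icc s₁ s₂, ∀ᶠ s' in 𝓝[Set.Icc s₁ s₂] s, P s' = P s ∧
      Ch s' + c₀ (P s') * lam s' = Ch s + c₀ (P s) * lam s := by
    intro s hs
    obtain ⟨l, k', μ, hg, heq⟩ := hgerm s hs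
    have heq0 := heq.self_of_nhdsWithin hs
    have := germ_const hτ hD rg hε0.le haε hΦ hg (by rw [← heq0.1, ← heq0.2]; exact hmem s hs)
    have h2 := (hγ s hs).tendsto.eventually this
    filter_upwards [h2, heq, self_mem_nhdsWithin] with s' e1 e2 hs'
    have := e1 (P s') (Ch s') (P s) (Ch s)
    rw [← e2.1, ← e2.2, ← heq0.1, ← heq0.2] at this
    obtain ⟨p1, _, _, _, _, p2, _⟩ := hPC s' hs'
    obtain ⟨p3, _, _, _, _, p4, _⟩ := hPC s hs
    exact this p1 p2 p3 p4
  have hPconst : ∀ s ∈ Set.Icc s₁ s₂, P s = P s₁ :=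
    const_of_local fun s hs => (hloc s hs).mono fun _ h => h.1
  have hCconst : ∀ s ∈ Set.Icc s₁ s₂, Ch s + c₀ (P s) * lam s = Ch s₁ + c₀ (P s₁) * lam s₁ :=
    const_of_local (f := fun s => Ch s + c₀ (P s) * lam s) fun s hs => (hloc s hs).mono fun _ h => h.2
  set p := P s₁ with hp
  have hs1 : s₁ ∈ Set.Icc s₁ s₂ := ⟨le_rfl, h12⟩
  have hs2 : s₂ ∈ Set.Icc s₁ s₂ := ⟨h12, le_rfl⟩
  have hexpτ : ∀ s, Complex.exp (τ * lam s) = Complex.exp (lam s) ^ τ := fun s => by rw [Complex.exp_nat_mul]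
  have hvb : ∀ s ∈ Set.Icc s₁ s₂, ‖Complex.exp (lam s)‖ ≤ 1 := by
    intro s hs
    have := hmem s hs
    rw [Metric.mem_ball, Prod.dist_eq, max_lt_iff] at this
    have h1 := this.1
    simp only [dist_eq_norm, sub_zero] at h1
    linarith [rg.hR1]
  have h1 : ∀ s ∈ Set.Icc s₁ s₂, ‖γ s - p - A * Complex.exp (lam s) ^ τ‖ ≤ 1 / 100 * ‖A * Complex.exp (lam s) ^ τ‖ := by
    intro s hs
    obtain ⟨_, _, p3, _⟩ := hPC s hs
    rw [hyb s hs, hPconst s hs] at p3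
    refine p3.trans (le_of_eq ?_)
    rw [norm_mul, hAn, norm_pow, hε]
    simp only [hy]
    field_simp
  constructor
  · intro s hs t ht
    have e1 := h1 s hs
    have e2 := h1 t ht
    rw [norm_mul, norm_pow, hAn] at e1 e2
    set vs := ‖Complex.exp (lam s)‖ ^ τ with hvs
    set vt := ‖Complex.exp (lam t)‖ ^ τ with hvt
    have hvs0 : 0 ≤ vs := by positivity
    have hvt0 : 0 ≤ vt := by positivity
    have n1 : ‖A * Complex.exp (lam s) ^ τ‖ = 1 / τ * vs := by rw [norm_mul, norm_pow, hAn]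
    have n2 : ‖A * Complex.exp (lam t) ^ τ‖ = 1 / τ * vt := by rw [norm_mul, norm_pow, hAn]
    have e3 : A * Complex.exp (lam t) ^ τ = -(γ t - p - A * Complex.exp (lam t) ^ τ) + (γ t - γ s) +
      ((γ s - p - A * Complex.exp (lam s) ^ τ) + A * Complex.exp (lam s) ^ τ) := by ring
    have e4 := congrArg norm e3
    have e5 := (norm_add_le (-(γ t - p - A * Complex.exp (lam t) ^ τ) + (γ t - γ s))
      ((γ s - p - A * Complex.exp (lam s) ^ τ) + A * Complex.exp (lam s) ^ τ))
    have e6 := norm_add_le (-(γ t - p - A * Complex.exp (lam t) ^ τ)) (γ t - γ s)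
    have e7 := norm_add_le (γ s - p - A * Complex.exp (lam s) ^ τ) (A * Complex.exp (lam s) ^ τ)
    rw [norm_neg] at e6
    rw [← e4, n2] at e5
    rw [n1] at e7
    have e8 : 1 / (τ:ℝ) * vt ≤ 1 / 100 * (1 / τ * vt) + ‖γ t - γ s‖ + (1 / 100 * (1 / τ * vs) + 1 / τ * vs) := by linarith
    have e9 : vt ≤ 1 / 100 * vt + τ * ‖γ t - γ s‖ + (1 / 100 * vs + vs) := by
      have := mul_le_mul_of_nonneg_left e8 hτ0.le
      field_simp at this
      linarith
    have : 0 ≤ τ * ‖γ t - γ s‖ := by positivity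
    norm_num
    linarith
  · intro m hm hm1 hm2
    set H : ℝ → ℂ := fun s => k s * (Complex.exp (lam s) ^ D)⁻¹ with hH
    have hHb : ∀ s ∈ Set.Icc s₁ s₂, m ≤ ‖Complex.exp (lam s)‖ → ‖H s - (Ch s₁ + c₀ p * lam s₁) - (-c₀ p) * lam s‖ ≤ 17 * K ^ 2 * (m⁻¹) ^ q := by
      intro s hs hms
      obtain ⟨_, _, _, _, _, _, _, p8⟩ := hPC s hs
      rw [hyb s hs] at p8
      have e := hCconst s hs
      rw [hPconst s hs] at e
      have e2 : H s - (Ch s₁ + c₀ p * lam s₁) - (-c₀ p) * lam s = (y s).2.2 * ((y s).1 ^ D)⁻¹ - Ch s := by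
        rw [← e]; simp only [hH, hy]; ring
      rw [e2]
      refine p8.trans ?_
      simp only [hy]
      gcongr
    have := chordEst (γ := γ) (lam := lam) (H := H) (L := L) (a := s₁) (b := s₂) (m := m) (K := 17 * K ^ 2)
      (A := A) (p := p) (c := - c₀ p) (C := Ch s₁ + c₀ p * lam s₁) (τ := τ) (q := q) (N1 := N1) h12 hγ hlam hL hτ hq hAne hN1 hNτ
      (by intro s hs; rw [hexpτ]; exact h1 s hs) hm hm1 hm2 (hvb _ hs1) (hvb _ hs2) (hHb _ hs1 hm1) (hHb _ hs2 hm2)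
      (by
        rw [norm_neg]
        obtain ⟨_, p2, _⟩ := hPC s₁ hs1
        refine (rg.hc _ p2).trans ?_
        nlinarith) hN
      (by
        intro s hs t ht hst hl
        have hk := hsame s hs t ht hst hl
        have hys : y s = y t := by
          simp only [hy]
          have : lam t = lam s + 2 * Real.pi * Complex.I := by linear_combination hl
          rw [this, Complex.exp_periodic, hst, hk]
        obtain ⟨_, _, _, _, _, q1, _⟩ := hPC s hs
        obtain ⟨_, _, _, _, _, q2, _⟩ := hPC t ht
        rw [hPconst s hs] at q1
        rw [hPconst t ht, ← hys] at q2
        have hCC := tendsto_nhds_unique q1 q2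
        have e1 := hCconst s hs
        have e2 := hCconst t ht
        rw [hPconst s hs] at e1
        rw [hPconst t ht, ← hCC] at e2
        have e3 : c₀ p * (lam t - lam s) = 0 := by linear_combination e2 - e1
        rw [hl] at e3
        have := (mul_eq_zero.1 e3).resolve_right Complex.two_pi_I_ne_zero
        rw [this, neg_zero])
    refine this.trans ?_
    rw [hAn]
    have hmq : 0 < (m⁻¹) ^ q := by positivity
    have e : 17 * K ^ 2 * (200 / (1 / τ) * (m⁻¹) ^ τ * (L s₂ - L s₁) + 20 * (m⁻¹) ^ q) =
      17 * K ^ 2 * (200 * τ) * ((m⁻¹) ^ τ * (L s₂ - L s₁)) + 17 * K ^ 2 * (20 * (m⁻¹) ^ q) := by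
      field_simp
    rw [e, mul_add]
    have : 17 * K ^ 2 * (20 * (m⁻¹) ^ q) ≤ 17 * K ^ 2 * (200 * τ) * (m⁻¹) ^ q := by
      rw [mul_assoc (17 * K ^ 2)]
      gcongr
      linarith
    linarith

end SCM

namespace SCM
open Asymptotics

def dg (M N : ℕ) (p : ℕ × ℕ) : ℕ := (M + 1) * (N + 1) - (p.1 * (N + 1) + p.2 * (M + 1))

noncomputable def Ff (M N : ℕ) (α : ℕ × ℕ → ℂ → ℂ) (y : ℂ × ℂ × ℂ) : ℂ :=
  1 + y.2.2 ^ (N + 1) + ∑ p ∈ idxI' M N, α p y.2.1 * y.1 ^ dg M N p * y.2.2 ^ p.2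

noncomputable def Sf (M N : ℕ) (α : ℕ × ℕ → ℂ → ℂ) (y : ℂ × ℂ × ℂ) : ℂ :=
  y.2.2 ^ N + (∑ p ∈ idxI' M N, p.2 * α p y.2.1 * y.1 ^ dg M N p * y.2.2 ^ (p.2 - 1)) / (N + 1)

noncomputable def Tf (M N : ℕ) (α : ℕ × ℕ → ℂ → ℂ) (y : ℂ × ℂ × ℂ) : ℂ :=
  ∑ p ∈ idxI' M N, deriv (α p) y.2.1 * y.1 ^ (dg M N p - 1) * y.2.2 ^ p.2

noncomputable def Ham (M N : ℕ) (α : ℕ × ℕ → ℂ → ℂ) (y₁ y₂ : ℂ → ℂ) (z : ℂ) : ℂ :=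
  y₁ z ^ (M + 1) + y₂ z ^ (N + 1) + ∑ p ∈ idxI' M N, α p z * y₁ z ^ p.1 * y₂ z ^ p.2

noncomputable def dHam (M N : ℕ) (α : ℕ × ℕ → ℂ → ℂ) (y₁ y₂ : ℂ → ℂ) (z : ℂ) : ℂ :=
  ∑ p ∈ idxI' M N, deriv (α p) z * y₁ z ^ p.1 * y₂ z ^ p.2

theorem dg_spec {M N : ℕ} {p : ℕ × ℕ} (hp : p ∈ idxI' M N) :
    p.1 * (N + 1) + p.2 * (M + 1) + dg M N p = (M + 1) * (N + 1) ∧ 1 ≤ dg M N p ∧ p.2 ≤ N := by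
  have h1 := (Finset.mem_filter.1 (Finset.mem_of_mem_erase hp)).2
  rw [mul_comm (N + 1) (M + 1)] at h1
  unfold dg
  refine ⟨by omega, by omega, ?_⟩
  by_contra h
  push Not at h
  have : (N + 1) * (M + 1) ≤ p.2 * (M + 1) := Nat.mul_le_mul_right _ h
  have := mul_comm (N+1) (M+1)
  omega

theorem Ham_v {M N : ℕ} {α : ℕ × ℕ → ℂ → ℂ} {y₁ y₂ : ℂ → ℂ} {z v : ℂ} (h : y₁ z * v ^ (N + 1) = 1) :
    Ham M N α y₁ y₂ z * v ^ ((M + 1) * (N + 1)) = Ff M N α (v, z, y₂ z * v ^ (M + 1)) := by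
  simp only [Ham, Ff]
  rw [add_mul, add_mul, Finset.sum_mul]
  congr 1
  · congr 1
    · rw [mul_comm (M + 1) (N + 1), pow_mul, ← mul_pow, h, one_pow]
    · rw [mul_pow, ← pow_mul]
  · refine Finset.sum_congr rfl fun p hp => ?_
    rw [← (dg_spec hp).1, pow_add, pow_add, mul_comm p.1, mul_comm p.2, pow_mul, pow_mul]
    calc _ = α p z * (y₁ z * v ^ (N + 1)) ^ p.1 * (y₂ z * v ^ (M + 1)) ^ p.2 * v ^ dg M N p := by ring
      _ = _ := by rw [h, one_pow]; ring

theorem dHam_v {M N : ℕ} {α : ℕ × ℕ → ℂ → ℂ} {y₁ y₂ : ℂ → ℂ} {z v : ℂ} (h : y₁ z * v ^ (N + 1) = 1) :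
    dHam M N α y₁ y₂ z * v ^ ((M + 1) * (N + 1)) = v * Tf M N α (v, z, y₂ z * v ^ (M + 1)) := by
  simp only [dHam, Tf]
  rw [Finset.sum_mul, Finset.mul_sum]
  refine Finset.sum_congr rfl fun p hp => ?_
  obtain ⟨e1, e2, _⟩ := dg_spec hp
  have e3 : v ^ dg M N p = v * v ^ (dg M N p - 1) := by rw [← pow_succ']; congr 1; omega
  rw [← e1, pow_add, pow_add, mul_comm p.1, mul_comm p.2, pow_mul, pow_mul, e3]
  calc _ = deriv (α p) z * (y₁ z * v ^ (N + 1)) ^ p.1 * (y₂ z * v ^ (M + 1)) ^ p.2 * (v * v ^ (dg M N p - 1)) := by ring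
      _ = _ := by rw [h, one_pow]; ring

theorem Fn₁_v {M N : ℕ} {α : ℕ × ℕ → ℂ → ℂ} {y₁ y₂ : ℂ → ℂ} {z v : ℂ} (hMN : 1 ≤ M * N) (h : y₁ z * v ^ (N + 1) = 1) :
    Fn₁ M N α z (y₁ z) (y₂ z) * v ^ (N + 1) * v ^ (M * N - 1) = (N + 1) * Sf M N α (v, z, y₂ z * v ^ (M + 1)) := by
  have hN1 : (N : ℂ) + 1 ≠ 0 := by exact_mod_cast Nat.succ_ne_zero N
  simp only [Fn₁, Sf]
  rw [mul_assoc, ← pow_add, mul_add, mul_div_cancel₀ _ hN1, add_mul, Finset.sum_mul]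
  have hexp : N + 1 + (M * N - 1) = N * (M + 1) := by
    have : N * (M + 1) = M * N + N := by ring
    omega
  rw [hexp]
  congr 1
  · rw [mul_pow, ← pow_mul, mul_comm N (M + 1)]; ring
  · refine Finset.sum_congr rfl fun p hp => ?_
    rcases Nat.eq_zero_or_pos p.2 with h0 | h0
    · simp [h0]
    obtain ⟨e1, e2, _⟩ := dg_spec hp
    have e3 : N * (M + 1) = (N + 1) * p.1 + (M + 1) * (p.2 - 1) + dg M N p := by
      obtain ⟨j, hj⟩ : ∃ j, p.2 = j + 1 := ⟨p.2 - 1, by omega⟩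
      rw [hj] at e1 ⊢
      simp only [Nat.add_sub_cancel]
      nlinarith
    rw [e3, pow_add, pow_add, pow_mul, pow_mul]
    calc _ = p.2 * α p z * (y₁ z * v ^ (N + 1)) ^ p.1 * (y₂ z * v ^ (M + 1)) ^ (p.2 - 1) * v ^ dg M N p := by ring
      _ = _ := by rw [h, one_pow]; ring

theorem Ham_deriv {M N : ℕ} {α : ℕ × ℕ → ℂ → ℂ} {y₁ y₂ : ℂ → ℂ} {z : ℂ}
    (hα : ∀ p ∈ idxI' M N, DifferentiableAt ℂ (α p) z)
    (h1 : HasDerivAt y₁ (Fn₁ M N α z (y₁ z) (y₂ z)) z) (h2 : HasDerivAt y₂ (Fn₂ M N α z (y₁ z) (y₂ z)) z) :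
    HasDerivAt (Ham M N α y₁ y₂) (dHam M N α y₁ y₂ z) z := by
  have hs : HasDerivAt (fun z => ∑ p ∈ idxI' M N, α p z * y₁ z ^ p.1 * y₂ z ^ p.2) (∑ p ∈ idxI' M N,
      (deriv (α p) z * y₁ z ^ p.1 * y₂ z ^ p.2 + (p.1 * α p z * y₁ z ^ (p.1 - 1) * y₂ z ^ p.2) * Fn₁ M N α z (y₁ z) (y₂ z)
        + (p.2 * α p z * y₁ z ^ p.1 * y₂ z ^ (p.2 - 1)) * Fn₂ M N α z (y₁ z) (y₂ z))) z := by
    refine HasDerivAt.fun_sum fun p hp => ?_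
    exact (((hα p hp).hasDerivAt.mul (h1.pow p.1)).mul (h2.pow p.2)).congr_deriv (by simp only [Pi.mul_apply, Pi.pow_apply]; ring)
  have := ((h1.pow (M + 1)).add (h2.pow (N + 1))).add hs
  refine this.congr_deriv ?_
  rw [Finset.sum_add_distrib, Finset.sum_add_distrib, ← Finset.sum_mul, ← Finset.sum_mul]
  have e1 : ∑ p ∈ idxI' M N, (p.2 : ℂ) * α p z * y₁ z ^ p.1 * y₂ z ^ (p.2 - 1) = Fn₁ M N α z (y₁ z) (y₂ z) - (N + 1) * y₂ z ^ N := by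
    rw [Fn₁]; ring
  have e2 : ∑ p ∈ idxI' M N, (p.1 : ℂ) * α p z * y₁ z ^ (p.1 - 1) * y₂ z ^ p.2 = - Fn₂ M N α z (y₁ z) (y₂ z) - (M + 1) * y₁ z ^ M := by
    rw [Fn₂]; ring
  rw [e1, e2, dHam]
  push_cast [add_tsub_cancel_right]
  ring

end SCM

namespace SCM
open Asymptotics

theorem exists_Psi {F : ℂ × ℂ × ℂ → ℂ} {z₀ η₀ c : ℂ} (hF : AnalyticAt ℂ F (0, z₀, η₀)) (h0 : F (0, z₀, η₀) = 0)
    (hd : HasDerivAt (fun η => F (0, z₀, η)) c η₀) (hc : c ≠ 0) :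
    ∃ Ψ : ℂ × ℂ × ℂ → ℂ, AnalyticAt ℂ Ψ (0, z₀, 0) ∧ Ψ (0, z₀, 0) = η₀ ∧
      ∀ᶠ y in 𝓝 ((0:ℂ), z₀, η₀), Ψ (y.1, y.2.1, F y) = y.2.2 := by
  set T : ℂ × ℂ × ℂ → ℂ × ℂ × ℂ := fun y => (y.1, y.2.1, F y) with hT
  have hTa : AnalyticAt ℂ T (0, z₀, η₀) :=
    analyticAt_fst.prod ((analyticAt_fst.comp analyticAt_snd).prod hF)
  obtain ⟨F', hF'⟩ := hF.differentiableAt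
  set T' : ℂ × ℂ × ℂ →L[ℂ] ℂ × ℂ × ℂ := (ContinuousLinearMap.fst ℂ ℂ (ℂ × ℂ)).prod
    (((ContinuousLinearMap.fst ℂ ℂ ℂ).comp (ContinuousLinearMap.snd ℂ ℂ (ℂ × ℂ))).prod F') with hT'
  have hTd : HasFDerivAt T T' (0, z₀, η₀) := by
    refine HasFDerivAt.prodMk hasFDerivAt_fst (HasFDerivAt.prodMk ?_ hF')
    exact ((ContinuousLinearMap.fst ℂ ℂ ℂ).comp (ContinuousLinearMap.snd ℂ ℂ (ℂ × ℂ))).hasFDerivAt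
  have hF'c : F' (0, 0, 1) = c := by
    have h1 : HasDerivAt (fun η : ℂ => ((0:ℂ), z₀, η)) (0, 0, 1) η₀ :=
      (hasDerivAt_const _ _).prodMk ((hasDerivAt_const _ _).prodMk (hasDerivAt_id _))
    have h2 := HasFDerivAt.comp_hasDerivAt η₀ (l := F) (l' := F') (f := fun η : ℂ => ((0:ℂ), z₀, η)) hF' h1
    exact h2.unique hd
  have hinj : Function.Injective T' := by
    rw [injective_iff_map_eq_zero]
    rintro ⟨x1, x2, x3⟩ hx
    simp only [hT', ContinuousLinearMap.prod_apply, ContinuousLinearMap.comp_apply, ContinuousLinearMap.coe_fst', ContinuousLinearMap.coe_snd', Prod.mk_eq_zero] at hx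
    obtain ⟨e1, e2, e3⟩ := hx
    subst e1 e2
    have : F' (0, 0, x3) = x3 * c := by
      rw [← hF'c, ← smul_eq_mul, ← map_smul]; simp
    rw [this] at e3
    simp [(mul_eq_zero.1 e3).resolve_right hc]
  have hsurj : Function.Surjective T' := (LinearMap.injective_iff_surjective (f := (T' : ℂ × ℂ × ℂ →ₗ[ℂ] ℂ × ℂ × ℂ))).1 hinj
  set e := ContinuousLinearEquiv.ofBijective T' (LinearMap.ker_eq_bot.2 hinj) (LinearMap.range_eq_top.2 hsurj) with he
  have hTd' : HasFDerivAt T (e : ℂ × ℂ × ℂ →L[ℂ] ℂ × ℂ × ℂ) (0, z₀, η₀) := by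
    rw [he, ContinuousLinearEquiv.coe_ofBijective]; exact hTd
  have hcd : ContDiffAt ℂ ⊤ T (0, z₀, η₀) := hTa.contDiffAt
  have hT0 : T (0, z₀, η₀) = (0, z₀, 0) := by simp [hT, h0]
  have hinv := hcd.to_localInverse hTd' (by simp)
  have himg := hcd.localInverse_apply_image hTd' (by simp)
  set G := hcd.localInverse hTd' (by simp) with hG
  rw [hT0] at hinv himg
  have hleft : ∀ᶠ y in 𝓝 ((0:ℂ), z₀, η₀), G (T y) = y := by
    exact (hcd.toOpenPartialHomeomorph T hTd' (by simp)).eventually_left_inverse (hcd.mem_toOpenPartialHomeomorph_source hTd' (by simp))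
  refine ⟨fun y => (G y).2.2, ?_, by simp [himg], ?_⟩
  · have hGa : AnalyticAt ℂ G (0, z₀, 0) := hinv.analyticAt
    exact (analyticAt_snd.comp analyticAt_snd).comp hGa
  · filter_upwards [hleft] with y hy
    exact congrArg (fun y => y.2.2) hy

section
variable {M N : ℕ} {α : ℕ × ℕ → ℂ → ℂ} {z₀ η : ℂ}

theorem an_aux (hα : ∀ p ∈ idxI' M N, AnalyticAt ℂ (α p) z₀) (v : ℂ) :
    AnalyticAt ℂ (Ff M N α) (v, z₀, η) ∧ AnalyticAt ℂ (Sf M N α) (v, z₀, η) ∧ AnalyticAt ℂ (Tf M N α) (v, z₀, η) := by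
  have hη : AnalyticAt ℂ (fun y : ℂ × ℂ × ℂ => y.2.2) (v, z₀, η) := analyticAt_snd.comp analyticAt_snd
  have hz : AnalyticAt ℂ (fun y : ℂ × ℂ × ℂ => y.2.1) (v, z₀, η) := analyticAt_fst.comp analyticAt_snd
  have hv : AnalyticAt ℂ (fun y : ℂ × ℂ × ℂ => y.1) (v, z₀, η) := analyticAt_fst
  have ha : ∀ p ∈ idxI' M N, AnalyticAt ℂ (fun y : ℂ × ℂ × ℂ => α p y.2.1) (v, z₀, η) := fun p hp =>
    AnalyticAt.comp (g := α p) (hα p hp) hz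
  have ha' : ∀ p ∈ idxI' M N, AnalyticAt ℂ (fun y : ℂ × ℂ × ℂ => deriv (α p) y.2.1) (v, z₀, η) := fun p hp =>
    AnalyticAt.comp (g := deriv (α p)) (hα p hp).deriv hz
  refine ⟨?_, ?_, ?_⟩
  · unfold Ff
    refine (analyticAt_const.add (hη.pow _)).add (Finset.analyticAt_fun_sum _ fun p hp => ?_)
    exact ((ha p hp).mul (hv.pow _)).mul (hη.pow _)
  · unfold Sf
    refine (hη.pow _).add ((Finset.analyticAt_fun_sum _ fun p hp => ?_).fun_div analyticAt_const (by exact_mod_cast Nat.succ_ne_zero N))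
    exact ((analyticAt_const.mul (ha p hp)).mul (hv.pow _)).mul (hη.pow _)
  · unfold Tf
    refine (Finset.analyticAt_fun_sum _ fun p hp => ?_)
    exact ((ha' p hp).mul (hv.pow _)).mul (hη.pow _)

theorem Ff_zero (z η : ℂ) : Ff M N α (0, z, η) = 1 + η ^ (N + 1) := by
  simp only [Ff]
  rw [Finset.sum_eq_zero, add_zero]
  intro p hp
  rw [zero_pow (by have := (dg_spec hp).2.1; omega)]; ring

theorem Sf_zero (z η : ℂ) : Sf M N α (0, z, η) = η ^ N := by
  simp only [Sf]
  rw [Finset.sum_eq_zero, zero_div, add_zero]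
  intro p hp
  rw [zero_pow (by have := (dg_spec hp).2.1; omega)]; ring

end
end SCM

namespace SCM
open Asymptotics

structure Sys (M N : ℕ) (α : ℕ × ℕ → ℂ → ℂ) (U : Set ℂ) (y₁ y₂ : ℂ → ℂ) : Prop where
  hU : IsOpen U
  hα : ∀ p ∈ idxI' M N, ∀ z ∈ U, DifferentiableAt ℂ (α p) z
  h1 : ∀ z ∈ U, HasDerivAt y₁ (Fn₁ M N α z (y₁ z) (y₂ z)) z
  h2 : ∀ z ∈ U, HasDerivAt y₂ (Fn₂ M N α z (y₁ z) (y₂ z)) z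

theorem exp_one_small {w : ℂ} (h : Complex.exp w = 1) (hw : ‖w‖ < 3) : w = 0 := by
  have h3 := Complex.abs_im_le_norm w
  have h4 := abs_le.1 h3
  have := Real.pi_gt_three
  rw [← Complex.log_exp (x := w) (by linarith) (by linarith), h, Complex.log_one]

theorem Fn₁_cont {M N : ℕ} {α : ℕ × ℕ → ℂ → ℂ} {U : Set ℂ} {y₁ y₂ : ℂ → ℂ} (S : Sys M N α U y₁ y₂) {z : ℂ} (hz : z ∈ U) :
    ContinuousAt (fun z => Fn₁ M N α z (y₁ z) (y₂ z)) z := by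
  have c1 := (S.h1 z hz).continuousAt
  have c2 := (S.h2 z hz).continuousAt
  unfold Fn₁
  refine (continuousAt_const.mul (c2.pow _)).add (tendsto_finsetSum _ fun p hp => ?_)
  exact ((continuousAt_const.mul (S.hα p hp z hz).continuousAt).mul (c1.pow _)).mul (c2.pow _)

set_option maxHeartbeats 1000000 in
theorem chordRoot {M N : ℕ} (hM : 2 ≤ M) (hN : 2 ≤ N) {α : ℕ × ℕ → ℂ → ℂ} {z₀ η₀ : ℂ}
    (hα : ∀ p ∈ idxI' M N, AnalyticAt ℂ (α p) z₀) (hη₀ : η₀ ^ (N + 1) = -1) :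
    ∃ r > 0, ∃ K > 0, ∀ (U : Set ℂ) (y₁ y₂ : ℂ → ℂ), Sys M N α U y₁ y₂ →
      ∀ (γ lam : ℝ → ℂ) (L : ℝ → ℝ) (s₁ s₂ : ℝ), s₁ ≤ s₂ →
      ContinuousOn γ (Set.Icc s₁ s₂) → ContinuousOn lam (Set.Icc s₁ s₂) →
      (∀ s ∈ Set.Icc s₁ s₂, ∀ t ∈ Set.Icc s₁ s₂, s ≤ t → ‖γ t - γ s‖ ≤ L t - L s) →
      (∀ s ∈ Set.Icc s₁ s₂, γ s ∈ U) →
      (∀ s ∈ Set.Icc s₁ s₂, y₁ (γ s) * Complex.exp (lam s) ^ (N + 1) = 1) →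
      (∀ s ∈ Set.Icc s₁ s₂, (Complex.exp (lam s), γ s, y₂ (γ s) * Complex.exp (lam s) ^ (M + 1)) ∈ Metric.ball ((0:ℂ), z₀, η₀) r) →
      (∀ s ∈ Set.Icc s₁ s₂, ∀ t ∈ Set.Icc s₁ s₂, ‖Complex.exp (lam t)‖ ^ (M * N - 1) ≤
        1.1 * ‖Complex.exp (lam s)‖ ^ (M * N - 1) + 2 * (M * N - 1 : ℕ) * ‖γ t - γ s‖) ∧
      ∀ m, 0 < m → m ≤ ‖Complex.exp (lam s₁)‖ → m ≤ ‖Complex.exp (lam s₂)‖ →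
        ‖Ham M N α y₁ y₂ (γ s₂) - Ham M N α y₁ y₂ (γ s₁)‖ ≤
          K * ((m⁻¹) ^ (M * N - 1) * (L s₂ - L s₁) + (m⁻¹) ^ (M + N + 1)) := by
  have hMN : 2 * N ≤ M * N := Nat.mul_le_mul_right _ hM
  have hN1c : (N : ℂ) + 1 ≠ 0 := by exact_mod_cast Nat.succ_ne_zero N
  have hη0 : η₀ ≠ 0 := by rintro rfl; simp at hη₀
  have hηn : ‖η₀‖ = 1 := by
    have : ‖η₀‖ ^ (N + 1) = 1 := by rw [← norm_pow, hη₀]; simp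
    exact (pow_eq_one_iff_of_nonneg (norm_nonneg _) (Nat.succ_ne_zero N)).1 this
  obtain ⟨hFa, hSa, -⟩ := an_aux (η := η₀) hα 0
  have hF0 : Ff M N α (0, z₀, η₀) = 0 := by rw [Ff_zero, hη₀]; ring
  obtain ⟨Ψ, hΨa, hΨ0, hΨ⟩ := exists_Psi hFa hF0 (c := (N + 1) * η₀ ^ N) (by
    simp only [Ff_zero]
    have := (hasDerivAt_pow (N + 1) η₀).const_add 1
    simpa using this) (mul_ne_zero hN1c (pow_ne_zero _ hη0))
  set τ := M * N - 1 with hτ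
  set D := (M + 1) * (N + 1) with hDdef
  set q := M + N + 1 with hq
  have hD : D = τ + 1 + q := by
    have : D = M * N + M + N + 1 := by rw [hDdef]; ring
    omega
  have hS0 : Sf M N α (0, z₀, η₀) ≠ 0 := by rw [Sf_zero]; exact pow_ne_zero _ hη0
  set P : ℂ × ℂ × ℂ → ℂ × ℂ × ℂ := fun y => (y.1, y.2.1, Ψ y) with hP
  have hPa : AnalyticAt ℂ P (0, z₀, 0) := analyticAt_fst.prod ((analyticAt_fst.comp analyticAt_snd).prod hΨa)
  have hP0 : P (0, z₀, 0) = (0, z₀, η₀) := by simp [hP, hΨ0]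
  set a : ℂ × ℂ × ℂ → ℂ := fun y => -(Sf M N α (P y))⁻¹ with ha
  have haa : AnalyticAt ℂ a (0, z₀, 0) := by
    refine AnalyticAt.fun_neg (AnalyticAt.fun_inv ?_ (by rw [hP0]; exact hS0))
    exact AnalyticAt.comp' (g := Sf M N α) (f := P) (by rw [hP0]; exact hSa) hPa
  set h : ℂ × ℂ × ℂ → ℂ := fun y => a y * Tf M N α (P y) with hh
  have hha : AnalyticAt ℂ h (0, z₀, 0) := by
    refine haa.mul ?_
    exact AnalyticAt.comp' (g := Tf M N α) (f := P) (by rw [hP0]; exact (an_aux hα 0).2.2) hPa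
  have ha1 : ‖a (0, z₀, 0)‖ = 1 := by
    rw [ha]; simp only [norm_neg, norm_inv, hP0, Sf_zero, norm_pow, hηn]; simp
  obtain ⟨r', hr', K, hK, hmain⟩ := chordAbs (N1 := N + 1) (by omega : 1 ≤ τ) (by omega : 1 ≤ q) hD (by omega) (by omega) haa hha ha1
  have hev : ∀ᶠ y in 𝓝 ((0:ℂ), z₀, η₀), Ψ (y.1, y.2.1, Ff M N α y) = y.2.2 ∧ Sf M N α y ≠ 0 ∧
      (y.1, y.2.1, Ff M N α y) ∈ Metric.ball ((0:ℂ), z₀, (0:ℂ)) r' := by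
    refine hΨ.and ((hSa.continuousAt.eventually_ne hS0).and ?_)
    have hc : ContinuousAt (fun y : ℂ × ℂ × ℂ => (y.1, y.2.1, Ff M N α y)) (0, z₀, η₀) :=
      continuousAt_fst.prodMk ((continuousAt_fst.comp continuousAt_snd).prodMk hFa.continuousAt)
    refine hc.eventually_mem ?_
    simp only [hF0]
    exact Metric.ball_mem_nhds _ hr'
  obtain ⟨r, hr, hball⟩ := Metric.eventually_nhds_iff_ball.1 hev
  refine ⟨r, hr, K, hK, ?_⟩
  intro U y₁ y₂ S γ lam L s₁ s₂ h12 hγ hlam hL hγU hv hmem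
  set H := Ham M N α y₁ y₂ with hH
  set k : ℝ → ℂ := fun s => H (γ s) * Complex.exp (lam s) ^ D with hk
  have hy0 : ∀ s ∈ Set.Icc s₁ s₂, y₁ (γ s) ≠ 0 := by
    intro s hs h0
    have := hv s hs
    rw [h0] at this; simp at this
  -- germs
  have hgerm : ∀ s ∈ Set.Icc s₁ s₂, ∃ l k' μ, Germ τ D a h (γ s) l k' μ ∧
        ∀ᶠ s' in 𝓝[Set.Icc s₁ s₂] s, lam s' = l (γ s') ∧ k s' = k' (γ s') := by
    intro s hs
    set ζ₀ := γ s with hζ₀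
    have hy0s : y₁ ζ₀ ≠ 0 := hy0 s hs
    set l : ℂ → ℂ := fun ζ => lam s - Complex.log (y₁ ζ / y₁ ζ₀) / (N + 1) with hl
    set μ : ℂ → ℂ := fun ζ => - (Fn₁ M N α ζ (y₁ ζ) (y₂ ζ) / y₁ ζ) / (N + 1) with hμ
    have hUev : ∀ᶠ ζ in 𝓝 ζ₀, ζ ∈ U := S.hU.mem_nhds (hγU s hs)
    have hc1 := (S.h1 ζ₀ (hγU s hs)).continuousAt
    have hc2 := (S.h2 ζ₀ (hγU s hs)).continuousAt
    have hyev : ∀ᶠ ζ in 𝓝 ζ₀, y₁ ζ ≠ 0 := hc1.eventually_ne hy0s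
    have hslit : ∀ᶠ ζ in 𝓝 ζ₀, y₁ ζ / y₁ ζ₀ ∈ Complex.slitPlane := by
      refine (hc1.div_const (y₁ ζ₀)).eventually_mem (Complex.isOpen_slitPlane.mem_nhds ?_)
      rw [div_self hy0s]; exact Complex.one_mem_slitPlane
    have hl0 : l ζ₀ = lam s := by simp [hl, div_self hy0s]
    have hlder : ∀ᶠ ζ in 𝓝 ζ₀, HasDerivAt l (μ ζ) ζ := by
      filter_upwards [hUev, hyev, hslit] with ζ h1 h2 h3
      have := (((S.h1 ζ h1).div_const (y₁ ζ₀)).clog h3).div_const ((N:ℂ) + 1) |>.const_sub (lam s)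
      refine this.congr_deriv ?_
      rw [hμ]; field_simp
    have hexp : ∀ ζ, y₁ ζ ≠ 0 → y₁ ζ * Complex.exp (l ζ) ^ (N + 1) = 1 := by
      intro ζ h2
      rw [hl]
      simp only
      rw [← Complex.exp_nat_mul]
      push_cast
      rw [mul_sub, mul_div_cancel₀ _ hN1c, Complex.exp_sub, Complex.exp_log (div_ne_zero h2 hy0s)]
      have := hv s hs
      rw [← Complex.exp_nat_mul] at this
      push_cast at this
      rw [div_div_eq_mul_div, mul_div_cancel₀ _ h2, mul_comm]
      exact this
    have hlc : ContinuousAt l ζ₀ := hlder.self_of_nhds.continuousAt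
    set η : ℂ → ℂ := fun ζ => y₂ ζ * Complex.exp (l ζ) ^ (M + 1) with hη
    have hmemev : ∀ᶠ ζ in 𝓝 ζ₀, (Complex.exp (l ζ), ζ, η ζ) ∈ Metric.ball ((0:ℂ), z₀, η₀) r := by
      have hc : ContinuousAt (fun ζ => (Complex.exp (l ζ), ζ, η ζ)) ζ₀ :=
        hlc.cexp.prodMk (continuousAt_id.prodMk (hc2.mul (hlc.cexp.pow _)))
      refine hc.eventually_mem (Metric.isOpen_ball.mem_nhds ?_)
      simp only [hη, hl0]
      exact hmem s hs
    set k' : ℂ → ℂ := fun ζ => H ζ * Complex.exp (l ζ) ^ D with hk'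
    have key : ∀ᶠ ζ in 𝓝 ζ₀, k' ζ = Ff M N α (Complex.exp (l ζ), ζ, η ζ) ∧
        P (Complex.exp (l ζ), ζ, k' ζ) = (Complex.exp (l ζ), ζ, η ζ) ∧ Sf M N α (Complex.exp (l ζ), ζ, η ζ) ≠ 0 ∧
        μ ζ * Complex.exp (l ζ) ^ τ = - Sf M N α (Complex.exp (l ζ), ζ, η ζ) := by
      filter_upwards [hyev, hmemev] with ζ h2 h3
      have e1 : k' ζ = Ff M N α (Complex.exp (l ζ), ζ, η ζ) := Ham_v (hexp ζ h2)
      obtain ⟨b1, b2, b3⟩ := hball _ h3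
      refine ⟨e1, ?_, b2, ?_⟩
      · rw [hP, e1]; simp only at b1 ⊢; rw [b1]
      · have e2 := Fn₁_v (M := M) (N := N) (α := α) (y₁ := y₁) (y₂ := y₂) (by omega) (hexp ζ h2)
        have e3 : Complex.exp (l ζ) ^ (N + 1) = (y₁ ζ)⁻¹ := eq_inv_of_mul_eq_one_right (hexp ζ h2)
        rw [e3] at e2
        have e4 : Sf M N α (Complex.exp (l ζ), ζ, η ζ) = Fn₁ M N α ζ (y₁ ζ) (y₂ ζ) * (y₁ ζ)⁻¹ * Complex.exp (l ζ) ^ (M * N - 1) / (N + 1) := by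
          rw [e2, mul_div_cancel_left₀ _ hN1c]
        rw [e4, hμ, hτ]
        simp only
        ring
    refine ⟨l, k', μ, ⟨?_, hlder, ?_, ?_⟩, ?_⟩
    · exact (((Fn₁_cont S (hγU s hs)).div hc1 hy0s).neg).div_const _
    · filter_upwards [key, hlder, hUev, hyev] with ζ ⟨e1, e2, e3, e4⟩ hd hu hyz
      have hHd := Ham_deriv (M := M) (N := N) (α := α) (y₁ := y₁) (y₂ := y₂) (z := ζ) (fun p hp => S.hα p hp ζ hu) (S.h1 ζ hu) (S.h2 ζ hu)
      have := hHd.mul ((hd.cexp).pow D)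
      refine this.congr_deriv ?_
      have e5 := dHam_v (M := M) (N := N) (α := α) (y₁ := y₁) (y₂ := y₂) (hexp ζ hyz)
      have e6 : h (Complex.exp (l ζ), ζ, k' ζ) = -(Sf M N α (Complex.exp (l ζ), ζ, η ζ))⁻¹ * Tf M N α (Complex.exp (l ζ), ζ, η ζ) := by
        rw [hh, ha]; simp only; rw [e2]
      rw [e6]
      have e7 : μ ζ * Complex.exp (l ζ) ^ (τ + 1) = - Sf M N α (Complex.exp (l ζ), ζ, η ζ) * Complex.exp (l ζ) := by
        rw [pow_succ, ← mul_assoc, e4]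
      have e8 : Complex.exp (l ζ) ^ D = Complex.exp (l ζ) * Complex.exp (l ζ) ^ (D - 1) := by
        rw [← pow_succ']; congr 1
      have e5' : dHam M N α y₁ y₂ ζ * Complex.exp (l ζ) ^ D = Complex.exp (l ζ) * Tf M N α (Complex.exp (l ζ), ζ, η ζ) := e5
      calc _ = dHam M N α y₁ y₂ ζ * Complex.exp (l ζ) ^ D + H ζ * (D * (Complex.exp (l ζ) * Complex.exp (l ζ) ^ (D - 1)) * μ ζ) := by
            simp only [Pi.pow_apply]; ring
        _ = μ ζ * (D * k' ζ) + - Sf M N α (Complex.exp (l ζ), ζ, η ζ) * Complex.exp (l ζ) * (-(Sf M N α (Complex.exp (l ζ), ζ, η ζ))⁻¹ * Tf M N α (Complex.exp (l ζ), ζ, η ζ)) := by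
            rw [e5', ← e8, hk']; field_simp; ring
        _ = _ := by rw [← e7]; ring
    · filter_upwards [key] with ζ ⟨e1, e2, e3, e4⟩
      rw [← mul_assoc, e4, ha]
      simp only
      rw [e2]; field_simp
    · have hγs : ContinuousWithinAt γ (Set.Icc s₁ s₂) s := hγ s hs
      have hlγ : ContinuousWithinAt (fun s' => l (γ s')) (Set.Icc s₁ s₂) s := ContinuousAt.comp_continuousWithinAt (g := l) hlc hγs
      have hw : ContinuousWithinAt (fun s' => ((N:ℂ) + 1) * (l (γ s') - lam s')) (Set.Icc s₁ s₂) s :=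
        continuousWithinAt_const.mul (hlγ.sub (hlam s hs))
      have hsm : ∀ᶠ s' in 𝓝[Set.Icc s₁ s₂] s, ‖((N:ℂ) + 1) * (l (γ s') - lam s')‖ < 3 := by
        refine hw.norm.eventually_lt continuousWithinAt_const ?_
        simp [← hζ₀, hl0]
      filter_upwards [hsm, self_mem_nhdsWithin] with s' h1 h2
      have e1 : l (γ s') = lam s' := by
        have h3 : Complex.exp (((N:ℂ) + 1) * (l (γ s') - lam s')) = 1 := by
          have e2 := hexp (γ s') (hy0 s' h2)
          have e3 := hv s' h2
          rw [← Complex.exp_nat_mul] at e2 e3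
          push_cast at e2 e3
          rw [mul_sub, Complex.exp_sub, mul_left_cancel₀ (hy0 s' h2) (e2.trans e3.symm), div_self (Complex.exp_ne_zero _)]
        have h4 := exp_one_small h3 h1
        exact sub_eq_zero.1 ((mul_eq_zero.1 h4).resolve_left hN1c)
      refine ⟨e1.symm, ?_⟩
      simp only [hk, hk', e1]
  have hkF : ∀ s ∈ Set.Icc s₁ s₂, k s = Ff M N α (Complex.exp (lam s), γ s, y₂ (γ s) * Complex.exp (lam s) ^ (M + 1)) :=
    fun s hs => Ham_v (hv s hs)
  obtain ⟨r1, r2⟩ := hmain γ lam k L s₁ s₂ h12 hγ hlam hL (by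
      intro s hs
      rw [hkF s hs]
      exact (hball _ (hmem s hs)).2.2) hgerm (by
      intro s hs t ht hst
      have e2 := hv s hs
      have e3 := hv t ht
      rw [← Complex.exp_nat_mul] at e2 e3
      rw [← hst] at e3
      obtain ⟨n, hn⟩ := Complex.exp_eq_exp_iff_exists_int.1 (mul_left_cancel₀ (hy0 s hs) (e3.trans e2.symm))
      exact ⟨n, by rw [mul_sub, hn]; ring⟩) (by
      intro s hs t ht hst hd
      have : Complex.exp (lam t) = Complex.exp (lam s) := by
        rw [← sub_add_cancel (lam t) (lam s), hd, Complex.exp_add, Complex.exp_two_pi_mul_I, one_mul]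
      simp only [hk, hst, this])
  refine ⟨r1, fun m hm hm1 hm2 => ?_⟩
  have := r2 m hm hm1 hm2
  simp only [hk] at this
  rwa [mul_inv_cancel_right₀ (pow_ne_zero _ (Complex.exp_ne_zero _)), mul_inv_cancel_right₀ (pow_ne_zero _ (Complex.exp_ne_zero _))] at this

end SCM

namespace SCM
open Asymptotics

theorem exists_pos_le {ι : Type*} (s : Set ι) (hs : s.Finite) (f : ι → ℝ) (hf : ∀ x ∈ s, 0 < f x) :
    ∃ ρ > 0, ∀ x ∈ s, ρ ≤ f x := by
  induction s, hs using Set.Finite.induction_on with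
  | empty => exact ⟨1, one_pos, by simp⟩
  | @insert a s _ _ ih =>
    obtain ⟨ρ, h1, h2⟩ := ih fun x hx => hf x (Set.mem_insert_of_mem _ hx)
    refine ⟨min ρ (f a), lt_min h1 (hf a (Set.mem_insert _ _)), ?_⟩
    rintro x (rfl | hx)
    · exact min_le_right _ _
    · exact (min_le_left _ _).trans (h2 x hx)

theorem exists_ge {ι : Type*} (s : Set ι) (hs : s.Finite) (f : ι → ℝ) :
    ∃ K > 0, ∀ x ∈ s, f x ≤ K := by
  induction s, hs using Set.Finite.induction_on with
  | empty => exact ⟨1, one_pos, by simp⟩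
  | @insert a s _ _ ih =>
    obtain ⟨ρ, h1, h2⟩ := ih
    refine ⟨max ρ (f a), lt_max_of_lt_left h1, ?_⟩
    rintro x (rfl | hx)
    · exact le_max_right _ _
    · exact (h2 x hx).trans (le_max_left _ _)

theorem roots_finite (N : ℕ) : {η : ℂ | η ^ (N + 1) = -1}.Finite := by
  have hp : (Polynomial.X ^ (N + 1) + Polynomial.C (1:ℂ)) ≠ 0 := by
    exact (Polynomial.monic_X_pow_add_C 1 (Nat.succ_ne_zero N)).ne_zero
  refine ((Polynomial.X ^ (N + 1) + Polynomial.C (1:ℂ)).roots.toFinset.finite_toSet).subset fun η hη => ?_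
  have : η ^ (N + 1) = -1 := hη
  rw [Finset.mem_coe, Multiset.mem_toFinset, Polynomial.mem_roots hp]
  simp [Polynomial.IsRoot, this]

/-- local bound of coefficients -/
theorem coeff_bound {ι : Type*} (s : Finset ι) (f : ι → ℂ → ℂ) (z₀ : ℂ) (hf : ∀ p ∈ s, ContinuousAt (f p) z₀) :
    ∃ A > 0, ∃ r > 0, ∀ z, ‖z - z₀‖ < r → ∑ p ∈ s, ‖f p z‖ ≤ A := by
  have hc : ContinuousAt (fun z => ∑ p ∈ s, ‖f p z‖) z₀ := tendsto_finsetSum _ fun p hp => (hf p hp).norm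
  have h0 : 0 ≤ ∑ p ∈ s, ‖f p z₀‖ := Finset.sum_nonneg fun _ _ => norm_nonneg _
  have hev := hc.eventually_lt (continuousAt_const (y := ∑ p ∈ s, ‖f p z₀‖ + 1)) (by linarith)
  obtain ⟨r, hr, h⟩ := Metric.eventually_nhds_iff.1 hev
  exact ⟨_, by linarith, r, hr, fun z hz => (h (by rwa [dist_eq_norm])).le⟩

theorem root_near {M N : ℕ} (hN : 1 ≤ N) {α : ℕ × ℕ → ℂ → ℂ} {z₀ : ℂ}
    (hα : ∀ p ∈ idxI' M N, ContinuousAt (α p) z₀) {ρ : ℝ} (hρ : 0 < ρ) :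
    ∃ r > 0, r ≤ 1 ∧ ∃ κ > 0, ∀ v z η : ℂ, ‖v‖ < r → ‖z - z₀‖ < r → ‖Ff M N α (v, z, η)‖ ≤ κ →
      ‖η‖ < 2 ∧ ∃ η₀, η₀ ^ (N + 1) = -1 ∧ ‖η - η₀‖ < ρ := by
  obtain ⟨A, hA, r₀, hr₀, hAb⟩ := coeff_bound _ _ z₀ hα
  -- compactness
  obtain ⟨ε, hε, hεb⟩ : ∃ ε > 0, ∀ η : ℂ, ‖η‖ ≤ 2 → (∀ η₀, η₀ ^ (N + 1) = -1 → ρ ≤ ‖η - η₀‖) → ε ≤ ‖1 + η ^ (N + 1)‖ := by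
    have hcl : IsClosed {η : ℂ | ∀ η₀, η₀ ^ (N + 1) = -1 → ρ ≤ ‖η - η₀‖} := by
      simp only [Set.setOf_forall]
      refine isClosed_iInter fun η₀ => isClosed_iInter fun _ => ?_
      exact isClosed_le continuous_const (by fun_prop)
    have hcomp : IsCompact (Metric.closedBall (0:ℂ) 2 ∩ {η : ℂ | ∀ η₀, η₀ ^ (N + 1) = -1 → ρ ≤ ‖η - η₀‖}) :=
      (isCompact_closedBall _ _).inter_right hcl
    obtain ⟨ε, h1, h2⟩ := hcomp.exists_forall_le' (f := fun η : ℂ => ‖1 + η ^ (N + 1)‖) (a := 0) (by fun_prop) (by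
      rintro η ⟨_, h⟩
      rw [norm_pos_iff]
      intro h0
      have := h η (by linear_combination h0)
      simp at this; linarith)
    exact ⟨ε, h1, fun η h3 h4 => h2 η ⟨by simpa using h3, h4⟩⟩
  set κ := min (1/2) (ε / 4) with hκ
  set r := min (min 1 r₀) (min (1 / (2 * A)) (ε / (4 * A * 2 ^ N))) with hr
  have hr1 : r ≤ 1 := (min_le_left _ _).trans (min_le_left _ _)
  have hr2 : r ≤ r₀ := (min_le_left _ _).trans (min_le_right _ _)
  have hr3 : r ≤ 1 / (2 * A) := (min_le_right _ _).trans (min_le_left _ _)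
  have hr4 : r ≤ ε / (4 * A * 2 ^ N) := (min_le_right _ _).trans (min_le_right _ _)
  have hrp : 0 < r := by rw [hr]; positivity
  refine ⟨r, hrp, hr1, κ, by rw [hκ]; positivity, ?_⟩
  intro v z η hv hz hF
  have hF1 : ‖Ff M N α (v, z, η)‖ ≤ 1/2 := hF.trans (min_le_left _ _)
  have hF2 : ‖Ff M N α (v, z, η)‖ ≤ ε / 4 := hF.trans (min_le_right _ _)
  have hsum : ∀ X : ℝ, 1 ≤ X → ‖η‖ ≤ X → ‖∑ p ∈ idxI' M N, α p z * v ^ dg M N p * η ^ p.2‖ ≤ A * r * X ^ N := by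
    intro X hX1 hX
    calc _ ≤ ∑ p ∈ idxI' M N, ‖α p z‖ * (r * X ^ N) := by
          refine norm_sum_le_of_le _ fun p hp => ?_
          obtain ⟨-, d1, d2⟩ := dg_spec hp
          rw [norm_mul, norm_mul, norm_pow, norm_pow, mul_assoc]
          refine mul_le_mul_of_nonneg_left ?_ (norm_nonneg _)
          refine mul_le_mul ?_ ?_ (by positivity) hrp.le
          · calc ‖v‖ ^ dg M N p ≤ r ^ dg M N p := pow_le_pow_left₀ (norm_nonneg _) hv.le _
              _ ≤ r ^ 1 := pow_le_pow_of_le_one hrp.le hr1 d1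
              _ = r := pow_one r
          · exact (pow_le_pow_left₀ (norm_nonneg _) hX _).trans (pow_le_pow_right₀ hX1 d2)
      _ ≤ A * (r * X ^ N) := by
          rw [← Finset.sum_mul]
          exact mul_le_mul_of_nonneg_right (hAb z (hz.trans_le hr2)) (by positivity)
      _ = _ := by ring
  have hAr : A * r ≤ 1 / 2 := by
    calc A * r ≤ A * (1 / (2 * A)) := mul_le_mul_of_nonneg_left hr3 hA.le
      _ = 1/2 := by field_simp
  have hAr2 : A * r * 2 ^ N ≤ ε / 4 := by
    calc A * r * 2 ^ N ≤ A * (ε / (4 * A * 2 ^ N)) * 2 ^ N := by gcongr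
      _ = ε / 4 := by field_simp
  have hη2 : ‖η‖ < 2 := by
    by_contra hcon
    push Not at hcon
    have h1 := hsum ‖η‖ (by linarith) le_rfl
    set Sg := ∑ p ∈ idxI' M N, α p z * v ^ dg M N p * η ^ p.2 with hSg
    have e : η ^ (N + 1) = Ff M N α (v, z, η) - 1 - Sg := by simp only [Ff, hSg]; ring
    have h2 : ‖η‖ ^ (N + 1) ≤ 1/2 + 1 + A * r * ‖η‖ ^ N := by
      rw [← norm_pow, e]
      refine (norm_sub_le _ _).trans (add_le_add ((norm_sub_le _ _).trans ?_) h1)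
      simpa using hF1
    have h3 : 2 ≤ ‖η‖ ^ N := by
      calc (2:ℝ) ≤ ‖η‖ ^ 1 := by simpa using hcon
        _ ≤ ‖η‖ ^ N := pow_le_pow_right₀ (by linarith) hN
    have h4 : A * r * ‖η‖ ^ N ≤ 1 / 2 * ‖η‖ ^ N := mul_le_mul_of_nonneg_right hAr (by positivity)
    have h5 : 2 * ‖η‖ ^ N ≤ ‖η‖ ^ (N + 1) := by
      rw [pow_succ, mul_comm]; exact mul_le_mul_of_nonneg_left hcon (by positivity)
    linarith
  refine ⟨hη2, ?_⟩
  by_contra hcon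
  push Not at hcon
  have h1 := hεb η hη2.le hcon
  have h2 := hsum 2 (by norm_num) hη2.le
  have e : 1 + η ^ (N + 1) = Ff M N α (v, z, η) - ∑ p ∈ idxI' M N, α p z * v ^ dg M N p * η ^ p.2 := by simp only [Ff]; ring
  have h3 : ‖1 + η ^ (N + 1)‖ ≤ ε / 4 + ε / 4 := by
    rw [e]; exact (norm_sub_le _ _).trans (add_le_add hF2 (h2.trans hAr2))
  linarith

theorem deriv_local {f : ℂ → ℂ} {d z : ℂ} {C : ℝ} (h : HasDerivAt f d z) (hd : ‖d‖ < C) :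
    ∀ᶠ ζ in 𝓝 z, ‖f ζ - f z‖ ≤ C * ‖ζ - z‖ := by
  have h1 := (hasDerivAt_iff_isLittleO.1 h).bound (sub_pos.2 hd)
  filter_upwards [h1] with ζ hζ
  calc ‖f ζ - f z‖ = ‖(f ζ - f z - (ζ - z) • d) + (ζ - z) • d‖ := by ring_nf
    _ ≤ (C - ‖d‖) * ‖ζ - z‖ + ‖ζ - z‖ * ‖d‖ := (norm_add_le _ _).trans (add_le_add hζ (norm_smul _ _).le)
    _ = C * ‖ζ - z‖ := by ring

theorem right_of_Icc {γ : ℝ → ℂ} {s₁ s₂ t : ℝ} (hγ : ContinuousOn γ (Set.Icc s₁ s₂)) (h1 : s₁ ≤ t) (h2 : t < s₂) {p : ℂ → Prop}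
    (hp : ∀ᶠ ζ in 𝓝 (γ t), p ζ) : ∀ᶠ t' in 𝓝[>] t, p (γ t') ∧ t' ∈ Set.Icc s₁ s₂ ∧ t < t' := by
  have hc := hγ t ⟨h1, h2.le⟩
  have hle : 𝓝[>] t ≤ 𝓝[Set.Icc s₁ s₂] t := by
    rw [← nhdsWithin_Ioc_eq_nhdsGT h2]
    exact nhdsWithin_mono _ fun x hx => ⟨h1.trans hx.1.le, hx.2⟩
  filter_upwards [hle (hc.eventually hp), hle self_mem_nhdsWithin, self_mem_nhdsWithin] with t' a b c
  exact ⟨a, b, c⟩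

end SCM

namespace SCM
open Asymptotics

set_option maxHeartbeats 1000000 in
theorem chordUnif {M N : ℕ} (hM : 2 ≤ M) (hN : 2 ≤ N) {α : ℕ × ℕ → ℂ → ℂ} {z₀ : ℂ}
    (hα : ∀ p ∈ idxI' M N, AnalyticAt ℂ (α p) z₀) :
    ∃ r > 0, r ≤ 1 ∧ ∃ κ > 0, ∃ K > 0, ∀ (U : Set ℂ) (y₁ y₂ : ℂ → ℂ), Sys M N α U y₁ y₂ →
      ∀ (γ lam : ℝ → ℂ) (L : ℝ → ℝ) (s₁ s₂ : ℝ), s₁ ≤ s₂ →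
      ContinuousOn γ (Set.Icc s₁ s₂) → ContinuousOn lam (Set.Icc s₁ s₂) →
      (∀ s ∈ Set.Icc s₁ s₂, ∀ t ∈ Set.Icc s₁ s₂, s ≤ t → ‖γ t - γ s‖ ≤ L t - L s) →
      (∀ s ∈ Set.Icc s₁ s₂, γ s ∈ U) →
      (∀ s ∈ Set.Icc s₁ s₂, y₁ (γ s) * Complex.exp (lam s) ^ (N + 1) = 1) →
      (∀ s ∈ Set.Icc s₁ s₂, ‖Complex.exp (lam s)‖ < r ∧ ‖γ s - z₀‖ < r ∧
        ‖Ham M N α y₁ y₂ (γ s)‖ * ‖Complex.exp (lam s)‖ ^ ((M + 1) * (N + 1)) ≤ κ) →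
      (∀ s ∈ Set.Icc s₁ s₂, ∀ t ∈ Set.Icc s₁ s₂, ‖Complex.exp (lam t)‖ ^ (M * N - 1) ≤
        1.1 * ‖Complex.exp (lam s)‖ ^ (M * N - 1) + 2 * (M * N - 1 : ℕ) * ‖γ t - γ s‖) ∧
      ∀ m, 0 < m → m ≤ ‖Complex.exp (lam s₁)‖ → m ≤ ‖Complex.exp (lam s₂)‖ →
        ‖Ham M N α y₁ y₂ (γ s₂) - Ham M N α y₁ y₂ (γ s₁)‖ ≤
          K * ((m⁻¹) ^ ((M + 1) * (N + 1) - 1) * (L s₂ - L s₁)) := by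
  classical
  have hMN : 2 * N ≤ M * N := Nat.mul_le_mul_right _ hM
  set R : Set ℂ := {η : ℂ | η ^ (N + 1) = -1} with hR
  have hRf : R.Finite := roots_finite N
  choose! rr hrr KK hKK hroot using fun (η₀ : ℂ) (h : η₀ ∈ R) => chordRoot hM hN hα h
  obtain ⟨ρ₁, hρ₁, hρ₁b⟩ := exists_pos_le R hRf rr hrr
  obtain ⟨K, hK, hKb⟩ := exists_ge R hRf KK
  obtain ⟨ρ₂, hρ₂, hρ₂b⟩ := exists_pos_le ((R ×ˢ R) ∩ {p | p.1 ≠ p.2}) ((hRf.prod hRf).inter_of_left _) (fun p => dist p.1 p.2)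
    (fun p hp => dist_pos.2 hp.2)
  set ρ := min ρ₁ (ρ₂ / 2) with hρ
  have hρp : 0 < ρ := by rw [hρ]; positivity
  obtain ⟨r₁, hr₁, hr₁1, κ, hκ, hnear⟩ := root_near (M := M) (by omega : 1 ≤ N) (fun p hp => (hα p hp).continuousAt) hρp
  obtain ⟨A, hA, r₂, hr₂, hAb⟩ := coeff_bound (idxI' M N) (fun p => deriv (α p)) z₀ (fun p hp => (hα p hp).deriv.continuousAt)
  set r := min r₁ (min r₂ ρ₁) with hr
  have hrr1 : r ≤ r₁ := min_le_left _ _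
  have hrr2 : r ≤ r₂ := (min_le_right _ _).trans (min_le_left _ _)
  have hrr3 : r ≤ ρ₁ := (min_le_right _ _).trans (min_le_right _ _)
  set τ := M * N - 1 with hτ
  set D := (M + 1) * (N + 1) with hD
  have hDτ : D - 1 = τ + (M + N + 1) := by
    have : D = M * N + M + N + 1 := by rw [hD]; ring
    omega
  have hτ1 : 1 ≤ τ := by omega
  have hτ0 : (0:ℝ) < τ := by exact_mod_cast hτ1
  set K₁ := K * (1 + 8 * τ) with hK₁
  set K₂ := A * 2 ^ N * 2 ^ (D - 1) + 1 with hK₂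
  refine ⟨r, by rw [hr]; positivity, hrr1.trans hr₁1, κ, hκ, max K₁ K₂, lt_max_of_lt_left (by positivity), ?_⟩
  intro U y₁ y₂ S γ lam L s₁ s₂ h12 hγ hlam hL hγU hv hmem
  set H := Ham M N α y₁ y₂ with hH
  set η : ℝ → ℂ := fun s => y₂ (γ s) * Complex.exp (lam s) ^ (M + 1) with hη
  have hFs : ∀ s ∈ Set.Icc s₁ s₂, ‖η s‖ < 2 ∧ ∃ η₀, η₀ ^ (N + 1) = -1 ∧ ‖η s - η₀‖ < ρ := by
    intro s hs
    obtain ⟨m1, m2, m3⟩ := hmem s hs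
    refine hnear (Complex.exp (lam s)) (γ s) (η s) (m1.trans_le hrr1) (m2.trans_le hrr1) ?_
    rw [hη, ← Ham_v (hv s hs), norm_mul, norm_pow]
    exact m3
  have hηc : ContinuousOn η (Set.Icc s₁ s₂) := by
    refine ContinuousOn.mul ?_ (hlam.cexp.pow _)
    intro s hs
    exact ContinuousAt.comp_continuousWithinAt (g := y₂) (S.h2 _ (hγU s hs)).continuousAt (hγ s hs)
  have hs₁ : s₁ ∈ Set.Icc s₁ s₂ := ⟨le_rfl, h12⟩
  have hs₂ : s₂ ∈ Set.Icc s₁ s₂ := ⟨h12, le_rfl⟩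
  obtain ⟨η₀, hη₀, hη₀n⟩ := (hFs s₁ hs₁).2
  have htrack : η '' Set.Icc s₁ s₂ ⊆ Metric.ball η₀ ρ := by
    have hpre : IsPreconnected (η '' Set.Icc s₁ s₂) := isPreconnected_Icc.image _ hηc
    refine hpre.subset_left_of_subset_union (v := ⋃ η' ∈ R \ {η₀}, Metric.ball η' ρ) Metric.isOpen_ball
      (isOpen_biUnion fun _ _ => Metric.isOpen_ball) ?_ ?_ ?_
    · rw [Set.disjoint_iUnion₂_right]
      rintro η' ⟨h1, h2⟩
      apply Metric.ball_disjoint_ball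
      have h3 := hρ₂b (η₀, η') ⟨⟨hη₀, h1⟩, fun h => h2 h.symm⟩
      have : ρ ≤ ρ₂ / 2 := min_le_right _ _
      simp only at h3
      linarith
    · rintro _ ⟨s, hs, rfl⟩
      obtain ⟨η', h1, h2⟩ := (hFs s hs).2
      by_cases he : η' = η₀
      · left; rw [← he]; simpa [dist_eq_norm] using h2
      · right
        simp only [Set.mem_iUnion]
        exact ⟨η', ⟨h1, he⟩, by simpa [dist_eq_norm] using h2⟩
    · exact ⟨η s₁, ⟨s₁, hs₁, rfl⟩, by simpa [dist_eq_norm] using hη₀n⟩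
  obtain ⟨hi, hii⟩ := hroot η₀ hη₀ U y₁ y₂ S γ lam L s₁ s₂ h12 hγ hlam hL hγU hv (by
    intro s hs
    have h1 := hρ₁b η₀ hη₀
    obtain ⟨m1, m2, m3⟩ := hmem s hs
    have h2 := htrack ⟨s, hs, rfl⟩
    rw [Metric.mem_ball, Prod.dist_eq, Prod.dist_eq, max_lt_iff, max_lt_iff]
    refine ⟨by simpa using (m1.trans_le (hrr3.trans h1)), by simpa [dist_eq_norm] using (m2.trans_le (hrr3.trans h1)), ?_⟩
    exact (Metric.mem_ball.1 h2).trans_le ((min_le_left _ _).trans h1))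
  refine ⟨hi, fun m hm hm1 hm2 => ?_⟩
  have hlen : 0 ≤ L s₂ - L s₁ := (norm_nonneg _).trans (hL s₁ hs₁ s₂ hs₂ h12)
  set len := L s₂ - L s₁ with hlendef
  have hmle : m ≤ 1 := hm1.trans ((hmem s₁ hs₁).1.le.trans (hrr1.trans hr₁1))
  have hmi : 1 ≤ m⁻¹ := (one_le_inv₀ hm).2 hmle
  rcases le_or_gt (m ^ τ / (8 * τ)) len with hcase | hcase
  · have h1 := hii m hm hm1 hm2
    have h2 : m⁻¹ ^ τ ≤ m⁻¹ ^ (D - 1) := pow_le_pow_right₀ hmi (by omega)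
    have h3 : m⁻¹ ^ (M + N + 1) ≤ 8 * τ * (m⁻¹ ^ (D - 1) * len) := by
      rw [hDτ, pow_add m⁻¹ τ]
      have : 1 ≤ 8 * τ * (m⁻¹ ^ τ * len) := by
        calc 1 = 8 * τ * (m⁻¹ ^ τ * (m ^ τ / (8 * τ))) := by
              rw [inv_pow]; field_simp
          _ ≤ _ := by gcongr
      calc m⁻¹ ^ (M + N + 1) = 1 * m⁻¹ ^ (M + N + 1) := (one_mul _).symm
        _ ≤ (8 * τ * (m⁻¹ ^ τ * len)) * m⁻¹ ^ (M + N + 1) := by gcongr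
        _ = _ := by ring
    have hX : 0 ≤ m⁻¹ ^ (D - 1) * len := by positivity
    calc ‖H (γ s₂) - H (γ s₁)‖ ≤ KK η₀ * (m⁻¹ ^ τ * len + m⁻¹ ^ (M + N + 1)) := h1
      _ ≤ K * (m⁻¹ ^ (D - 1) * len + 8 * τ * (m⁻¹ ^ (D - 1) * len)) := by
          refine mul_le_mul (hKb η₀ hη₀) (add_le_add ?_ h3) (by positivity) hK.le
          gcongr
      _ = K₁ * (m⁻¹ ^ (D - 1) * len) := by rw [hK₁]; ring
      _ ≤ _ := mul_le_mul_of_nonneg_right (le_max_left _ _) hX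
  · have hLmono : MonotoneOn L (Set.Icc s₁ s₂) := fun s hs t ht hst => by
      have := (norm_nonneg _).trans (hL s hs t ht hst); linarith
    have hvt : ∀ t ∈ Set.Icc s₁ s₂, m / 2 ≤ ‖Complex.exp (lam t)‖ := by
      intro t ht
      have h1 := hi t ht s₁ hs₁
      have h2 : ‖γ s₁ - γ t‖ ≤ len := by
        rw [norm_sub_rev]
        refine (hL s₁ hs₁ t ht ht.1).trans ?_
        have := hLmono ht hs₂ ht.2
        rw [hlendef]; linarith
      have h3 : m ^ τ ≤ ‖Complex.exp (lam s₁)‖ ^ τ := pow_le_pow_left₀ hm.le hm1 _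
      have h4 : 2 * τ * ‖γ s₁ - γ t‖ ≤ m ^ τ / 4 := by
        calc 2 * τ * ‖γ s₁ - γ t‖ ≤ 2 * τ * (m ^ τ / (8 * τ)) := by gcongr; exact h2.trans hcase.le
          _ = m ^ τ / 4 := by field_simp; norm_num
      have h5 : (m / 2) ^ τ ≤ m ^ τ / 2 := by
        rw [div_pow]
        have : (2:ℝ) ^ 1 ≤ 2 ^ τ := pow_le_pow_right₀ (by norm_num) hτ1
        gcongr
        simpa using this
      have h6 : (m / 2) ^ τ ≤ ‖Complex.exp (lam t)‖ ^ τ := by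
        have : 0 < m ^ τ := by positivity
        linarith
      exact le_of_pow_le_pow_left₀ (by omega) (norm_nonneg _) h6
    have hder : ∀ t ∈ Set.Icc s₁ s₂, ‖dHam M N α y₁ y₂ (γ t)‖ < K₂ * m⁻¹ ^ (D - 1) := by
      intro t ht
      obtain ⟨m1, m2, m3⟩ := hmem t ht
      have h1 := dHam_v (M := M) (N := N) (α := α) (y₁ := y₁) (y₂ := y₂) (hv t ht)
      set v := Complex.exp (lam t) with hvd
      have hv0 : v ≠ 0 := Complex.exp_ne_zero _
      have hTf : ‖Tf M N α (v, γ t, η t)‖ ≤ A * 2 ^ N := by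
        calc _ ≤ ∑ p ∈ idxI' M N, ‖deriv (α p) (γ t)‖ * 2 ^ N := by
              refine norm_sum_le_of_le _ fun p hp => ?_
              obtain ⟨-, d1, d2⟩ := dg_spec hp
              simp only
              rw [norm_mul, norm_mul, norm_pow, norm_pow, mul_assoc]
              refine mul_le_mul_of_nonneg_left ?_ (norm_nonneg _)
              calc ‖v‖ ^ (dg M N p - 1) * ‖η t‖ ^ p.2 ≤ 1 * 2 ^ N := by
                    refine mul_le_mul (pow_le_one₀ (norm_nonneg _) (m1.le.trans (hrr1.trans hr₁1))) ?_ (by positivity) zero_le_one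
                    exact (pow_le_pow_left₀ (norm_nonneg _) (hFs t ht).1.le _).trans (pow_le_pow_right₀ (by norm_num) d2)
                _ = 2 ^ N := one_mul _
          _ ≤ A * 2 ^ N := by
              rw [← Finset.sum_mul]
              exact mul_le_mul_of_nonneg_right (hAb _ (m2.trans_le hrr2)) (by positivity)
      have h2 : dHam M N α y₁ y₂ (γ t) = Tf M N α (v, γ t, η t) * (v⁻¹) ^ (D - 1) := by
        have hDs : D = (D - 1) + 1 := by omega
        have h3 : dHam M N α y₁ y₂ (γ t) * v ^ (D - 1) * v = Tf M N α (v, γ t, η t) * v := by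
          rw [mul_assoc, ← pow_succ, ← hDs, h1]; ring
        have h4 := mul_right_cancel₀ hv0 h3
        rw [← h4, inv_pow, mul_inv_cancel_right₀ (pow_ne_zero _ hv0)]
      have h3 : ‖v‖⁻¹ ≤ 2 * m⁻¹ := by
        have := inv_anti₀ (by positivity : 0 < m / 2) (hvt t ht)
        rw [inv_div, div_eq_mul_inv] at this
        exact this
      rw [h2, norm_mul, norm_pow, norm_inv]
      calc _ ≤ A * 2 ^ N * (2 * m⁻¹) ^ (D - 1) := by gcongr
        _ = A * 2 ^ N * 2 ^ (D - 1) * m⁻¹ ^ (D - 1) := by rw [mul_pow]; ring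
        _ < K₂ * m⁻¹ ^ (D - 1) := by
            rw [hK₂]
            exact mul_lt_mul_of_pos_right (by linarith) (by positivity)
    have hHd : ∀ t ∈ Set.Icc s₁ s₂, HasDerivAt H (dHam M N α y₁ y₂ (γ t)) (γ t) := fun t ht =>
      Ham_deriv (fun p hp => S.hα p hp _ (hγU t ht)) (S.h1 _ (hγU t ht)) (S.h2 _ (hγU t ht))
    have hfin := pathLemma (H := fun s => H (γ s)) (L := L) (C := K₂ * m⁻¹ ^ (D - 1)) h12 (fun t ht =>
        ContinuousAt.comp_continuousWithinAt (g := H) (hHd t ht).continuousAt (hγ t ht)) hLmono (by positivity) (by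
      intro t h1 h2
      have ht : t ∈ Set.Icc s₁ s₂ := ⟨h1, h2.le⟩
      filter_upwards [right_of_Icc hγ h1 h2 (deriv_local (hHd t ht) (hder t ht))] with t' ⟨a, b, c⟩
      exact a.trans (mul_le_mul_of_nonneg_left (hL t ht t' b c.le) (by positivity)))
    calc _ ≤ K₂ * m⁻¹ ^ (D - 1) * len := hfin
      _ = K₂ * (m⁻¹ ^ (D - 1) * len) := by ring
      _ ≤ _ := mul_le_mul_of_nonneg_right (le_max_right _ _) (by positivity)

end SCM

namespace SCM
open Asymptotics

theorem exists_lam (N : ℕ) {g : ℝ → ℂ} {a b : ℝ} (hab : a ≤ b) (hg : ContinuousOn g (Set.Icc a b)) (h0 : ∀ s ∈ Set.Icc a b, g s ≠ 0) :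
    ∃ lam : ℝ → ℂ, Continuous lam ∧ ∀ s ∈ Set.Icc a b, g s * Complex.exp (lam s) ^ (N + 1) = 1 := by
  have hN1c : (N : ℂ) + 1 ≠ 0 := by exact_mod_cast Nat.succ_ne_zero N
  have hc : Continuous (Set.IccExtend hab (Set.restrict (Set.Icc a b) g)) := (continuousOn_iff_continuous_restrict.1 hg).Icc_extend'
  obtain ⟨f, hf, hfe⟩ := exists_log_of_continuous hc (by
    intro x
    rw [Set.IccExtend_apply]
    exact h0 _ (Subtype.mem _))
  refine ⟨fun s => - f s / (N + 1), by fun_prop, fun s hs => ?_⟩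
  have h1 := hfe s
  rw [Set.IccExtend_of_mem _ _ hs] at h1
  change Complex.exp (f s) = g s at h1
  rw [← Complex.exp_nat_mul]
  push_cast
  rw [mul_div_cancel₀ _ hN1c, Complex.exp_neg, h1, mul_inv_cancel₀ (h0 s hs)]

set_option maxHeartbeats 1000000 in
theorem gapChord {M N : ℕ} (hM : 2 ≤ M) (hN : 2 ≤ N) {α : ℕ × ℕ → ℂ → ℂ} {z₀ : ℂ}
    (hα : ∀ p ∈ idxI' M N, AnalyticAt ℂ (α p) z₀) :
    ∃ κ > 0, ∃ δ > 0, ∃ K > 0, ∀ (U : Set ℂ) (y₁ y₂ : ℂ → ℂ), Sys M N α U y₁ y₂ →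
      ∀ (γ : ℝ → ℂ) (L : ℝ → ℝ) (a b : ℝ), a ≤ b →
      ContinuousOn γ (Set.Icc a b) →
      (∀ s ∈ Set.Icc a b, ∀ t ∈ Set.Icc a b, s ≤ t → ‖γ t - γ s‖ ≤ L t - L s) →
      (∀ s ∈ Set.Icc a b, γ s ∈ U ∧ y₁ (γ s) ≠ 0 ∧ ‖γ s - z₀‖ < δ ∧
        ‖Ham M N α y₁ y₂ (γ s)‖ ≤ κ * ‖y₁ (γ s)‖ ^ (M + 1)) →
      L b - L a ≤ δ → δ⁻¹ ≤ ‖y₁ (γ a)‖ →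
      ∀ w : ℝ, 0 < w → ‖y₁ (γ a)‖ ≤ w ^ (N + 1) → ‖y₁ (γ b)‖ ≤ w ^ (N + 1) →
        ‖Ham M N α y₁ y₂ (γ b) - Ham M N α y₁ y₂ (γ a)‖ ≤ K * (w ^ ((M + 1) * (N + 1) - 1) * (L b - L a)) := by
  obtain ⟨r, hr, hr1, κ, hκ, K, hK, hmain⟩ := chordUnif hM hN hα
  have hMN : 2 * N ≤ M * N := Nat.mul_le_mul_right _ hM
  set τ := M * N - 1 with hτ
  have hτ1 : 1 ≤ τ := by omega
  have hτ0 : (0:ℝ) < τ := by exact_mod_cast hτ1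
  set δ := min r (min ((r / 8) ^ (N + 1)) ((r / 2) ^ τ / (8 * τ))) with hδ
  have hδ0 : 0 < δ := by rw [hδ]; positivity
  have hδ1 : δ ≤ r := min_le_left _ _
  have hδ2 : δ ≤ (r / 8) ^ (N + 1) := (min_le_right _ _).trans (min_le_left _ _)
  have hδ3 : δ ≤ (r / 2) ^ τ / (8 * τ) := (min_le_right _ _).trans (min_le_right _ _)
  refine ⟨κ, hκ, δ, hδ0, K, hK, ?_⟩
  intro U y₁ y₂ S γ L a b hab hγ hL hall hlen hya w hw hwa hwb
  obtain ⟨lam, hlam, hlamv⟩ := exists_lam N (g := fun s => y₁ (γ s)) hab (fun s hs =>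
    ContinuousAt.comp_continuousWithinAt (g := y₁) (S.h1 _ (hall s hs).1).continuousAt (hγ s hs)) (fun s hs => (hall s hs).2.1)
  have hnorm : ∀ s ∈ Set.Icc a b, ‖y₁ (γ s)‖ * ‖Complex.exp (lam s)‖ ^ (N + 1) = 1 := by
    intro s hs
    rw [← norm_pow, ← norm_mul, hlamv s hs, norm_one]
  set f : ℝ → ℝ := fun s => ‖Complex.exp (lam s)‖ with hf
  have hfc : Continuous f := (hlam.cexp).norm
  have ha : a ∈ Set.Icc a b := ⟨le_rfl, hab⟩
  have hb : b ∈ Set.Icc a b := ⟨hab, le_rfl⟩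
  have hfpos : ∀ s, 0 < f s := fun s => norm_pos_iff.2 (Complex.exp_ne_zero _)
  have hLmono : MonotoneOn L (Set.Icc a b) := fun s hs t ht hst => by
    have := (norm_nonneg _).trans (hL s hs t ht hst); linarith
  have hfa : f a ≤ r / 8 := by
    have h1 := hnorm a ha
    have h2 : δ⁻¹ * f a ^ (N + 1) ≤ 1 := by
      rw [← h1]; exact mul_le_mul_of_nonneg_right hya (by have := hfpos a; positivity)
    have h3 : f a ^ (N + 1) ≤ (r / 8) ^ (N + 1) := by
      refine le_trans ?_ hδ2
      rwa [inv_mul_le_iff₀ hδ0, mul_one] at h2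
    exact le_of_pow_le_pow_left₀ (Nat.succ_ne_zero N) (by positivity) h3
  -- the chord hypotheses on sub-intervals
  have hHv : ∀ s ∈ Set.Icc a b, ‖Ham M N α y₁ y₂ (γ s)‖ * f s ^ ((M + 1) * (N + 1)) ≤ κ := by
    intro s hs
    calc _ ≤ κ * ‖y₁ (γ s)‖ ^ (M + 1) * f s ^ ((M + 1) * (N + 1)) :=
          mul_le_mul_of_nonneg_right (hall s hs).2.2.2 (by have := hfpos s; positivity)
      _ = κ * (‖y₁ (γ s)‖ * f s ^ (N + 1)) ^ (M + 1) := by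
          rw [mul_comm (M + 1) (N + 1), pow_mul, mul_pow]; ring
      _ = κ := by rw [hnorm s hs]; simp
  have hsub : ∀ t ∈ Set.Icc a b, (∀ s ∈ Set.Icc a t, f s < r) → _ := fun t ht hfr =>
    hmain U y₁ y₂ S γ lam L a t ht.1 (hγ.mono (Set.Icc_subset_Icc_right ht.2)) hlam.continuousOn
      (fun s hs t' ht' => hL s ⟨hs.1, hs.2.trans ht.2⟩ t' ⟨ht'.1, ht'.2.trans ht.2⟩)
      (fun s hs => (hall s ⟨hs.1, hs.2.trans ht.2⟩).1)
      (fun s hs => hlamv s ⟨hs.1, hs.2.trans ht.2⟩)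
      (fun s hs => ⟨hfr s hs, (hall s ⟨hs.1, hs.2.trans ht.2⟩).2.2.1.trans_le hδ1, hHv s ⟨hs.1, hs.2.trans ht.2⟩⟩)
  have hsmall : ∀ t ∈ Set.Icc a b, f t < r := by
    by_contra hcon
    push Not at hcon
    obtain ⟨t, ht, htr⟩ := hcon
    have hivt : ∀ t ∈ Set.Icc a b, r / 2 ≤ f t → ∃ c ∈ Set.Icc a t, f c = r / 2 := fun t ht htr => by
      obtain ⟨c, hc, hc2⟩ := intermediate_value_Icc ht.1 hfc.continuousOn ⟨(by linarith : f a ≤ r / 2), htr⟩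
      exact ⟨c, hc, hc2⟩
    have hcomp : IsCompact (Set.Icc a b ∩ f ⁻¹' {r / 2}) := isCompact_Icc.inter_right (isClosed_singleton.preimage hfc)
    obtain ⟨c, hc, hc2⟩ := hivt t ht (by linarith)
    obtain ⟨t₀, ⟨ht₀, hft₀⟩, hleast⟩ := hcomp.exists_isLeast ⟨c, ⟨hc.1, hc.2.trans ht.2⟩, hc2⟩
    have hft₀' : f t₀ = r / 2 := hft₀
    have hlt : ∀ s ∈ Set.Icc a t₀, f s < r := by
      intro s hs
      by_contra hge
      push Not at hge
      rcases eq_or_lt_of_le hs.2 with h | h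
      · rw [h, hft₀'] at hge; linarith
      · obtain ⟨c, hc, hc2⟩ := hivt s ⟨hs.1, hs.2.trans ht₀.2⟩ (by linarith)
        have : t₀ ≤ c := hleast ⟨⟨hc.1, hc.2.trans (hs.2.trans ht₀.2)⟩, hc2⟩
        linarith [hc.2]
    have h1 := (hsub t₀ ht₀ hlt).1 a ⟨le_rfl, ht₀.1⟩ t₀ ⟨ht₀.1, le_rfl⟩
    have h1' : f t₀ ^ τ ≤ 1.1 * f a ^ τ + 2 * τ * ‖γ t₀ - γ a‖ := h1
    rw [hft₀'] at h1'
    have h2 : f a ^ τ ≤ (r / 2) ^ τ / 4 := by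
      calc f a ^ τ ≤ (r / 8) ^ τ := pow_le_pow_left₀ (hfpos a).le hfa _
        _ = (r / 2) ^ τ * (1 / 4) ^ τ := by rw [← mul_pow]; congr 1; ring
        _ ≤ (r / 2) ^ τ * (1 / 4) ^ 1 := by
            refine mul_le_mul_of_nonneg_left (pow_le_pow_of_le_one (by norm_num) (by norm_num) hτ1) (by positivity)
        _ = _ := by ring
    have h3 : ‖γ t₀ - γ a‖ ≤ δ := by
      refine (hL a ha t₀ ht₀ ht₀.1).trans ?_
      have := hLmono ht₀ hb ht₀.2
      linarith
    have h4 : 2 * τ * ‖γ t₀ - γ a‖ ≤ (r / 2) ^ τ / 4 := by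
      calc 2 * τ * ‖γ t₀ - γ a‖ ≤ 2 * τ * ((r / 2) ^ τ / (8 * τ)) := by gcongr; exact h3.trans hδ3
        _ = _ := by field_simp; norm_num
    have h5 : 0 < (r / 2) ^ τ := by positivity
    linarith
  have hfin := (hsub b hb hsmall).2 w⁻¹ (by positivity)
  have hwv : ∀ s ∈ Set.Icc a b, ‖y₁ (γ s)‖ ≤ w ^ (N + 1) → w⁻¹ ≤ f s := by
    intro s hs h
    have h1 := hnorm s hs
    have h2 : 1 ≤ w ^ (N + 1) * f s ^ (N + 1) := by
      rw [← h1]; exact mul_le_mul_of_nonneg_right h (by have := hfpos s; positivity)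
    rw [← mul_pow] at h2
    have h3 : 1 ≤ w * f s := by
      by_contra hlt
      push Not at hlt
      have := pow_lt_one₀ (by have := hfpos s; positivity) hlt (Nat.succ_ne_zero N)
      exact absurd h2 (not_le.2 this)
    rwa [inv_le_iff_one_le_mul₀' hw]
  have h := hfin (hwv a ha hwa) (hwv b hb hwb)
  rwa [inv_inv] at h

end SCM

namespace SCM
open Asymptotics

theorem exists_scale (M N : ℕ) (a b : ℝ) (ha : 0 ≤ a) (hb : 0 ≤ b) :
    ∃ ξ : ℝ, 1 ≤ ξ ∧ a ≤ ξ ^ (N + 1) ∧ b ≤ ξ ^ (M + 1) ∧ ξ ^ ((M + 1) * (N + 1)) = 1 + a ^ (M + 1) + b ^ (N + 1) := by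
  have hD : (M + 1) * (N + 1) ≠ 0 := by positivity
  have hX : 1 ≤ 1 + a ^ (M + 1) + b ^ (N + 1) := by
    have := pow_nonneg ha (M + 1)
    have := pow_nonneg hb (N + 1)
    linarith
  have hX0 : 0 ≤ 1 + a ^ (M + 1) + b ^ (N + 1) := by linarith
  set ξ := (1 + a ^ (M + 1) + b ^ (N + 1)) ^ (((((M + 1) * (N + 1) : ℕ) : ℝ))⁻¹) with hξ
  have hξD : ξ ^ ((M + 1) * (N + 1)) = 1 + a ^ (M + 1) + b ^ (N + 1) := Real.rpow_inv_natCast_pow hX0 hD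
  have hξ0 : 0 ≤ ξ := Real.rpow_nonneg hX0 _
  refine ⟨ξ, Real.one_le_rpow hX (by positivity), ?_, ?_, hξD⟩
  · refine le_of_pow_le_pow_left₀ (Nat.succ_ne_zero M) (by positivity) ?_
    rw [← pow_mul, mul_comm (N + 1), Nat.succ_eq_add_one, hξD]
    have := pow_nonneg hb (N + 1)
    linarith
  · refine le_of_pow_le_pow_left₀ (Nat.succ_ne_zero N) (by positivity) ?_
    rw [← pow_mul, Nat.succ_eq_add_one, hξD]
    have := pow_nonneg ha (M + 1)
    linarith

theorem exists_root (D : ℕ) (hD : D ≠ 0) (h : ℝ) (hh : 1 ≤ h) : ∃ χ : ℝ, 1 ≤ χ ∧ χ ^ D = h :=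
  ⟨h ^ ((D : ℝ)⁻¹), Real.one_le_rpow hh (by positivity), Real.rpow_inv_natCast_pow (by linarith) hD⟩

theorem mono_bound {M N : ℕ} {y₁ y₂ : ℂ} {ξ : ℝ} (h1 : 1 ≤ ξ) (ha : ‖y₁‖ ≤ ξ ^ (N + 1)) (hb : ‖y₂‖ ≤ ξ ^ (M + 1))
    (c : ℕ × ℕ → ℂ) {A : ℝ} (hA : ∑ p ∈ idxI' M N, ‖c p‖ ≤ A) :
    ‖∑ p ∈ idxI' M N, c p * y₁ ^ p.1 * y₂ ^ p.2‖ ≤ A * ξ ^ ((M + 1) * (N + 1) - 1) := by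
  calc _ ≤ ∑ p ∈ idxI' M N, ‖c p‖ * ξ ^ ((M + 1) * (N + 1) - 1) := by
        refine norm_sum_le_of_le _ fun p hp => ?_
        obtain ⟨e1, e2, _⟩ := dg_spec hp
        rw [norm_mul, norm_mul, norm_pow, norm_pow, mul_assoc]
        refine mul_le_mul_of_nonneg_left ?_ (norm_nonneg _)
        calc ‖y₁‖ ^ p.1 * ‖y₂‖ ^ p.2 ≤ (ξ ^ (N + 1)) ^ p.1 * (ξ ^ (M + 1)) ^ p.2 := by gcongr
          _ = ξ ^ (p.1 * (N + 1) + p.2 * (M + 1)) := by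
              rw [pow_add ξ (p.1 * (N + 1)), mul_comm p.1, mul_comm p.2, pow_mul, pow_mul]
          _ ≤ _ := pow_le_pow_right₀ h1 (by omega)
    _ ≤ _ := by
        rw [← Finset.sum_mul]
        exact mul_le_mul_of_nonneg_right hA (by positivity)

theorem Ham_sub {M N : ℕ} {α : ℕ × ℕ → ℂ → ℂ} {y₁ y₂ : ℂ → ℂ} {z : ℂ} {ξ A : ℝ} (h1 : 1 ≤ ξ) (ha : ‖y₁ z‖ ≤ ξ ^ (N + 1)) (hb : ‖y₂ z‖ ≤ ξ ^ (M + 1))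
    (hA : ∑ p ∈ idxI' M N, ‖α p z‖ ≤ A) :
    ‖y₂ z‖ ^ (N + 1) ≤ ‖Ham M N α y₁ y₂ z‖ + ‖y₁ z‖ ^ (M + 1) + A * ξ ^ ((M + 1) * (N + 1) - 1) := by
  have h := mono_bound (y₁ := y₁ z) (y₂ := y₂ z) h1 ha hb (fun p => α p z) hA
  have e : y₂ z ^ (N + 1) = Ham M N α y₁ y₂ z - y₁ z ^ (M + 1) - ∑ p ∈ idxI' M N, α p z * y₁ z ^ p.1 * y₂ z ^ p.2 := by
    simp only [Ham]; ring
  rw [← norm_pow, ← norm_pow, e]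
  exact (norm_sub_le _ _).trans (add_le_add (norm_sub_le _ _) h)

/-- in the good region the derivative of the Hamiltonian is controlled -/
theorem good_deriv {M N : ℕ} (α : ℕ × ℕ → ℂ → ℂ) {A κ : ℝ} (hA : 0 < A) (hκ : 0 < κ) :
    ∃ C > 0, ∀ (y₁ y₂ : ℂ → ℂ) (z : ℂ) (χ : ℝ), 1 ≤ χ →
      ∑ p ∈ idxI' M N, ‖α p z‖ ≤ A → ∑ p ∈ idxI' M N, ‖deriv (α p) z‖ ≤ A →
      κ * ‖y₁ z‖ ^ (M + 1) ≤ ‖Ham M N α y₁ y₂ z‖ → ‖Ham M N α y₁ y₂ z‖ ≤ 2 * χ ^ ((M + 1) * (N + 1)) →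
      ‖dHam M N α y₁ y₂ z‖ < C * χ ^ ((M + 1) * (N + 1) - 1) := by
  set D := (M + 1) * (N + 1) with hD
  have hDpos : D ≠ 0 := by rw [hD]; positivity
  set G := 2 * (1 + 2 * (1 + 2 / κ)) with hG
  set C' := max (2 * A) G with hC'
  have hG1 : 1 ≤ G := by rw [hG]; have : 0 < 2 / κ := by positivity
                         linarith
  have hC'0 : 1 ≤ C' := hG1.trans (le_max_right _ _)
  refine ⟨A * C' ^ (D - 1) + 1, by positivity, ?_⟩
  intro y₁ y₂ z χ hχ hA1 hA2 hK hH
  obtain ⟨ξ, x1, x2, x3, x4⟩ := exists_scale M N ‖y₁ z‖ ‖y₂ z‖ (norm_nonneg _) (norm_nonneg _)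
  have hd : ‖dHam M N α y₁ y₂ z‖ ≤ A * ξ ^ (D - 1) := mono_bound x1 x2 x3 (fun p => deriv (α p) z) hA2
  have hs := Ham_sub (α := α) x1 x2 x3 hA1
  rw [← hD] at hs x4
  have hξC : ξ ≤ C' * χ := by
    rcases le_or_gt ξ (2 * A) with h | h
    · calc ξ ≤ C' := h.trans (le_max_left _ _)
        _ ≤ C' * χ := le_mul_of_one_le_right (by linarith) hχ
    · have e1 : A * ξ ^ (D - 1) ≤ ξ ^ D / 2 := by
        have : ξ ^ D = ξ * ξ ^ (D - 1) := by rw [← pow_succ']; congr 1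
        rw [this]
        have hp : 0 < ξ ^ (D - 1) := by positivity
        nlinarith
      have e2 : ‖y₁ z‖ ^ (M + 1) ≤ ‖Ham M N α y₁ y₂ z‖ / κ := by rw [le_div_iff₀ hκ, mul_comm]; exact hK
      have e3 : ‖Ham M N α y₁ y₂ z‖ / κ ≤ 2 * χ ^ D / κ := by gcongr
      have e4 : 1 ≤ χ ^ D := one_le_pow₀ hχ
      have e5 : ξ ^ D ≤ G * χ ^ D := by
        have e6 : 2 * χ ^ D / κ = 2 / κ * χ ^ D := by ring
        have e7 : G * χ ^ D = 2 * (χ ^ D + 2 * χ ^ D + 2 * (2 / κ * χ ^ D)) := by rw [hG]; ring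
        rw [e7, ← e6]
        linarith
      have e8 : ξ ^ D ≤ (G * χ) ^ D := by
        rw [mul_pow]
        refine e5.trans (mul_le_mul_of_nonneg_right ?_ (by positivity))
        exact le_self_pow₀ hG1 hDpos
      have e9 : ξ ≤ G * χ := le_of_pow_le_pow_left₀ hDpos (by positivity) e8
      exact e9.trans (mul_le_mul_of_nonneg_right (le_max_right _ _) (by linarith))
  calc ‖dHam M N α y₁ y₂ z‖ ≤ A * (C' * χ) ^ (D - 1) := by
        refine hd.trans ?_; gcongr
    _ = A * C' ^ (D - 1) * χ ^ (D - 1) := by rw [mul_pow]; ring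
    _ < _ := mul_lt_mul_of_pos_right (by linarith) (by positivity)

end SCM

namespace SCM
open Asymptotics

theorem le_end {f g : ℝ → ℝ} {a b t t' x : ℝ} (hf : ContinuousOn f (Set.Icc a b)) (hg : ContinuousOn g (Set.Icc a b))
    (h1 : a ≤ t) (h2 : t < t') (h3 : t' ≤ b) (h : ∀ x, t < x → x < t' → f x ≤ g x) (hx : x ∈ Set.Icc t t') : f x ≤ g x := by
  have hsub : Set.Icc t t' ⊆ Set.Icc a b := Set.Icc_subset_Icc h1 h3
  have hcl : closure (Set.Ioo t t') = Set.Icc t t' := closure_Ioo h2.ne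
  refine le_on_closure (s := Set.Ioo t t') (fun y hy => h y hy.1 hy.2) ?_ ?_ (by rw [hcl]; exact hx)
  · rw [hcl]; exact hf.mono hsub
  · rw [hcl]; exact hg.mono hsub

set_option maxHeartbeats 1000000 in
theorem claim {M N : ℕ} (hM : 2 ≤ M) (hN : 2 ≤ N) {α : ℕ × ℕ → ℂ → ℂ} {z₀ : ℂ}
    (hα : ∀ p ∈ idxI' M N, AnalyticAt ℂ (α p) z₀) :
    ∃ κ > 0, ∃ δ > 0, ∃ X : ℝ, ∀ (U : Set ℂ) (y₁ y₂ : ℂ → ℂ), Sys M N α U y₁ y₂ →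
      ∀ (γ : ℝ → ℂ) (L : ℝ → ℝ) (a b : ℝ), a ≤ b →
      ContinuousOn γ (Set.Icc a b) →
      (∀ s ∈ Set.Icc a b, ∀ t ∈ Set.Icc a b, s ≤ t → ‖γ t - γ s‖ ≤ L t - L s) →
      (∀ s ∈ Set.Icc a b, γ s ∈ U ∧ y₁ (γ s) ≠ 0 ∧ ‖γ s - z₀‖ < δ) →
      L b - L a ≤ δ → κ * ‖y₁ (γ a)‖ ^ (M + 1) ≤ ‖Ham M N α y₁ y₂ (γ a)‖ →
      κ * ‖y₁ (γ b)‖ ^ (M + 1) ≤ ‖Ham M N α y₁ y₂ (γ b)‖ → X ≤ ‖Ham M N α y₁ y₂ (γ a)‖ →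
      ‖Ham M N α y₁ y₂ (γ b) - Ham M N α y₁ y₂ (γ a)‖ ≤ ‖Ham M N α y₁ y₂ (γ a)‖ / 2 := by
  obtain ⟨κ, hκ, δ₀, hδ₀, K, hK, hgapC⟩ := gapChord hM hN hα
  obtain ⟨A₁, hA₁, r₁, hr₁, hA₁b⟩ := coeff_bound (idxI' M N) α z₀ (fun p hp => (hα p hp).continuousAt)
  obtain ⟨A₂, hA₂, r₂, hr₂, hA₂b⟩ := coeff_bound (idxI' M N) (fun p => deriv (α p)) z₀ (fun p hp => (hα p hp).deriv.continuousAt)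
  obtain ⟨C₁, hC₁, hgood⟩ := good_deriv (M := M) (N := N) α (A := max A₁ A₂) (lt_max_of_lt_left hA₁) hκ
  set D := (M + 1) * (N + 1) with hD
  have hDpos : D ≠ 0 := by rw [hD]; positivity
  have hDs : D - 1 + 1 = D := by omega
  set C₃ := max 1 (4 / κ) with hC₃
  have hC₃1 : 1 ≤ C₃ := le_max_left _ _
  set C := max C₁ (K * C₃ ^ (D - 1)) with hC
  have hC0 : 0 < C := lt_max_of_lt_left hC₁
  set δ := min (min δ₀ (min r₁ r₂)) (min (1 / (2 * C)) (κ / (4 * K))) with hδ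
  have hδp : 0 < δ := by rw [hδ]; positivity
  have hδ0 : δ ≤ δ₀ := (min_le_left _ _).trans (min_le_left _ _)
  have hδ1 : δ ≤ r₁ := (min_le_left _ _).trans ((min_le_right _ _).trans (min_le_left _ _))
  have hδ2 : δ ≤ r₂ := (min_le_left _ _).trans ((min_le_right _ _).trans (min_le_right _ _))
  have hδ3 : δ ≤ 1 / (2 * C) := (min_le_right _ _).trans (min_le_left _ _)
  have hδ4 : δ ≤ κ / (4 * K) := (min_le_right _ _).trans (min_le_right _ _)
  refine ⟨κ, hκ, δ, hδp, max (max 1 κ) (2 * κ * (δ₀⁻¹) ^ (M + 1)), ?_⟩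
  intro U y₁ y₂ S γ L a b hab hγ hL hall hlen hKa hKb hX
  set H := Ham M N α y₁ y₂ with hH
  have hX1 : 1 ≤ ‖H (γ a)‖ := ((le_max_left _ _).trans (le_max_left _ _)).trans hX
  have hX2 : κ ≤ ‖H (γ a)‖ := ((le_max_right _ _).trans (le_max_left _ _)).trans hX
  have hX3 : 2 * κ * (δ₀⁻¹) ^ (M + 1) ≤ ‖H (γ a)‖ := (le_max_right _ _).trans hX
  obtain ⟨χ, hχ1, hχD⟩ := exists_root D hDpos _ hX1
  have hLmono : MonotoneOn L (Set.Icc a b) := fun s hs t ht hst => by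
    have := (norm_nonneg _).trans (hL s hs t ht hst); linarith
  have ha : a ∈ Set.Icc a b := ⟨le_rfl, hab⟩
  have hb : b ∈ Set.Icc a b := ⟨hab, le_rfl⟩
  have hHd : ∀ t ∈ Set.Icc a b, HasDerivAt H (dHam M N α y₁ y₂ (γ t)) (γ t) := fun t ht =>
    Ham_deriv (fun p hp => S.hα p hp _ (hall t ht).1) (S.h1 _ (hall t ht).1) (S.h2 _ (hall t ht).1)
  have hHc : ContinuousOn (fun s => H (γ s)) (Set.Icc a b) := fun t ht =>
    ContinuousAt.comp_continuousWithinAt (g := H) (hHd t ht).continuousAt (hγ t ht)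
  have hyc : ContinuousOn (fun s => κ * ‖y₁ (γ s)‖ ^ (M + 1)) (Set.Icc a b) := fun t ht =>
    continuousWithinAt_const.mul
      ((ContinuousAt.comp_continuousWithinAt (g := y₁) (S.h1 _ (hall t ht).1).continuousAt (hγ t ht)).norm.pow _)
  set CC := C * χ ^ (D - 1) with hCC
  have hCC0 : 0 ≤ CC := by positivity
  have hlent : ∀ t ∈ Set.Icc a b, CC * (L t - L a) ≤ ‖H (γ a)‖ / 2 := by
    intro t ht
    have h1 : L t - L a ≤ 1 / (2 * C) := by
      have := hLmono ht hb ht.2; linarith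
    have h0 : 0 ≤ L t - L a := by have := hLmono ha ht ht.1; linarith
    calc CC * (L t - L a) ≤ C * χ ^ D * (1 / (2 * C)) := by
          rw [hCC]
          refine mul_le_mul (mul_le_mul_of_nonneg_left (pow_le_pow_right₀ hχ1 (by omega)) hC0.le) h1 h0 (by positivity)
      _ = ‖H (γ a)‖ / 2 := by rw [hχD]; field_simp
  have hnear : ∀ t ∈ Set.Icc a b, ‖H (γ t) - H (γ a)‖ ≤ CC * (L t - L a) →
      ‖H (γ t)‖ ≤ 3 / 2 * χ ^ D ∧ χ ^ D / 2 ≤ ‖H (γ t)‖ := by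
    intro t ht h
    have h1 := h.trans (hlent t ht)
    have h2 := norm_sub_norm_le (H (γ t)) (H (γ a))
    have h3 := norm_sub_norm_le (H (γ a)) (H (γ t))
    rw [norm_sub_rev] at h3
    rw [hχD]
    constructor <;> linarith
  have key := gapInduction (H := fun s => H (γ s)) (L := L) (a := a) (b := b) (C := CC)
    (K := {s | κ * ‖y₁ (γ s)‖ ^ (M + 1) ≤ ‖H (γ s)‖}) hHc hLmono hCC0
    (by
      intro t ht htK
      simp only [Set.mem_setOf_eq, not_le] at htK ⊢
      exact (hHc t ht).norm.eventually_lt (hyc t ht) htK) hKa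
    (by
      intro t htK h1 h2 hI
      have ht : t ∈ Set.Icc a b := ⟨h1, h2.le⟩
      have hd := hgood y₁ y₂ (γ t) χ hχ1 ((hA₁b _ ((hall t ht).2.2.trans_le hδ1)).trans (le_max_left _ _))
        ((hA₂b _ ((hall t ht).2.2.trans_le hδ2)).trans (le_max_right _ _)) htK
        (by have := (hnear t ht hI).1; have h0 : 0 < χ ^ D := by positivity
            linarith)
      have hd' : ‖dHam M N α y₁ y₂ (γ t)‖ < CC := hd.trans_le (mul_le_mul_of_nonneg_right (le_max_left _ _) (by positivity))
      filter_upwards [right_of_Icc hγ h1 h2 (deriv_local (hHd t ht) hd')] with t' ⟨u1, u2, u3⟩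
      exact u1.trans (mul_le_mul_of_nonneg_left (hL t ht t' u2 u3.le) hCC0))
    (by
      intro t htK t' htK' h1 h2 h3 hno hI
      have ht : t ∈ Set.Icc a b := ⟨h1, h2.le.trans h3⟩
      have ht' : t' ∈ Set.Icc a b := ⟨h1.trans h2.le, h3⟩
      have hsub : Set.Icc t t' ⊆ Set.Icc a b := Set.Icc_subset_Icc h1 h3
      have hle : ∀ x ∈ Set.Icc t t', ‖H (γ x)‖ ≤ κ * ‖y₁ (γ x)‖ ^ (M + 1) := fun x hx =>
        le_end hHc.norm hyc h1 h2 h3 (fun x hx1 hx2 => (not_le.1 (hno x hx1 hx2)).le) hx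
      have heq : ‖H (γ t)‖ = κ * ‖y₁ (γ t)‖ ^ (M + 1) := le_antisymm (hle t ⟨le_rfl, h2.le⟩) htK
      have heq' : ‖H (γ t')‖ = κ * ‖y₁ (γ t')‖ ^ (M + 1) := le_antisymm (hle t' ⟨h2.le, le_rfl⟩) htK'
      obtain ⟨n1, n2⟩ := hnear t ht hI
      have hlen0 : 0 ≤ L t' - L t := by have := hLmono ht ht' h2.le; linarith
      have hlen1 : L t' - L t ≤ δ := by
        have := hLmono ha ht ht.1
        have := hLmono ht' hb ht'.2
        linarith
      have hyt : δ₀⁻¹ ≤ ‖y₁ (γ t)‖ := by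
        refine le_of_pow_le_pow_left₀ (Nat.succ_ne_zero M) (norm_nonneg _) ?_
        have e1 : 2 * κ * (δ₀⁻¹) ^ (M + 1) ≤ 2 * κ * ‖y₁ (γ t)‖ ^ (M + 1) := by
          rw [mul_assoc 2 κ (‖y₁ (γ t)‖ ^ (M + 1)), ← heq]
          rw [hχD] at n2; linarith
        exact le_of_mul_le_mul_left e1 (by positivity)
      have hg := hgapC U y₁ y₂ S γ L t t' h2.le (hγ.mono hsub) (fun s hs x hx => hL s (hsub hs) x (hsub hx))
        (fun s hs => ⟨(hall s (hsub hs)).1, (hall s (hsub hs)).2.1, (hall s (hsub hs)).2.2.trans_le hδ0, hle s hs⟩)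
        (hlen1.trans hδ0) hyt
      have hconv : ∀ (y w : ℝ), 0 ≤ w → y ^ (M + 1) ≤ w ^ D → y ≤ w ^ (N + 1) := by
        intro y w hw h
        refine le_of_pow_le_pow_left₀ (Nat.succ_ne_zero M) (by positivity) ?_
        rw [← pow_mul, mul_comm (N + 1)]
        exact h
      have hyH : ‖y₁ (γ t)‖ ^ (M + 1) = ‖H (γ t)‖ / κ := by rw [heq]; field_simp
      have hyH' : ‖y₁ (γ t')‖ ^ (M + 1) = ‖H (γ t')‖ / κ := by rw [heq']; field_simp
      rcases le_or_gt ‖H (γ t')‖ (4 * χ ^ D) with hcase | hcase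
      · have hw : 4 * χ ^ D / κ ≤ (C₃ * χ) ^ D := by
          rw [mul_pow]
          calc 4 * χ ^ D / κ = 4 / κ * χ ^ D := by ring
            _ ≤ C₃ * χ ^ D := mul_le_mul_of_nonneg_right (le_max_right _ _) (by positivity)
            _ ≤ C₃ ^ D * χ ^ D := mul_le_mul_of_nonneg_right (le_self_pow₀ hC₃1 hDpos) (by positivity)
        have hχD0 : 0 < χ ^ D := by positivity
        have hw0 : 0 < C₃ * χ := by positivity
        have g1 := hg (C₃ * χ) hw0 (hconv _ _ hw0.le (by
            rw [hyH]; refine le_trans ?_ hw; gcongr; linarith)) (hconv _ _ hw0.le (by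
            rw [hyH']; refine le_trans ?_ hw; gcongr))
        calc ‖H (γ t') - H (γ t)‖ ≤ K * ((C₃ * χ) ^ (D - 1) * (L t' - L t)) := g1
          _ = K * C₃ ^ (D - 1) * χ ^ (D - 1) * (L t' - L t) := by rw [mul_pow]; ring
          _ ≤ _ := by
              refine mul_le_mul_of_nonneg_right (mul_le_mul_of_nonneg_right (le_max_right _ _) (by positivity)) hlen0
      · exfalso
        have hχD0 : 0 < χ ^ D := by positivity
        have hb1 : 1 ≤ ‖H (γ t')‖ / κ := by
          rw [le_div_iff₀ hκ, one_mul]; rw [hχD] at hcase; linarith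
        obtain ⟨w, hw1, hwD⟩ := exists_root D hDpos _ hb1
        have hw0 : 0 < w := by linarith
        have g1 := hg w hw0 (hconv _ _ hw0.le (by
            rw [hyH, hwD]; gcongr; linarith)) (hconv _ _ hw0.le (by rw [hyH', hwD]))
        have g2 : K * (w ^ (D - 1) * (L t' - L t)) ≤ ‖H (γ t')‖ / 4 := by
          calc K * (w ^ (D - 1) * (L t' - L t)) ≤ K * (w ^ D * (κ / (4 * K))) := by
                refine mul_le_mul_of_nonneg_left (mul_le_mul (pow_le_pow_right₀ hw1 (by omega)) (hlen1.trans hδ4) hlen0 (by positivity)) hK.le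
            _ = ‖H (γ t')‖ / 4 := by rw [hwD]; field_simp
        have g3 := norm_sub_norm_le (H (γ t')) (H (γ t))
        have g4 : ‖H (γ t') - H (γ t)‖ ≤ ‖H (γ t')‖ / 4 := g1.trans g2
        linarith)
    b hKb hab le_rfl
  exact key.trans (hlent b hb)

end SCM

namespace SCM
open Asymptotics

theorem bad_ham {M N : ℕ} (α : ℕ × ℕ → ℂ → ℂ) {A c : ℝ} (hA : 0 < A) (hc : 0 < c) (κ Y : ℝ) :
    ∃ u₀ : ℝ, ∀ (y₁ y₂ : ℂ → ℂ) (z : ℂ), ∑ p ∈ idxI' M N, ‖α p z‖ ≤ A → c ≤ ‖y₁ z‖ ^ (M + 1) →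
      u₀ * ‖y₁ z‖ ^ (M + 1) ≤ ‖y₂ z‖ ^ (N + 1) →
      κ * ‖y₁ z‖ ^ (M + 1) ≤ ‖Ham M N α y₁ y₂ z‖ ∧ Y ≤ ‖Ham M N α y₁ y₂ z‖ := by
  set D := (M + 1) * (N + 1) with hD
  have hDpos : D ≠ 0 := by rw [hD]; positivity
  have hDs : D - 1 + 1 = D := by omega
  refine ⟨8 + 8 / c + (8 * A) ^ D / c + 2 * |κ| + 2 * |Y| / c, ?_⟩
  intro y₁ y₂ z hs hp hq
  obtain ⟨ξ, hξ1, hξa, hξb, hξD⟩ := exists_scale M N ‖y₁ z‖ ‖y₂ z‖ (norm_nonneg _) (norm_nonneg _)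
  have hsub := Ham_sub hξ1 hξa hξb hs
  rw [← hD] at hξD hsub
  set p := ‖y₁ z‖ ^ (M + 1)
  set q := ‖y₂ z‖ ^ (N + 1)
  set h := ‖Ham M N α y₁ y₂ z‖
  have hp0 : 0 < p := hc.trans_le hp
  have key : ∀ x : ℝ, 0 ≤ x → x ≤ x / c * p := by
    intro x hx
    have : x / c * c ≤ x / c * p := mul_le_mul_of_nonneg_left hp (by positivity)
    rwa [div_mul_cancel₀ _ hc.ne'] at this
  have k1 := key 8 (by norm_num)
  have k2 := key ((8 * A) ^ D) (by positivity)
  have k3 := key (2 * |Y|) (by positivity)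
  have k4 : 0 ≤ |κ| * p := by positivity
  have hY0 := abs_nonneg Y
  have hAD : 0 ≤ (8 * A) ^ D := by positivity
  have hexp : 8 * p + 8 / c * p + (8 * A) ^ D / c * p + 2 * (|κ| * p) + 2 * |Y| / c * p ≤ q := by
    refine le_trans (le_of_eq ?_) hq
    ring
  have hξA : 8 * A ≤ ξ := by
    refine le_of_pow_le_pow_left₀ hDpos (by linarith) ?_
    rw [hξD]; linarith
  have h8 : A * ξ ^ (D - 1) ≤ ξ ^ D / 8 := by
    have e : ξ ^ D = ξ ^ (D - 1) * ξ := by rw [← pow_succ, hDs]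
    have : 0 ≤ ξ ^ (D - 1) := by positivity
    rw [e]; nlinarith
  have hh : q / 2 ≤ h := by linarith
  constructor
  · have : κ * p ≤ |κ| * p := mul_le_mul_of_nonneg_right (le_abs_self κ) hp0.le
    linarith
  · have := le_abs_self Y
    linarith

theorem var_fun {γ : ℝ → ℂ} (hlen : eVariationOn γ (Set.Icc 0 1) ≠ ⊤) {δ : ℝ} (hδ : 0 < δ) :
    ∃ L : ℝ → ℝ, (∀ s ∈ Set.Icc (0 : ℝ) 1, ∀ t ∈ Set.Icc (0 : ℝ) 1, s ≤ t → ‖γ t - γ s‖ ≤ L t - L s) ∧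
      ∃ s₀, 0 ≤ s₀ ∧ s₀ < 1 ∧ ∀ a b, s₀ ≤ a → a ≤ b → b < 1 → L b - L a ≤ δ := by
  have hloc : LocallyBoundedVariationOn γ (Set.Icc 0 1) :=
    BoundedVariationOn.locallyBoundedVariationOn hlen
  have h0 : (0 : ℝ) ∈ Set.Icc (0 : ℝ) 1 := by simp
  have h1 : (1 : ℝ) ∈ Set.Icc (0 : ℝ) 1 := by simp
  set L := variationOnFromTo γ (Set.Icc 0 1) 0 with hL
  have hmono : MonotoneOn L (Set.Icc 0 1) := variationOnFromTo.monotoneOn hloc h0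
  refine ⟨L, ?_, ?_⟩
  · intro s hs t ht hst
    have hadd := variationOnFromTo.add hloc h0 hs ht
    have : L t - L s = variationOnFromTo γ (Set.Icc 0 1) s t := by rw [hL]; linarith
    rw [this, variationOnFromTo.eq_of_le _ _ hst]
    have hfin : eVariationOn γ (Set.Icc 0 1 ∩ Set.Icc s t) ≠ ⊤ := hloc s t hs ht
    rw [← dist_eq_norm, dist_edist]
    exact ENNReal.toReal_mono hfin (eVariationOn.edist_le γ ⟨ht, hst, le_rfl⟩ ⟨hs, le_rfl, hst⟩)
  · have hne : (L '' Set.Ico 0 1).Nonempty := ⟨L 0, 0, by simp, rfl⟩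
    have hbd : BddAbove (L '' Set.Ico 0 1) := by
      refine ⟨L 1, ?_⟩
      rintro _ ⟨x, hx, rfl⟩
      exact hmono ⟨hx.1, hx.2.le⟩ h1 hx.2.le
    obtain ⟨_, ⟨s₀, hs₀, rfl⟩, hs⟩ := exists_lt_of_lt_csSup hne (show sSup (L '' Set.Ico 0 1) - δ < _ by linarith)
    refine ⟨s₀, hs₀.1, hs₀.2, fun a b ha hab hb => ?_⟩
    have e1 : L b ≤ sSup (L '' Set.Ico 0 1) := le_csSup hbd ⟨b, ⟨by linarith [hs₀.1], hb⟩, rfl⟩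
    have e2 : L s₀ ≤ L a := hmono ⟨hs₀.1, hs₀.2.le⟩ ⟨by linarith [hs₀.1], by linarith⟩ ha
    linarith

theorem ratio_bdd {M N : ℕ} (hM : 2 ≤ M) (hN : 2 ≤ N) {α : ℕ × ℕ → ℂ → ℂ} {γ : ℝ → ℂ}
    (hα : ∀ p ∈ idxI' M N, AnalyticAt ℂ (α p) (γ 1)) (hγc : ContinuousOn γ (Set.Icc 0 1))
    (hlen : eVariationOn γ (Set.Icc 0 1) ≠ ⊤) {U : Set ℂ} {y₁ y₂ : ℂ → ℂ} (hS : Sys M N α U y₁ y₂)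
    (hγU : ∀ s ∈ Set.Ico (0 : ℝ) 1, γ s ∈ U) {m : ℝ} (hm : 0 < m)
    (hy : ∀ s ∈ Set.Ico (0 : ℝ) 1, m ≤ ‖y₁ (γ s)‖) :
    ∃ C : ℝ, ∀ s ∈ Set.Ico (0 : ℝ) 1, ‖y₂ (γ s)‖ ^ (N + 1) ≤ C * ‖y₁ (γ s)‖ ^ (M + 1) := by
  obtain ⟨κ, hκ, δ, hδ, X, hclaim⟩ := claim hM hN hα
  obtain ⟨A, hA, r, hr, hAb⟩ := coeff_bound (idxI' M N) α (γ 1) (fun p hp => (hα p hp).continuousAt)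
  obtain ⟨L, hL, s₀, hs₀, hs₀1, hL2⟩ := var_fun hlen hδ
  have hρ : 0 < min δ r := lt_min hδ hr
  obtain ⟨η, hη, hηb⟩ := Metric.continuousWithinAt_iff.1 (hγc 1 (by simp)) _ hρ
  set s₁ := max s₀ (1 - η / 2) with hs₁
  have hs₁0 : 0 ≤ s₁ := hs₀.trans (le_max_left _ _)
  have hs₁1 : s₁ < 1 := max_lt hs₀1 (by linarith)
  have hnear : ∀ s, s₁ ≤ s → s < 1 → ‖γ s - γ 1‖ < min δ r := by
    intro s h h'
    rw [← dist_eq_norm]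
    refine hηb ⟨hs₁0.trans h, h'.le⟩ ?_
    rw [Real.dist_eq, abs_lt]
    have := (le_max_right s₀ (1 - η / 2)).trans h
    constructor <;> linarith
  have hcpt : ∀ a, 0 ≤ a → a < 1 → ∃ C : ℝ, ∀ s ∈ Set.Icc 0 a, ‖y₂ (γ s)‖ ^ (N + 1) ≤ C * ‖y₁ (γ s)‖ ^ (M + 1) := by
    intro a ha ha1
    have hc : ContinuousOn (fun s => y₂ (γ s)) (Set.Icc 0 a) := by
      intro s hs
      exact (hS.h2 _ (hγU s ⟨hs.1, by linarith [hs.2]⟩)).continuousAt.comp_continuousWithinAt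
        ((hγc s ⟨hs.1, by linarith [hs.2]⟩).mono (Set.Icc_subset_Icc_right ha1.le))
    obtain ⟨C, hC⟩ := isCompact_Icc.exists_bound_of_continuousOn hc
    have hmp : 0 < m ^ (M + 1) := by positivity
    refine ⟨C ^ (N + 1) / m ^ (M + 1), fun s hs => ?_⟩
    have hCs := hC s hs
    have hC0 : 0 ≤ C := (norm_nonneg _).trans hCs
    have e1 : ‖y₂ (γ s)‖ ^ (N + 1) ≤ C ^ (N + 1) := pow_le_pow_left₀ (norm_nonneg _) hCs _
    have e2 : m ^ (M + 1) ≤ ‖y₁ (γ s)‖ ^ (M + 1) := pow_le_pow_left₀ hm.le (hy s ⟨hs.1, by linarith [hs.2]⟩) _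
    have e3 : C ^ (N + 1) / m ^ (M + 1) * m ^ (M + 1) ≤ C ^ (N + 1) / m ^ (M + 1) * ‖y₁ (γ s)‖ ^ (M + 1) :=
      mul_le_mul_of_nonneg_left e2 (by positivity)
    rw [div_mul_cancel₀ _ hmp.ne'] at e3
    exact e1.trans e3
  by_contra hcon
  push Not at hcon
  have hfind : ∀ a, s₁ ≤ a → a < 1 → ∀ Y : ℝ, ∃ b, a ≤ b ∧ b < 1 ∧
      κ * ‖y₁ (γ b)‖ ^ (M + 1) ≤ ‖Ham M N α y₁ y₂ (γ b)‖ ∧ Y ≤ ‖Ham M N α y₁ y₂ (γ b)‖ := by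
    intro a ha ha1 Y
    obtain ⟨u₀, hu₀⟩ := bad_ham (M := M) (N := N) α hA (pow_pos hm (M + 1)) κ Y
    obtain ⟨C, hC⟩ := hcpt a (hs₁0.trans ha) ha1
    obtain ⟨b, hb, hbC⟩ := hcon (max C u₀)
    have hp : 0 ≤ ‖y₁ (γ b)‖ ^ (M + 1) := by positivity
    have hab : a ≤ b := by
      by_contra h
      have e1 := hC b ⟨hb.1, (not_le.1 h).le⟩
      have e2 := mul_le_mul_of_nonneg_right (le_max_left C u₀) hp
      linarith
    have e2 := mul_le_mul_of_nonneg_right (le_max_right C u₀) hp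
    exact ⟨b, hab, hb.2, hu₀ y₁ y₂ (γ b) (hAb _ ((hnear b (ha.trans hab) hb.2).trans_le (min_le_right _ _)))
      (pow_le_pow_left₀ hm.le (hy b hb) _) (e2.trans hbC.le)⟩
  obtain ⟨a, ha, ha1, hka, hXa⟩ := hfind s₁ le_rfl hs₁1 X
  obtain ⟨b, hab, hb1, hkb, hYb⟩ := hfind a ha ha1 (2 * ‖Ham M N α y₁ y₂ (γ a)‖ + 1)
  have hsub : Set.Icc a b ⊆ Set.Icc 0 1 := Set.Icc_subset_Icc (hs₁0.trans ha) hb1.le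
  have := hclaim U y₁ y₂ hS γ L a b hab (hγc.mono hsub)
    (fun s hs t ht hst => hL s (hsub hs) t (hsub ht) hst)
    (fun s hs => by
      have hs' : s ∈ Set.Ico (0 : ℝ) 1 := ⟨(hsub hs).1, by linarith [hs.2]⟩
      exact ⟨hγU s hs', norm_pos_iff.1 (hm.trans_le (hy s hs')),
        (hnear s (ha.trans hs.1) hs'.2).trans_le (min_le_left _ _)⟩)
    (hL2 a b ((le_max_left _ _).trans ha) hab hb1) hka hkb hXa
  have h3 := norm_le_insert' (Ham M N α y₁ y₂ (γ b)) (Ham M N α y₁ y₂ (γ a))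
  have h4 := norm_nonneg (Ham M N α y₁ y₂ (γ a))
  linarith

theorem quot_bdd {M N : ℕ} {m C x y : ℝ} (hm : 0 < m) (hx : m ≤ x) (hy : 0 ≤ y) (h : y ^ (N + 1) ≤ C * x ^ (M + 1))
    {k l : ℕ} (hkl : k * (M + 1) ≤ l * (N + 1)) :
    y ^ k / x ^ l ≤ max 1 (C ^ k / m ^ (l * (N + 1) - k * (M + 1))) := by
  have hx0 : 0 < x := hm.trans_le hx
  have hC : 0 ≤ C := by
    by_contra hC
    have h1 : C * x ^ (M + 1) < 0 := mul_neg_of_neg_of_pos (not_le.1 hC) (by positivity)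
    have h2 : 0 ≤ y ^ (N + 1) := by positivity
    linarith
  rcases le_or_gt (y ^ k / x ^ l) 1 with h1 | h1
  · exact h1.trans (le_max_left _ _)
  refine le_trans ?_ (le_max_right _ _)
  refine (le_self_pow₀ h1.le (Nat.succ_ne_zero N)).trans ?_
  obtain ⟨d, hd⟩ := Nat.exists_eq_add_of_le hkl
  have hd' : l * (N + 1) - k * (M + 1) = d := by omega
  rw [Nat.succ_eq_add_one, hd', div_pow, ← pow_mul, ← pow_mul, hd, mul_comm k (N + 1), pow_mul y, pow_add x (k * (M + 1)) d]
  have e1 : (y ^ (N + 1)) ^ k ≤ (C * x ^ (M + 1)) ^ k := pow_le_pow_left₀ (by positivity) h _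
  have e2 : (C * x ^ (M + 1)) ^ k = C ^ k * x ^ (k * (M + 1)) := by rw [mul_pow, ← pow_mul, mul_comm k]
  have e3 : m ^ d ≤ x ^ d := pow_le_pow_left₀ hm.le hx _
  rw [div_le_div_iff₀ (by positivity) (by positivity)]
  calc (y ^ (N + 1)) ^ k * m ^ d ≤ (C ^ k * x ^ (k * (M + 1))) * x ^ d := by
        rw [← e2]; exact mul_le_mul e1 e3 (by positivity) (by positivity)
    _ = _ := by ring

theorem final {M N : ℕ} (hM : 2 ≤ M) (hN : 2 ≤ N) {α : ℕ × ℕ → ℂ → ℂ} {γ : ℝ → ℂ}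
    (hα : ∀ p ∈ idxI' M N, AnalyticAt ℂ (α p) (γ 1)) (hγc : ContinuousOn γ (Set.Icc 0 1))
    (hlen : eVariationOn γ (Set.Icc 0 1) ≠ ⊤) {U : Set ℂ} {y₁ y₂ : ℂ → ℂ} (hS : Sys M N α U y₁ y₂)
    (hγU : ∀ s ∈ Set.Ico (0 : ℝ) 1, γ s ∈ U) {B : ℝ}
    (hB : ∀ s ∈ Set.Ico (0 : ℝ) 1, ‖(y₁ (γ s))⁻¹‖ ≤ B) (k l : ℕ) (hkl : k * (M + 1) ≤ l * (N + 1)) :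
    ∃ B : ℝ, ∀ s ∈ Set.Ico (0 : ℝ) 1, ‖y₂ (γ s) ^ k / y₁ (γ s) ^ l‖ ≤ B := by
  have hm : 0 < 1 / (|B| + 1) := by positivity
  have hdich : ∀ s ∈ Set.Ico (0 : ℝ) 1, y₁ (γ s) ≠ 0 → 1 / (|B| + 1) ≤ ‖y₁ (γ s)‖ := by
    intro s hs h
    have h1 := hB s hs
    rw [norm_inv] at h1
    have h2 : 0 < ‖y₁ (γ s)‖ := norm_pos_iff.2 h
    rw [one_div]
    refine inv_le_of_inv_le₀ h2 ?_
    linarith [le_abs_self B]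
  have hcont : ContinuousOn (fun s => ‖y₁ (γ s)‖) (Set.Ico 0 1) := by
    intro s hs
    exact ((hS.h1 _ (hγU s hs)).continuousAt.comp_continuousWithinAt
      ((hγc s ⟨hs.1, hs.2.le⟩).mono Set.Ico_subset_Icc_self)).norm
  by_cases hz : ∀ s ∈ Set.Ico (0 : ℝ) 1, y₁ (γ s) ≠ 0
  · obtain ⟨C, hC⟩ := ratio_bdd hM hN hα hγc hlen hS hγU hm (fun s hs => hdich s hs (hz s hs))
    refine ⟨max 1 (C ^ k / (1 / (|B| + 1)) ^ (l * (N + 1) - k * (M + 1))), fun s hs => ?_⟩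
    rw [norm_div, norm_pow, norm_pow]
    exact quot_bdd hm (hdich s hs (hz s hs)) (norm_nonneg _) (hC s hs) hkl
  · push Not at hz
    obtain ⟨s₀, hs₀, hz₀⟩ := hz
    have hall : ∀ s ∈ Set.Ico (0 : ℝ) 1, y₁ (γ s) = 0 := by
      intro s hs
      by_contra hne
      have hb := hdich s hs hne
      have hiv := isPreconnected_Ico.intermediate_value hs₀ hs hcont
      obtain ⟨t, ht, hte⟩ := hiv (show 1 / (|B| + 1) / 2 ∈ _ from ⟨by simp only [hz₀, norm_zero]; positivity, by linarith⟩)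
      simp only at hte
      have hne' : y₁ (γ t) ≠ 0 := by
        rw [← norm_pos_iff, hte]; positivity
      have := hdich t ht hne'
      linarith
    refine ⟨1, fun s hs => ?_⟩
    rw [hall s hs]
    rcases Nat.eq_zero_or_pos l with rfl | hl
    · have : k = 0 := by
        rw [zero_mul] at hkl
        rcases Nat.mul_eq_zero.1 (Nat.le_zero.1 hkl) with h | h <;> omega
      subst this
      simp
    · rw [zero_pow (by omega)]; simp

end SCM

/-- Second curve modification: if `(y₁,y₂)` solves the normalised Hamiltonian system
along a finite-length curve `γ` ending in a movable singularity `z_∞ = γ 1`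
(so the solution cannot be continued analytically to `z_∞`), and `1/y₁`, `1/y₂` are
bounded on `γ`, then after a deformation of `γ` inside the region of analyticity one
obtains a finite-length curve `γ'` with the same endpoint on which `y₂^k/y₁^l` is
bounded for all `k, l ≥ 0` with `l(N+1) − k(M+1) ≥ 0`. -/
theorem second_curve_modification (M N : ℕ) (hM : 2 ≤ M) (hMN : M ≤ N)
    (Ω : Set ℂ) (hΩ : IsOpen Ω)
    (α : ℕ × ℕ → ℂ → ℂ) (hα : ∀ p ∈ idxI' M N, AnalyticOnNhd ℂ (α p) Ω)
    (γ : ℝ → ℂ) (hγc : ContinuousOn γ (Set.Icc 0 1))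
    (hγΩ : γ '' Set.Icc 0 1 ⊆ Ω)
    (hlen : eVariationOn γ (Set.Icc 0 1) ≠ ⊤)
    (U : Set ℂ) (hU : IsOpen U) (hUΩ : U ⊆ Ω) (hγU : γ '' Set.Ico 0 1 ⊆ U)
    (y₁ y₂ : ℂ → ℂ) (hy₁ : AnalyticOnNhd ℂ y₁ U) (hy₂ : AnalyticOnNhd ℂ y₂ U)
    (hode : ∀ z ∈ U,
      deriv y₁ z = Fn₁ M N α z (y₁ z) (y₂ z) ∧
      deriv y₂ z = Fn₂ M N α z (y₁ z) (y₂ z))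
    -- `z_∞ = γ 1` is a movable singularity: no analytic continuation to `γ 1`
    (hsing : ¬ ∃ (V : Set ℂ) (Y₁ Y₂ : ℂ → ℂ), IsOpen V ∧ γ 1 ∈ V ∧
      AnalyticOnNhd ℂ Y₁ V ∧ AnalyticOnNhd ℂ Y₂ V ∧
      (∀ z ∈ V,
        deriv Y₁ z = Fn₁ M N α z (Y₁ z) (Y₂ z) ∧
        deriv Y₂ z = Fn₂ M N α z (Y₁ z) (Y₂ z)) ∧
      ∃ δ > (0 : ℝ), ∀ s : ℝ, 1 - δ < s → s < 1 →
        Y₁ (γ s) = y₁ (γ s) ∧ Y₂ (γ s) = y₂ (γ s))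
    -- `1/y₁` and `1/y₂` are bounded on `γ`
    (hbd : ∃ B : ℝ, ∀ s ∈ Set.Ico (0 : ℝ) 1,
      ‖(y₁ (γ s))⁻¹‖ ≤ B ∧ ‖(y₂ (γ s))⁻¹‖ ≤ B) :
    ∃ γ' : ℝ → ℂ,
      ContinuousOn γ' (Set.Ico 0 1) ∧
      γ' 0 = γ 0 ∧
      Tendsto γ' (𝓝[<] (1 : ℝ)) (𝓝 (γ 1)) ∧
      γ' '' Set.Ico 0 1 ⊆ U ∧
      eVariationOn γ' (Set.Ico 0 1) ≠ ⊤ ∧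
      ∀ k l : ℕ, k * (M + 1) ≤ l * (N + 1) →
        ∃ B : ℝ, ∀ s ∈ Set.Ico (0 : ℝ) 1,
          ‖y₂ (γ' s) ^ k / y₁ (γ' s) ^ l‖ ≤ B := by
  have h0 : ∀ s ∈ Set.Ico (0 : ℝ) 1, γ s ∈ U := fun s hs => hγU ⟨s, hs, rfl⟩
  have hS : SCM.Sys M N α U y₁ y₂ :=
    { hU := hU
      hα := fun p hp z hz => (hα p hp z (hUΩ hz)).differentiableAt
      h1 := fun z hz => by
        rw [← (hode z hz).1]; exact (hy₁ z hz).differentiableAt.hasDerivAt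
      h2 := fun z hz => by
        rw [← (hode z hz).2]; exact (hy₂ z hz).differentiableAt.hasDerivAt }
  obtain ⟨B, hB⟩ := hbd
  have h1 : (1 : ℝ) ∈ Set.Icc (0 : ℝ) 1 := by simp
  refine ⟨γ, hγc.mono Set.Ico_subset_Icc_self, rfl, ?_, hγU, ?_, ?_⟩
  · have h := (hγc 1 h1).mono_left (nhdsWithin_mono 1 (show Set.Ico (0 : ℝ) 1 ⊆ Set.Icc 0 1 from Set.Ico_subset_Icc_self))
    rwa [nhdsWithin_Ico_eq_nhdsLT zero_lt_one] at h
  · exact ne_top_of_le_ne_top hlen (eVariationOn.mono γ Set.Ico_subset_Icc_self)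
  · intro k l hkl
    exact SCM.final hM (hM.trans hMN) (fun p hp => hα p hp _ (hγΩ ⟨1, h1, rfl⟩)) hγc hlen hS h0
      (fun s hs => (hB s hs).1) k l hkl
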